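/- Let k be a field of characteristic 3 and let G = Alt(7) be the alternating group on 7 letters. Then every simple kG-module is algebraic. -/

import Mathlib

open CategoryTheory CategoryTheory.MonoidalCategory

namespace AlgebraicModule

variable {k G : Type} [Field k] [Monoid G]

/-- `N` is a direct summand of `M`, i.e. a retract of `M`. -/
def IsSummand (N M : FDRep k G) : Prop :=
  ∃ (i : N ⟶ M) (r : M ⟶ N), i ≫ r = 𝟙 N

/-- `M` is an indecomposable module: it is nonzero and is not the direct sum of two
nonzero submodules (equivalently, its only idempotent endomorphisms are `0` and `1`). -/
def Indecomposable (M : FDRep k G) : Prop :=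
  ¬ Limits.IsZero M ∧ ∀ e : M ⟶ M, e ≫ e = e → e = 0 ∨ e = 𝟙 M

/-- `tensorPow M n` is the tensor power `M^{⊗ (n + 1)}`, with diagonal `G`-action. -/
noncomputable def tensorPow (M : FDRep k G) : ℕ → FDRep k G
  | 0 => M
  | n + 1 => tensorPow M n ⊗ M

/-- `M` is algebraic: only finitely many isomorphism classes of indecomposable modules
occur as direct summands of the tensor powers `M^{⊗ n}` for `n ≥ 1`. -/
noncomputable def IsAlgebraic (M : FDRep k G) : Prop :=
  ∃ L : List (FDRep k G), ∀ N : FDRep k G, Indecomposable N →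
    (∃ n : ℕ, IsSummand N (tensorPow M n)) → ∃ N' ∈ L, Nonempty (N ≅ N')

end AlgebraicModule

open AlgebraicModule

set_option linter.all false
namespace A7
section cat
variable {C : Type*} [Category C] [Preadditive C]
def Fact (Z : C → Prop) (X Y : C) : AddSubgroup (X ⟶ Y) :=
  AddSubgroup.closure {f | ∃ z, Z z ∧ ∃ (a : X ⟶ z) (b : z ⟶ Y), f = a ≫ b}
def InAdd (Z : C → Prop) (X : C) : Prop := 𝟙 X ∈ Fact Z X X
variable {Z Z' : C → Prop} {X Y W : C}
theorem fact_mem {z : C} (hz : Z z) (a : X ⟶ z) (b : z ⟶ Y) : a ≫ b ∈ Fact Z X Y :=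
  AddSubgroup.subset_closure ⟨z, hz, a, b, rfl⟩
theorem fact_left (f : X ⟶ Y) {g : Y ⟶ W} (h : g ∈ Fact Z Y W) : f ≫ g ∈ Fact Z X W := by
  refine AddSubgroup.closure_induction (p := fun g _ => f ≫ g ∈ Fact Z X W) ?_ ?_ ?_ ?_ h
  · rintro _ ⟨z, hz, a, b, rfl⟩
    rw [← Category.assoc]; exact fact_mem hz _ _
  · simp [zero_mem]
  · intro a b _ _ ha hb; rw [Preadditive.comp_add]; exact add_mem ha hb
  · intro a _ ha; rw [Preadditive.comp_neg]; exact neg_mem ha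
theorem fact_right {g : X ⟶ Y} (f : Y ⟶ W) (h : g ∈ Fact Z X Y) : g ≫ f ∈ Fact Z X W := by
  refine AddSubgroup.closure_induction (p := fun g _ => g ≫ f ∈ Fact Z X W) ?_ ?_ ?_ ?_ h
  · rintro _ ⟨z, hz, a, b, rfl⟩
    rw [Category.assoc]; exact fact_mem hz _ _
  · simp [zero_mem]
  · intro a b _ _ ha hb; rw [Preadditive.add_comp]; exact add_mem ha hb
  · intro a _ ha; rw [Preadditive.neg_comp]; exact neg_mem ha
theorem InAdd.of_mem (h : Z X) : InAdd Z X := by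
  have := fact_mem h (𝟙 X) (𝟙 X)
  rwa [Category.comp_id] at this
theorem InAdd.retract (hY : InAdd Z Y) (i : X ⟶ Y) (r : Y ⟶ X) (h : i ≫ r = 𝟙 X) : InAdd Z X := by
  have := fact_left i (fact_right r hY)
  rw [Category.id_comp, h] at this
  exact this
theorem InAdd.iso (hY : InAdd Z Y) (e : X ≅ Y) : InAdd Z X := hY.retract e.hom e.inv e.hom_inv_id
theorem fact_trans {f : X ⟶ Y} (h : f ∈ Fact Z X Y) (hZ : ∀ z, Z z → InAdd Z' z) : f ∈ Fact Z' X Y := by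
  refine AddSubgroup.closure_induction (p := fun g _ => g ∈ Fact Z' X Y) ?_ ?_ ?_ ?_ h
  · rintro _ ⟨z, hz, a, b, rfl⟩
    have := fact_left a (fact_right b (hZ z hz))
    rwa [Category.id_comp] at this
  · exact zero_mem _
  · intro a b _ _ ha hb; exact add_mem ha hb
  · intro a _ ha; exact neg_mem ha
theorem InAdd.trans (h : InAdd Z X) (hZ : ∀ z, Z z → InAdd Z' z) : InAdd Z' X := fact_trans h hZ
theorem InAdd.mono (h : InAdd Z X) (hZ : ∀ z, Z z → Z' z) : InAdd Z' X :=
  h.trans fun z hz => .of_mem (hZ z hz)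
theorem InAdd.of_sum {ι : Type*} (s : Finset ι) (z : ι → C) (a : ∀ i, X ⟶ z i) (b : ∀ i, z i ⟶ X)
    (h : ∑ i ∈ s, a i ≫ b i = 𝟙 X) (hz : ∀ i ∈ s, InAdd Z (z i)) : InAdd Z X := by
  unfold InAdd
  rw [← h]
  refine sum_mem fun i hi => ?_
  have := fact_left (a i) (fact_right (b i) (hz i hi))
  rwa [Category.id_comp] at this
theorem InAdd.of_two {z1 z2 : C} (a : X ⟶ z1) (b : z1 ⟶ X) (a' : X ⟶ z2) (b' : z2 ⟶ X)
    (h : a ≫ b + a' ≫ b' = 𝟙 X) (hz : InAdd Z z1) (hz' : InAdd Z z2) : InAdd Z X := by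
  unfold InAdd
  rw [← h]
  refine add_mem ?_ ?_
  · have := fact_left a (fact_right b hz)
    rwa [Category.id_comp] at this
  · have := fact_left a' (fact_right b' hz')
    rwa [Category.id_comp] at this
theorem fact_map {D : Type*} [Category D] [Preadditive D] (F : C ⥤ D) [F.Additive] {Z' : D → Prop}
    {f : X ⟶ Y} (h : f ∈ Fact Z X Y)
    (hZ : ∀ z, Z z → InAdd Z' (F.obj z)) : F.map f ∈ Fact Z' (F.obj X) (F.obj Y) := by
  refine AddSubgroup.closure_induction (p := fun g _ => F.map g ∈ Fact Z' (F.obj X) (F.obj Y)) ?_ ?_ ?_ ?_ h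
  · rintro _ ⟨z, hz, a, b, rfl⟩
    have := fact_left (F.map a) (fact_right (F.map b) (hZ z hz))
    rwa [Category.id_comp, ← F.map_comp] at this
  · rw [F.map_zero]; exact zero_mem _
  · intro a b _ _ ha hb; rw [F.map_add]; exact add_mem ha hb
  · intro a _ ha; rw [F.map_neg]; exact neg_mem ha
theorem InAdd.map {D : Type*} [Category D] [Preadditive D] (F : C ⥤ D) [F.Additive] {Z' : D → Prop}
    (h : InAdd Z X) (hZ : ∀ z, Z z → InAdd Z' (F.obj z)) : InAdd Z' (F.obj X) := by
  have := fact_map F h hZ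
  rwa [F.map_id] at this
variable [MonoidalCategory C] [MonoidalPreadditive C]
theorem InAdd.tensorRight (h : InAdd Z X) (Y : C) (hZ : ∀ z, Z z → InAdd Z' (z ⊗ Y)) :
    InAdd Z' (X ⊗ Y) := h.map (MonoidalCategory.tensorRight Y) hZ
theorem InAdd.tensorLeft (h : InAdd Z X) (Y : C) (hZ : ∀ z, Z z → InAdd Z' (Y ⊗ z)) :
    InAdd Z' (Y ⊗ X) := h.map (MonoidalCategory.tensorLeft Y) hZ
theorem InAdd.tensor {Z1 Z2} (h : InAdd Z1 X) (h2 : InAdd Z2 Y)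
   (hZ : ∀ z, Z1 z → ∀ z2, Z2 z2 → InAdd Z' (z ⊗ z2)) :
    InAdd Z' (X ⊗ Y) := h.tensorRight Y fun z hz => h2.tensorLeft z fun z2 hz2 => hZ z hz z2 hz2
end cat

section lin
variable {k G : Type} [CommRing k] [Monoid G]
def toLin {X Y : FDRep k G} (f : X ⟶ Y) : X →ₗ[k] Y := f.hom.hom.hom
theorem toLin_comm {X Y : FDRep k G} (f : X ⟶ Y) (g : G) (v : X) : toLin f (X.ρ g v) = Y.ρ g (toLin f v) := by
  have := f.comm g
  exact ConcreteCategory.congr_hom this v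
def mkHom {X Y : FDRep k G} (l : X →ₗ[k] Y) (h : ∀ g v, l (X.ρ g v) = Y.ρ g (l v)) : X ⟶ Y :=
  ⟨InducedCategory.homMk (ModuleCat.ofHom l), fun g => by
    ext v
    exact h g v⟩
theorem toLin_mkHom {X Y : FDRep k G} (l : X →ₗ[k] Y) (h) : toLin (mkHom l h) = l := rfl
theorem toLin_comp {X Y Z : FDRep k G} (f : X ⟶ Y) (g : Y ⟶ Z) : toLin (f ≫ g) = toLin g ∘ₗ toLin f := rfl
theorem toLin_id {X  : FDRep k G} : toLin (𝟙 X) = LinearMap.id := rfl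
theorem toLin_add {X Y : FDRep k G} (f g: X ⟶ Y) : toLin (f+g) = toLin f + toLin g := rfl
theorem toLin_zero {X Y : FDRep k G}  : toLin (0: X ⟶ Y) = 0 := rfl
theorem toLin_inj {X Y : FDRep k G} {f g: X ⟶ Y} (h : toLin f = toLin g) : f = g := by
  ext v
  exact LinearMap.congr_fun h v
theorem tensor_ρ (X Y : FDRep k G) (g : G) : (X ⊗ Y).ρ g = TensorProduct.map (X.ρ g) (Y.ρ g) := rfl
def toLinHom (X Y : FDRep k G) : (X ⟶ Y) →+ (X →ₗ[k] Y) where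
  toFun := toLin
  map_zero' := rfl
  map_add' _ _ := rfl
theorem toLin_sum {X Y : FDRep k G} {ι : Type*} (s : Finset ι) (f : ι → (X ⟶ Y)) :
    toLin (∑ i ∈ s, f i) = ∑ i ∈ s, toLin (f i) := map_sum (toLinHom X Y) _ _
theorem toLin_smul {X Y : FDRep k G} (c : k) (f : X ⟶ Y) : toLin (c • f) = c • toLin f := rfl
def mkIso {X Y : FDRep k G} (l : X ≃ₗ[k] Y) (h : ∀ g v, l (X.ρ g v) = Y.ρ g (l v)) : X ≅ Y where
  hom := mkHom l.toLinearMap h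
  inv := mkHom l.symm.toLinearMap (fun g v => by
    apply l.injective
    simp [h])
  hom_inv_id := toLin_inj (by ext v; simp [toLin_comp, toLin_mkHom, toLin_id])
  inv_hom_id := toLin_inj (by ext v; simp [toLin_comp, toLin_mkHom, toLin_id])
end lin

section fld
variable {k G : Type} [Field k] [Monoid G]
noncomputable def subrep (X : FDRep k G) (W : Submodule k X) (h : ∀ g, ∀ v ∈ W, X.ρ g v ∈ W) : FDRep k G :=
  FDRep.of (V := W)
   { toFun := fun g => (X.ρ g).restrict (h g)
     map_one' := by ext v; simp
     map_mul' := fun a b => by ext v; simp }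
noncomputable def subrepι (X : FDRep k G) (W : Submodule k X) (h : ∀ g, ∀ v ∈ W, X.ρ g v ∈ W) : subrep X W h ⟶ X :=
  mkHom W.subtype (fun g v => rfl)

theorem isUnit_or_nilp {X : FDRep k G} (hX : AlgebraicModule.Indecomposable X) (f : X ⟶ X) :
   IsIso f ∨ IsIso (𝟙 X - f) := by
  let F : End X := f
  let R := Algebra.adjoin k ({F} : Set (End X))
  have : Module.Finite k (End X) := inferInstanceAs (Module.Finite k (X ⟶ X))
  have : Module.Finite k R := inferInstance
  have : IsArtinian R R := isArtinian_of_tower k inferInstance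
  let x : R := ⟨F, Algebra.self_mem_adjoin_singleton k F⟩
  letI : CommRing R := Algebra.adjoinCommRingOfComm k (by
    intro a ha b hb
    rw [Set.mem_singleton_iff] at ha hb; rw [ha, hb])
  have huni : ∀ y : R, IsUnit y → IsIso (show X ⟶ X from (y : End X)) := by
    rintro _ ⟨u, rfl⟩
    refine ⟨(u⁻¹.val : R).1, ?_, ?_⟩
    · have : u⁻¹.val * u.val = 1 := by simp
      exact congrArg Subtype.val this
    · have : u.val * u⁻¹.val = 1 := by simp
      exact congrArg Subtype.val this
  obtain ⟨n, y, hy⟩ := IsArtinian.exists_pow_succ_smul_dvd x (1 : R)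
  have hy : x ^ (n+1) * y = x ^ n := by simpa using hy
  have h2 : ∀ m, x ^ n = x ^ (n + m) * y ^ m := by
    intro m
    induction m with
    | zero => simp
    | succ m ih => rw [ih]; calc _ = x ^ m * (x ^ n) * y^m := by ring
                      _ = _ := by rw [← hy]; ring
  have hid : (x ^ n * y ^ n) * (x ^ n * y ^ n) = x ^ n * y ^ n := by
    calc _ = (x ^ (n+n) * y ^ n) * y ^ n := by ring
      _ = _ := by rw [← h2]
  rcases hX.2 (x ^ n * y ^ n : R).1 (congrArg Subtype.val hid) with h | h
  · right
    have h0 : x ^ n * y ^ n = 0 := Subtype.ext h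
    have hn : x ^ n = 0 := by rw [h2 n, pow_add, mul_assoc, h0, mul_zero]
    exact huni (1 - x) (IsNilpotent.isUnit_one_sub ⟨n, hn⟩)
  · left
    have h0 : x ^ n * y ^ n = 1 := Subtype.ext h
    apply huni x
    apply IsUnit.of_mul_eq_one y
    calc x * y = (x ^ n * y ^ n) * (x * y) := by rw [h0, one_mul]
      _ = (x^(n+1) * y) * y ^ n := by ring
      _ = 1 := by rw [hy, h0]

theorem exists_factor {X : FDRep k G} (hX : AlgebraicModule.Indecomposable X) {Z : FDRep k G → Prop} (h : InAdd Z X) :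
   ∃ z, Z z ∧ IsSummand X z := by
  by_contra hcon
  have : ∀ f ∈ Fact Z X X, ¬ IsIso f := by
    intro f hf
    refine AddSubgroup.closure_induction (p := fun g _ => ¬ IsIso g) ?_ ?_ ?_ ?_ hf
    · rintro _ ⟨z, hz, a, b, rfl⟩ hi
      exact hcon ⟨z, hz, a, b ≫ inv (a ≫ b), by rw [← Category.assoc]; exact IsIso.hom_inv_id _⟩
    · intro h0
      apply hX.1
      rw [Limits.IsZero.iff_id_eq_zero]
      have := (IsIso.hom_inv_id (0 : X ⟶ X)).symm
      rwa [Limits.zero_comp] at this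
    · intro a b _ _ ha hb hab
      rcases isUnit_or_nilp hX (a ≫ inv (a + b)) with h1 | h1
      · apply ha
        have : a = (a ≫ inv (a+b)) ≫ (a+b) := by rw [Category.assoc, IsIso.inv_hom_id, Category.comp_id]
        rw [this]; infer_instance
      · apply hb
        have : b = (𝟙 X - a ≫ inv (a+b)) ≫ (a+b) := by rw [Preadditive.sub_comp, Category.assoc, IsIso.inv_hom_id, Category.comp_id, Category.id_comp, add_sub_cancel_left]
        rw [this]; infer_instance
    · intro a _ ha hb
      apply ha
      have : a = (-a) ≫ (-𝟙 X) := by simp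
      rw [this]
      have : IsIso (-𝟙 X) := ⟨-𝟙 X, by simp, by simp⟩
      infer_instance
  exact this _ h inferInstance
end fld
end A7

namespace A7
section fld
variable {k G : Type} [Field k] [Monoid G]
theorem idem_split {Y : FDRep k G} (e : Y ⟶ Y) (he : e ≫ e = e) (h1 : e ≠ 𝟙 Y) :
    ∃ (W : FDRep k G) (i : W ⟶ Y) (r : Y ⟶ W), r ≫ i = e ∧ Module.finrank k W < Module.finrank k Y := by
  have hinv : ∀ g, ∀ v ∈ LinearMap.range (toLin e), Y.ρ g v ∈ LinearMap.range (toLin e) := by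
    rintro g _ ⟨v, rfl⟩
    exact ⟨Y.ρ g v, toLin_comm e g v⟩
  refine ⟨subrep Y _ hinv, subrepι Y _ hinv, mkHom (toLin e).rangeRestrict ?_, ?_, ?_⟩
  · intro g v
    apply Subtype.ext
    exact toLin_comm e g v
  · apply toLin_inj
    rfl
  · apply Submodule.finrank_lt
    intro htop
    apply h1
    apply toLin_inj
    rw [toLin_id]
    apply LinearMap.ext
    intro v
    have : v ∈ LinearMap.range (toLin e) := htop ▸ Submodule.mem_top
    obtain ⟨w, rfl⟩ := this
    exact LinearMap.congr_fun (congrArg toLin he) w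

theorem fin_summands (n : ℕ) : ∀ Y : FDRep k G, Module.finrank k Y < n →
    ∃ L : List (FDRep k G), ∀ X, AlgebraicModule.Indecomposable X → IsSummand X Y → ∃ N' ∈ L, Nonempty (X ≅ N') := by
  induction n with
  | zero => intro Y h; omega
  | succ n ih =>
    intro Y hY
    by_cases hi : ∀ e : Y ⟶ Y, e ≫ e = e → e = 0 ∨ e = 𝟙 Y
    · refine ⟨[Y], ?_⟩
      rintro X hX ⟨i, r, h⟩
      refine ⟨Y, by simp, ⟨⟨i, r, h, ?_⟩⟩⟩
      rcases hi (r ≫ i) (by rw [Category.assoc, ← Category.assoc i, h, Category.id_comp]) with h0 | h0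
      · exfalso
        apply hX.1
        rw [Limits.IsZero.iff_id_eq_zero]
        calc 𝟙 X = (i ≫ r) ≫ (i ≫ r) := by rw [h, Category.comp_id]
          _ = i ≫ (r ≫ i) ≫ r := by simp only [Category.assoc]
          _ = 0 := by rw [h0, Limits.zero_comp, Limits.comp_zero]
      · exact h0
    · push Not at hi
      obtain ⟨e, he, h0, h1⟩ := hi
      obtain ⟨W, i, r, hr, hd⟩ := idem_split e he h1
      obtain ⟨W', i', r', hr', hd'⟩ := idem_split (𝟙 Y - e) (by simp [he]) (by simpa using h0)
      obtain ⟨L, hL⟩ := ih W (by omega)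
      obtain ⟨L', hL'⟩ := ih W' (by omega)
      refine ⟨L ++ L', ?_⟩
      rintro X hX ⟨a, b, h⟩
      have hin : InAdd (fun z => z = W ∨ z = W') X := by
        refine InAdd.retract (Y := Y) ?_ a b h
        refine InAdd.of_two r i r' i' ?_ (.of_mem (.inl rfl)) (.of_mem (.inr rfl))
        rw [hr, hr']; simp
      obtain ⟨z, rfl | rfl, hz⟩ := exists_factor hX hin
      · obtain ⟨N, hN, h⟩ := hL X hX hz
        exact ⟨N, by simp [hN], h⟩
      · obtain ⟨N, hN, h⟩ := hL' X hX hz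
        exact ⟨N, by simp [hN], h⟩
end fld

section T1
variable {k G P : Type} [Field k] [Group G] [Group P] [Finite G] (φ : P →* G)

noncomputable def coindRep (z : FDRep k P) : FDRep k G := FDRep.of (Representation.coind φ z.ρ)


noncomputable def resA {X : FDRep k G} {z : FDRep k P} (a : (Action.res _ φ).obj X ⟶ z) : X →ₗ[k] z := toLin a
noncomputable def resB {X : FDRep k G} {z : FDRep k P} (a : z ⟶ (Action.res _ φ).obj X) : z →ₗ[k] X := toLin a
noncomputable def resL {X Y : FDRep k G} (a : (Action.res _ φ).obj X ⟶ (Action.res _ φ).obj Y) : X →ₗ[k] Y :=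
  toLin (X := (Action.res _ φ).obj X) (Y := (Action.res _ φ).obj Y) a
variable {φ}
theorem resA_comm {X : FDRep k G} {z : FDRep k P} (a : (Action.res _ φ).obj X ⟶ z) (p : P) (v : X) :
    resA φ a (X.ρ (φ p) v) = z.ρ p (resA φ a v) := toLin_comm a p v
theorem resB_comm {X : FDRep k G} {z : FDRep k P} (a : z ⟶ (Action.res _ φ).obj X) (p : P) (v : z) :
    resB φ a (z.ρ p v) = X.ρ (φ p) (resB φ a v) := toLin_comm a p v
theorem resL_comm {X Y : FDRep k G} (a : (Action.res _ φ).obj X ⟶ (Action.res _ φ).obj Y) (p : P) (v : X) :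
    resL φ a (X.ρ (φ p) v) = Y.ρ (φ p) (resL φ a v) :=
   toLin_comm (X := (Action.res _ φ).obj X) (Y := (Action.res _ φ).obj Y) a p v
theorem ρρ {k G : Type} [CommRing k] [Monoid G] (X : FDRep k G) (g h : G) (v : X) : X.ρ g (X.ρ h v) = X.ρ (g * h) v := by
  rw [map_mul]; rfl
variable (φ)

noncomputable def hatA {X : FDRep k G} {z : FDRep k P} (a : (Action.res _ φ).obj X ⟶ z) : X ⟶ coindRep φ z :=
  mkHom (X := X) (Y := coindRep φ z) (LinearMap.codRestrict (Representation.coindV φ z.ρ) (LinearMap.pi fun g => resA φ a ∘ₗ (X.ρ g)) (by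
    intro x p g
    have := resA_comm a p (X.ρ g x)
    rw [LinearMap.pi_apply, LinearMap.pi_apply, map_mul]
    exact this)) (by
    intro g v
    apply Subtype.ext
    funext h
    show resA φ a (X.ρ h (X.ρ g v)) = resA φ a (X.ρ (h * g) v)
    rw [ρρ])

noncomputable def trL {A B : Type*} [AddCommGroup A] [Module k A] [AddCommGroup B] [Module k B]
   (f : G → A →ₗ[k] B) : A →ₗ[k] B := by
  classical
  letI := Fintype.ofFinite (G ⧸ φ.range)
  exact ∑ c : G ⧸ φ.range, f c.out

theorem trL_apply {A B : Type*} [AddCommGroup A] [Module k A] [AddCommGroup B] [Module k B]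
   [Fintype (G ⧸ φ.range)] (f : G → A →ₗ[k] B) (v : A) : trL φ f v = ∑ c : G ⧸ φ.range, f c.out v := by
  classical
  unfold trL
  rw [LinearMap.sum_apply]
  convert rfl

theorem out_sum {B : Type*} [AddCommGroup B] [Fintype (G ⧸ φ.range)] (f : G → B)
   (h : ∀ g p, f (g * φ p) = f g) (x : G) :
   ∑ c : G ⧸ φ.range, f (x * c.out) = ∑ c : G ⧸ φ.range, f c.out := by
  have key : ∀ g, f (Quotient.out (QuotientGroup.mk (s := φ.range) g)) = f g := by
    intro g
    obtain ⟨⟨_, p, rfl⟩, hp⟩ := QuotientGroup.mk_out_eq_mul φ.range g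
    rw [hp]; exact h g p
  refine Fintype.sum_equiv (MulAction.toPerm x) _ _ ?_
  intro c
  induction c using QuotientGroup.induction_on with
  | H g =>
    have : (MulAction.toPerm x : Equiv.Perm (G ⧸ φ.range)) (QuotientGroup.mk g) = QuotientGroup.mk (x * g) := rfl
    rw [this, key]
    obtain ⟨⟨_, p, rfl⟩, hp⟩ := QuotientGroup.mk_out_eq_mul φ.range g
    rw [hp, ← mul_assoc]; exact (h _ p)

theorem trL_comm {A B : Type*} [AddCommGroup A] [Module k A] [AddCommGroup B] [Module k B]
   (ρA : Representation k G A) (ρB : Representation k G B) (f : G → A →ₗ[k] B)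
   (h1 : ∀ g p, f (g * φ p) = f g) (h2 : ∀ g c v, f (g * c) (ρA g v) = ρB g (f c v)) (g : G) (v : A) :
   trL φ f (ρA g v) = ρB g (trL φ f v) := by
  classical
  letI := Fintype.ofFinite (G ⧸ φ.range)
  rw [trL_apply, trL_apply, map_sum]
  rw [← out_sum φ (fun c => f c (ρA g v)) (fun c p => by rw [h1]) g]
  exact Finset.sum_congr rfl fun c _ => h2 _ _ _

noncomputable def fB {X : FDRep k G} {z : FDRep k P} (b : z ⟶ (Action.res _ φ).obj X) (g : G) :
   Representation.coindV φ z.ρ →ₗ[k] X :=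
   (X.ρ g) ∘ₗ (resB φ b) ∘ₗ (LinearMap.proj g⁻¹) ∘ₗ (Representation.coindV φ z.ρ).subtype

noncomputable def hatB {X : FDRep k G} {z : FDRep k P} (b : z ⟶ (Action.res _ φ).obj X) : coindRep φ z ⟶ X :=
  mkHom (X := coindRep φ z) (Y := X)
   (trL φ (fB φ b)) (by
    refine trL_comm φ (Representation.coind φ z.ρ) X.ρ _ ?_ ?_
    · intro c p
      apply LinearMap.ext
      rintro ⟨v, hv⟩
      have h1 : v (c * φ p)⁻¹ = z.ρ p⁻¹ (v c⁻¹) := by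
         have := hv p⁻¹ c⁻¹
         rw [← this]; congr 1; simp
      change X.ρ (c * φ p) (resB φ b (v (c * φ p)⁻¹)) = X.ρ c (resB φ b (v c⁻¹))
      rw [h1, resB_comm, ρρ]; simp
    · rintro g c ⟨v, hv⟩
      change X.ρ (g * c) (resB φ b (v ((g * c)⁻¹ * g))) = X.ρ g (X.ρ c (resB φ b (v c⁻¹)))
      rw [ρρ]; simp)

noncomputable def fT {X : FDRep k G} (f : (Action.res _ φ).obj X ⟶ (Action.res _ φ).obj X) (g : G) : X →ₗ[k] X :=
   X.ρ g ∘ₗ resL φ f ∘ₗ X.ρ g⁻¹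

noncomputable def TrHom {X : FDRep k G} (f : (Action.res _ φ).obj X ⟶ (Action.res _ φ).obj X) : X ⟶ X :=
  mkHom (trL φ (fT φ f)) (by
    refine trL_comm φ X.ρ X.ρ _ ?_ ?_
    · intro c p
      apply LinearMap.ext
      intro v
      change X.ρ (c * φ p) (resL φ f (X.ρ (c * φ p)⁻¹ v)) = X.ρ c (resL φ f (X.ρ c⁻¹ v))
      rw [mul_inv_rev, ← map_inv, ← ρρ X _ c⁻¹, resL_comm, ρρ]; simp
    · rintro g c v
      change X.ρ (g * c) (resL φ f (X.ρ ((g * c)⁻¹) (X.ρ g v))) = X.ρ g (X.ρ c (resL φ f (X.ρ c⁻¹ v)))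
      rw [ρρ, ρρ]; simp)

theorem TrHom_apply {X : FDRep k G} [Fintype (G ⧸ φ.range)] (f : (Action.res _ φ).obj X ⟶ (Action.res _ φ).obj X) (v : X) :
    toLin (TrHom φ f) v = ∑ c : G ⧸ φ.range, X.ρ c.out (resL φ f (X.ρ c.out⁻¹ v)) := by
  exact trL_apply φ _ v

theorem hatB_apply {X : FDRep k G} [Fintype (G ⧸ φ.range)] {z : FDRep k P} (b : z ⟶ (Action.res _ φ).obj X) (v : Representation.coindV φ z.ρ) :
    toLin (hatB φ b) v = ∑ c : G ⧸ φ.range, X.ρ c.out (resB φ b (v.1 c.out⁻¹)) := by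
  exact trL_apply φ _ v

theorem TrHom_add {X : FDRep k G} (f g : (Action.res _ φ).obj X ⟶ (Action.res _ φ).obj X) :
    TrHom φ (f + g) = TrHom φ f + TrHom φ g := by
  classical
  letI := Fintype.ofFinite (G ⧸ φ.range)
  apply toLin_inj; apply LinearMap.ext; intro v
  rw [toLin_add, LinearMap.add_apply, TrHom_apply, TrHom_apply, TrHom_apply, ← Finset.sum_add_distrib]
  refine Finset.sum_congr rfl fun c _ => ?_
  rw [← map_add]; rfl
noncomputable def TrHomHom (X : FDRep k G) : ((Action.res _ φ).obj X ⟶ (Action.res _ φ).obj X) →+ (X ⟶ X) :=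
  AddMonoidHom.mk' (TrHom φ) (TrHom_add φ)

theorem inAdd_coind {X : FDRep k G} (hidx : (φ.range.index : k) ≠ 0) {Z : FDRep k P → Prop}
    (h : InAdd Z ((Action.res _ φ).obj X)) : InAdd (fun y => ∃ z, Z z ∧ y = coindRep φ z) X := by
  classical
  letI := Fintype.ofFinite (G ⧸ φ.range)
  have key : ∀ f ∈ Fact Z ((Action.res _ φ).obj X) ((Action.res _ φ).obj X),
     TrHomHom φ X f ∈ Fact (fun y => ∃ z, Z z ∧ y = coindRep φ z) X X := by
    intro f hf
    refine AddSubgroup.closure_induction (p := fun g _ => TrHomHom φ X g ∈ Fact (fun y => ∃ z, Z z ∧ y = coindRep φ z) X X) ?_ ?_ ?_ ?_ hf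
    · rintro _ ⟨z, hz, a, b, rfl⟩
      have := fact_mem (Z := fun y => ∃ z, Z z ∧ y = coindRep φ z) ⟨z, hz, rfl⟩ (hatA φ a) (hatB φ b)
      convert this using 1
      apply toLin_inj; apply LinearMap.ext; intro v
      exact (TrHom_apply φ _ _).trans (hatB_apply φ b (toLin (hatA φ a) v)).symm
    · rw [map_zero]; exact zero_mem _
    · intro a b _ _ ha hb; rw [map_add]; exact add_mem ha hb
    · intro a _ ha; rw [map_neg]; exact neg_mem ha
  have h1 : TrHomHom φ X (𝟙 _) = (φ.range.index : k) • 𝟙 X := by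
    apply toLin_inj; apply LinearMap.ext; intro v
    refine (TrHom_apply φ _ _).trans ?_
    rw [toLin_smul, toLin_id, LinearMap.smul_apply, LinearMap.id_apply]
    rw [Finset.sum_congr rfl (g := fun _ => v)]
    · rw [Finset.sum_const, Finset.card_univ, ← Nat.card_eq_fintype_card]
      rw [Nat.cast_smul_eq_nsmul]; rfl
    · intro c _
      change X.ρ _ (X.ρ _ v) = v
      rw [ρρ]; simp
  have h2 := fact_left ((φ.range.index : k)⁻¹ • 𝟙 X) (key _ h)
  rw [h1] at h2
  unfold InAdd
  convert h2 using 1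
  simp [smul_smul, hidx]

/-- `Good`: the restriction to `P` generates a finite additive set under tensoring. -/
def Good (M : FDRep k P) : Prop :=
  ∃ L : List (FDRep k P), InAdd (· ∈ L) M ∧ ∀ z ∈ L, InAdd (· ∈ L) (z ⊗ M)

theorem Good.retract {M N : FDRep k P} (h : Good N) (i : M ⟶ N) (r : N ⟶ M) (hr : i ≫ r = 𝟙 M) : Good M := by
  obtain ⟨L, h1, h2⟩ := h
  refine ⟨L, h1.retract i r hr, fun z hz => (h2 z hz).retract (z ◁ i) (z ◁ r) ?_⟩
  rw [← MonoidalCategory.whiskerLeft_comp, hr, MonoidalCategory.whiskerLeft_id]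

theorem algebraic_of_good (M : FDRep k G) (hidx : (φ.range.index : k) ≠ 0)
    (h : Good ((Action.res _ φ).obj M)) : IsAlgebraic M := by
  obtain ⟨L, h1, h2⟩ := h
  have hpow : ∀ n, InAdd (· ∈ L) ((Action.res _ φ).obj (tensorPow M n)) := by
    intro n
    induction n with
    | zero => exact h1
    | succ n ih => exact ih.tensorRight ((Action.res _ φ).obj M) h2
  have hfin : ∀ z : FDRep k P, ∃ L' : List (FDRep k G), ∀ X, AlgebraicModule.Indecomposable X → IsSummand X (coindRep φ z) → ∃ N' ∈ L', Nonempty (X ≅ N') :=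
    fun z => fin_summands _ (coindRep φ z) (Nat.lt_succ_self _)
  choose F hF using hfin
  refine ⟨L.flatMap F, ?_⟩
  rintro X hX ⟨n, i, r, hr⟩
  have h3 : InAdd (· ∈ L) ((Action.res _ φ).obj X) :=
    (hpow n).retract ((Action.res _ φ).map i) ((Action.res _ φ).map r) (by rw [← Functor.map_comp, hr, CategoryTheory.Functor.map_id])
  obtain ⟨_, ⟨z, hz, rfl⟩, hs⟩ := exists_factor hX (inAdd_coind φ hidx h3)
  obtain ⟨N, hN, h⟩ := hF z X hX hs
  exact ⟨N, List.mem_flatMap.2 ⟨z, hz, hN⟩, h⟩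
end T1
end A7

namespace A7
section
variable {k G : Type} [Field k] [Monoid G]
def Inv (X : FDRep k G) (W : Submodule k X) : Prop := ∀ g, ∀ v ∈ W, X.ρ g v ∈ W
def IrrF (X : FDRep k G) : Prop := Nontrivial X ∧ ∀ W : Submodule k X, Inv X W → W = ⊥ ∨ W = ⊤

theorem mono_of_inj {X Y : FDRep k G} (f : X ⟶ Y) (h : Function.Injective (toLin f)) : Mono f := by
  constructor
  intro Z a b hab
  apply toLin_inj
  apply LinearMap.ext
  intro v
  apply h
  exact LinearMap.congr_fun (congrArg toLin hab) v

theorem irr_of_simple {X : FDRep k G} (h : Simple X) : IrrF X := by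
  refine ⟨?_, ?_⟩
  · by_contra hn
    rw [not_nontrivial_iff_subsingleton] at hn
    apply Simple.not_isZero X
    rw [Limits.IsZero.iff_id_eq_zero]
    apply toLin_inj
    apply LinearMap.ext
    intro v
    exact Subsingleton.elim _ _
  · intro W hW
    by_cases h0 : W = ⊥
    · exact .inl h0
    right
    have : Mono (subrepι X W hW) := mono_of_inj _ (fun a b hab => Subtype.ext hab)
    have hi : IsIso (subrepι X W hW) := by
      apply isIso_of_mono_of_nonzero
      intro hz
      apply h0
      rw [Submodule.eq_bot_iff]
      intro v hv
      exact LinearMap.congr_fun (congrArg toLin hz) (⟨v, hv⟩ : W)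
    rw [Submodule.eq_top_iff']
    intro v
    have h1 := LinearMap.congr_fun (congrArg toLin (IsIso.inv_hom_id (subrepι X W hW))) v
    have h2 : toLin (subrepι X W hW) (toLin (inv (subrepι X W hW)) v) = v := h1
    rw [← h2]
    exact Subtype.property (p := fun v => v ∈ W) _

theorem exists_irr_sub (X : FDRep k G) (hX : Nontrivial X) : ∃ (W : Submodule k X) (h : Inv X W), IrrF (subrep X W h) := by
  obtain ⟨W, ⟨hW, hne⟩, hmin⟩ := WellFounded.has_min (wellFounded_lt (α := Submodule k X))
    {W | Inv X W ∧ W ≠ ⊥} ⟨⊤, fun _ _ _ => Submodule.mem_top, top_ne_bot⟩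
  refine ⟨W, hW, ?_, ?_⟩
  · exact Submodule.nontrivial_iff_ne_bot.2 hne
  · intro U hU
    let U' : Submodule k W := U
    by_cases hb : U' = ⊥
    · exact .inl hb
    right
    show U' = ⊤
    have h1 : ¬ (U'.map W.subtype < W) := by
      apply hmin
      refine ⟨?_, ?_⟩
      · rintro g _ ⟨u, hu, rfl⟩
        exact ⟨_, hU g u hu, rfl⟩
      · intro h0
        apply hb
        apply Submodule.map_injective_of_injective W.injective_subtype
        rw [h0, Submodule.map_bot]
    have h2 : U'.map W.subtype = W := by
      by_contra hne
      exact h1 (lt_of_le_of_ne (Submodule.map_subtype_le _ _) hne)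
    apply Submodule.map_injective_of_injective W.injective_subtype
    rw [h2, Submodule.map_subtype_top]

theorem section_of_compl {X M : FDRep k G} (e : X ⟶ M) (he : Function.Surjective (toLin e))
    (U : Submodule k X) (hU : Inv X U) (hc : IsCompl (LinearMap.ker (toLin e)) U) :
    ∃ i : M ⟶ X, i ≫ e = 𝟙 M := by
  have hb : Function.Bijective ((toLin e).domRestrict U) := by
    constructor
    · rw [← LinearMap.ker_eq_bot, LinearMap.ker_eq_bot']
      rintro ⟨u, hu⟩ h
      have : u ∈ LinearMap.ker (toLin e) ⊓ U := ⟨h, hu⟩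
      rw [hc.inf_eq_bot] at this
      exact Subtype.ext this
    · intro m
      obtain ⟨x, rfl⟩ := he m
      have : x ∈ LinearMap.ker (toLin e) ⊔ U := by rw [hc.sup_eq_top]; trivial
      obtain ⟨y, hy, z, hz, rfl⟩ := Submodule.mem_sup.1 this
      refine ⟨⟨z, hz⟩, ?_⟩
      rw [map_add, LinearMap.mem_ker.1 hy, zero_add]; rfl
  let E := LinearEquiv.ofBijective _ hb
  have hE : ∀ m, toLin e (E.symm m).1 = m := fun m => E.apply_symm_apply m
  refine ⟨mkHom (U.subtype ∘ₗ E.symm.toLinearMap) ?_, ?_⟩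
  · intro g m
    have : E.symm (M.ρ g m) = ⟨X.ρ g (E.symm m).1, hU g _ (E.symm m).2⟩ := by
      apply E.injective
      rw [E.apply_symm_apply]
      refine (?_ : _ = toLin e (X.ρ g (E.symm m).1))
      rw [toLin_comm, hE]
    exact congrArg Subtype.val this
  · apply toLin_inj
    apply LinearMap.ext
    exact hE
end

variable {k : Type} [Field k]
abbrev S7 := Equiv.Perm (Fin 7)
abbrev aι : alternatingGroup (Fin 7) →* S7 := (alternatingGroup (Fin 7)).subtype

theorem exists_S7 (M : FDRep k (alternatingGroup (Fin 7))) (hM : Simple M) :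
   ∃ N : FDRep k S7, IrrF N ∧ ∃ (i : M ⟶ (Action.res _ aι).obj N) (r : (Action.res _ aι).obj N ⟶ M), i ≫ r = 𝟙 M := by
  obtain ⟨hnt, hirr⟩ := irr_of_simple hM
  let V := Representation.coindV aι M.ρ
  have hact : ∀ (g : S7) (f : V) (x : S7), (Representation.coind aι M.ρ g f).1 x = f.1 (x * g) := fun g f x => rfl
  have hntV : Nontrivial V := by
    obtain ⟨m, hm⟩ := exists_ne (0 : M)
    classical
    refine ⟨⟨fun g => if h : g ∈ alternatingGroup (Fin 7) then M.ρ ⟨g, h⟩ m else 0, ?_⟩, 0, ?_⟩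
    · intro a g
      by_cases h : g ∈ alternatingGroup (Fin 7)
      · have h2 : aι a * g ∈ alternatingGroup (Fin 7) := mul_mem a.2 h
        refine (dif_pos h2).trans (Eq.trans ?_ (congrArg (M.ρ a) (dif_pos h).symm))
        rw [ρρ]; rfl
      · have h2 : aι a * g ∉ alternatingGroup (Fin 7) := by
          intro h3; exact h ((Subgroup.mul_mem_cancel_left _ a.2).1 h3)
        exact (dif_neg h2).trans (((congrArg (M.ρ a) (dif_neg h)).trans (map_zero _)).symm)
    · intro h0
      have := congrFun (congrArg Subtype.val h0) 1
      apply hm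
      have h2 : M.ρ ⟨1, one_mem _⟩ m = 0 := by
        exact (dif_pos (one_mem _)).symm.trans this
      have h3 : M.ρ 1 m = 0 := h2
      rwa [map_one] at h3
  obtain ⟨W, hW, hWirr⟩ := exists_irr_sub (coindRep aι M) hntV
  refine ⟨_, hWirr, ?_⟩
  let W' : Submodule k V := W
  let ev : W' →ₗ[k] M := (LinearMap.proj (1 : S7)) ∘ₗ V.subtype ∘ₗ W'.subtype
  have hev : ∀ f : W', ev f = f.1.1 1 := fun f => rfl
  let e : (Action.res _ aι).obj (subrep _ W hW) ⟶ M := mkHom (X := (Action.res _ aι).obj (subrep (coindRep aι M) W hW)) (Y := M) ev (by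
    rintro g ⟨⟨f, hf⟩, hfW⟩
    change f (1 * aι g) = M.ρ g (f 1)
    rw [← hf, one_mul, mul_one])
  have hsurj : Function.Surjective ev := by
    rw [← LinearMap.range_eq_top]
    refine (hirr (LinearMap.range ev) ?_).resolve_left ?_
    · rintro g _ ⟨f, rfl⟩
      exact ⟨_, toLin_comm e g f⟩
    · intro h0
      obtain ⟨f, hf⟩ := @exists_ne W' hWirr.1 0
      apply hf
      apply Subtype.ext; apply Subtype.ext; funext g
      have : ev ⟨_, hW g f.1 f.2⟩ = 0 := by
        have h1 : ev ⟨_, hW g f.1 f.2⟩ ∈ LinearMap.range ev := ⟨_, rfl⟩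
        rw [h0] at h1
        exact h1
      change f.1.1 (1 * g) = 0 at this
      rwa [one_mul] at this
  have hker : ∀ f : W', ev f = 0 ↔ ∀ g ∈ alternatingGroup (Fin 7), f.1.1 g = 0 := by
    intro f
    constructor
    · intro h g hg
      have := f.1.2 ⟨g, hg⟩ 1
      rw [mul_one] at this
      refine this.trans ?_
      change M.ρ _ (ev f) = 0
      rw [h, map_zero]
    · intro h
      exact h 1 (one_mem _)
  suffices h : ∃ U : Submodule k W', (∀ g ∈ alternatingGroup (Fin 7), ∀ v (hv : v ∈ U), (⟨_, hW g v.1 v.2⟩ : W') ∈ U) ∧ IsCompl (LinearMap.ker ev) U by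
    obtain ⟨U, hU, hc⟩ := h
    obtain ⟨i, hi⟩ := section_of_compl e hsurj U (fun g v hv => hU g.1 g.2 v hv) hc
    exact ⟨i, e, hi⟩
  by_cases hb : LinearMap.ker ev = ⊥
  · rw [hb]
    exact ⟨⊤, fun _ _ _ _ => Submodule.mem_top, isCompl_bot_top⟩
  let U : Submodule k W' :=
    { carrier := {f | ∀ g ∉ alternatingGroup (Fin 7), f.1.1 g = 0}
      add_mem' := fun {a b} ha hb g hg => by
        change a.1.1 g + b.1.1 g = 0
        rw [ha g hg, hb g hg, add_zero]
      zero_mem' := fun g hg => rfl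
      smul_mem' := fun c a ha g hg => by
        change c • a.1.1 g = 0
        rw [ha g hg, smul_zero] }
  have hmulalt : ∀ x y : S7, x * y ∈ alternatingGroup (Fin 7) ↔ (x ∈ alternatingGroup (Fin 7) ↔ y ∈ alternatingGroup (Fin 7)) := by
    intro x y
    simp only [Equiv.Perm.mem_alternatingGroup, map_mul]
    rcases Int.units_eq_one_or (Equiv.Perm.sign x) with h | h <;> rcases Int.units_eq_one_or (Equiv.Perm.sign y) with h' | h' <;> rw [h, h'] <;> decide
  refine ⟨U, ?_, ?_, ?_⟩
  · intro g hg v hv x hx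
    change v.1.1 (x * g) = 0
    apply hv
    rw [hmulalt]; tauto
  · rw [Submodule.disjoint_def]
    intro f h1 h2
    apply Subtype.ext; apply Subtype.ext; funext g
    by_cases hg : g ∈ alternatingGroup (Fin 7)
    · exact (hker f).1 h1 g hg
    · exact h2 g hg
  · rw [codisjoint_iff]
    refine (hWirr.2 (LinearMap.ker ev ⊔ U) ?_).resolve_left ?_
    · intro g f hf
      obtain ⟨a, ha, b, hb, rfl⟩ := Submodule.mem_sup.1 hf
      rw [map_add]
      have ha' := (hker a).1 ha
      by_cases hg : g ∈ alternatingGroup (Fin 7)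
      · apply add_mem
        · apply Submodule.mem_sup_left
          refine (hker _).2 ?_
          intro x hx
          exact ha' (x * g) ((hmulalt _ _).2 (by tauto))
        · apply Submodule.mem_sup_right
          intro x hx
          exact hb (x * g) (by rw [hmulalt]; tauto)
      · apply add_mem
        · apply Submodule.mem_sup_right
          intro x hx
          exact ha' (x * g) ((hmulalt _ _).2 (by tauto))
        · apply Submodule.mem_sup_left
          refine (hker _).2 ?_
          intro x hx
          exact hb (x * g) (by rw [hmulalt]; tauto)
    · intro h0
      exact hb (eq_bot_iff.2 (le_sup_left.trans h0.le))
end A7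

namespace A7
theorem trace_indep {K R : Type} [Field K] [IsAlgClosed K] [Ring R] [Algebra K R] {ι : Type} [Fintype ι] [DecidableEq ι]
   (S : ι → Type) [∀ i, AddCommGroup (S i)] [∀ i, Module K (S i)] [∀ i, Module R (S i)] [∀ i, IsScalarTower K R (S i)]
   [∀ i, FiniteDimensional K (S i)] [∀ i, IsSimpleModule R (S i)] (hni : ∀ i j, i ≠ j → IsEmpty (S i ≃ₗ[R] S j))
   (c : ι → K) (hc : ∀ r : R, ∑ i, c i * LinearMap.trace K (S i) (Algebra.lsmul K K (S i) r) = 0) (j : ι) : c j = 0 := by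
  have hnt : Nontrivial (S j) := IsSimpleModule.nontrivial R (S j)
  obtain ⟨v, hv⟩ := exists_ne (0 : S j)
  obtain ⟨ℓ, hℓ⟩ := Module.Projective.exists_dual_ne_zero K hv
  let E : S j →ₗ[K] S j := LinearMap.smulRight ((ℓ v)⁻¹ • ℓ) v
  have htr : LinearMap.trace K _ E = 1 := by
    rw [LinearMap.trace_smulRight]
    simp [hℓ]
  have hsc : ∀ φ : Module.End R (∀ i, S i), ∀ i, ∃ a : K, ∀ m, φ m i = a • m i := by
    intro φ i
    obtain ⟨a, ha⟩ := (IsSimpleModule.algebraMap_end_bijective_of_isAlgClosed (A := R) (V := S i) K).2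
      (LinearMap.proj i ∘ₗ φ ∘ₗ LinearMap.single R S i)
    refine ⟨a, fun m => ?_⟩
    have h1 : m = ∑ l, Pi.single l (m l) := (Finset.univ_sum_single m).symm
    conv_lhs => rw [h1, map_sum, Finset.sum_apply]
    rw [Finset.sum_eq_single i]
    · have := LinearMap.congr_fun ha (m i)
      exact this.symm
    · intro l _ hl
      rcases LinearMap.bijective_or_eq_zero (LinearMap.proj i ∘ₗ φ ∘ₗ LinearMap.single R S l) with h | h
      · exact ((hni l i hl).false (LinearEquiv.ofBijective _ h)).elim
      · exact LinearMap.congr_fun h (m l)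
    · simp
  let f : Module.End (Module.End R (∀ i, S i)) (∀ i, S i) :=
    { toFun := fun m => Pi.single j (E (m j))
      map_add' := fun a b => by rw [← Pi.single_add, Pi.add_apply, map_add]
      map_smul' := fun φ m => by
        funext i
        obtain ⟨a, ha⟩ := hsc φ i
        simp only [RingHom.id_apply, Module.End.smul_def]
        rw [ha]
        by_cases h : i = j
        · subst h
          rw [ha, map_smul]; simp
        · simp [h] }
  let b := Module.finBasis K (∀ i, S i)
  classical
  obtain ⟨r, hr⟩ := jacobson_density (R := R) f (Finset.univ.image b)
  have hr2 : ∀ m, f m = r • m := by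
    intro m
    let f1 : (∀ i, S i) →ₗ[K] (∀ i, S i) := LinearMap.single K S j ∘ₗ E ∘ₗ LinearMap.proj j
    have : f1 = Algebra.lsmul K K (∀ i, S i) r := by
      apply b.ext
      intro l
      exact hr (b l) (by simp)
    exact LinearMap.congr_fun this m
  have hr3 : ∀ i, (Algebra.lsmul K K (S i) r) = if h : i = j then h ▸ E else 0 := by
    intro i
    apply LinearMap.ext
    intro m
    have := congrFun (hr2 (Pi.single i m)) i
    rw [Pi.smul_apply, Pi.single_eq_same] at this
    refine this.symm.trans ?_
    change (Pi.single j (E (Pi.single i m j)) : ∀ i, S i) i = _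
    by_cases h : i = j
    · subst h; simp
    · simp [h]
  have := hc r
  rw [Finset.sum_eq_single j] at this
  · rw [hr3] at this
    simpa [htr] using this
  · intro i _ hi
    rw [hr3]; simp [hi]
  · simp

theorem trace_indep' {K G : Type} [Field K] [IsAlgClosed K] [Group G] {ι : Type} [Fintype ι]
   (X : ι → FDRep K G) (hX : ∀ i, IrrF (X i)) (hni : ∀ i j, i ≠ j → ¬ Nonempty (X i ≅ X j)) :
   LinearIndependent K (fun i g => LinearMap.trace K _ ((X i).ρ g)) := by
  classical
  rw [Fintype.linearIndependent_iff]
  intro c hc j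
  let R : ∀ i, Representation K G (X i) := fun i => (X i).ρ
  let e := fun i => (R i).asModuleEquiv
  have he : ∀ i g v, (e i) ((MonoidAlgebra.of K G g) • v) = (X i).ρ g (e i v) := by
    intro i g v
    have := Representation.asModuleEquiv_map_smul (R i) (MonoidAlgebra.of K G g) v
    rw [this, Representation.asAlgebraHom_of]
  have hsim : ∀ i, IsSimpleModule (MonoidAlgebra K G) (R i).asModule := by
    intro i
    have hn := (hX i).1
    have : Nontrivial (R i).asModule := hn
    rw [isSimpleModule_iff]
    refine @IsSimpleOrder.mk _ _ _ inferInstance ?_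
    intro W
    let W' : Submodule K (X i) := (W.restrictScalars K).map (e i).toLinearMap
    have h1 : W' = ⊥ ∨ W' = ⊤ := by
      apply (hX i).2
      rintro g _ ⟨w, hw, rfl⟩
      exact ⟨MonoidAlgebra.of K G g • w, W.smul_mem _ hw, he i g w⟩
    rcases h1 with h1 | h1
    · left
      rw [Submodule.eq_bot_iff]
      intro x hx
      have : e i x ∈ W' := ⟨x, hx, rfl⟩
      rw [h1] at this
      exact (e i).map_eq_zero_iff.1 this
    · right
      rw [Submodule.eq_top_iff']
      intro x
      have : e i x ∈ W' := by rw [h1]; trivial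
      obtain ⟨y, hy, hxy⟩ := this
      have := (e i).injective hxy
      rw [← this]; exact hy
  have hfd : ∀ i, FiniteDimensional K (R i).asModule := fun i => Module.Finite.equiv (e i).symm
  refine trace_indep (K := K) (R := MonoidAlgebra K G) (fun i => (R i).asModule) ?_ c ?_ j
  · intro i j hij
    refine ⟨fun E => hni i j hij ⟨mkIso (((e i).symm.trans (E.restrictScalars K)).trans (e j)) ?_⟩⟩
    intro g v
    change e j (E ((e i).symm _)) = (X j).ρ g (e j (E ((e i).symm v)))
    rw [← he, ← map_smul]
    congr 2
    apply (e i).injective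
    rw [he]; simp
  · intro r
    induction r using MonoidAlgebra.induction_on with
    | of g =>
      have := congrFun hc g
      rw [Finset.sum_apply] at this
      rw [← show _ = (0:K) from this]
      apply Finset.sum_congr rfl
      intro i _
      simp only [Pi.smul_apply, smul_eq_mul]
      congr 1
      rw [← LinearMap.trace_conj' _ (e i)]
      congr 1
      apply LinearMap.ext
      intro v
      rw [LinearEquiv.conj_apply_apply]
      exact (he i g _).trans (by rw [LinearEquiv.apply_symm_apply])
    | add a b ha hb =>
      rw [← add_zero (0:K)]
      nth_rewrite 1 [← ha]
      rw [← hb, ← Finset.sum_add_distrib]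
      apply Finset.sum_congr rfl
      intro i _
      simp only [map_add]
      ring
    | smul a b hb =>
      rw [← mul_zero a, ← hb, Finset.mul_sum]
      apply Finset.sum_congr rfl
      intro i _
      simp only [map_smul, smul_eq_mul]
      ring
end A7

namespace A7
theorem pow420 (g : S7) : g ^ 420 = 1 := by
  rw [← orderOf_dvd_iff_pow_eq_one, ← Equiv.Perm.lcm_cycleType, Multiset.lcm_dvd]
  intro b hb
  have h1 := Multiset.single_le_sum (fun _ _ => Nat.zero_le _) b hb
  have h2 := Equiv.Perm.sum_cycleType_le g
  have h3 := Equiv.Perm.two_le_of_mem_cycleType hb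
  have h4 : b ≤ 7 := by simpa using h1.trans h2
  interval_cases b <;> decide

theorem trace_pow141 {K : Type} [Field K] [CharP K 3] (X : FDRep K S7) (g : S7) :
    LinearMap.trace K _ (X.ρ g) = LinearMap.trace K _ (X.ρ (g ^ 141)) := by
  rw [← sub_eq_zero, ← map_sub]
  refine (LinearMap.isNilpotent_trace_of_isNilpotent ?_).eq_zero
  have hc : Commute (X.ρ g) (X.ρ (g ^ 141)) := by
    rw [map_pow]; exact (Commute.refl _).pow_right _
  by_cases hn : Nontrivial X
  · have : CharP (Module.End K X) 3 := charP_of_injective_algebraMap (algebraMap K _).injective 3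
    refine ⟨3 ^ 2, ?_⟩
    have : _root_.Fact (Nat.Prime 3) := ⟨by norm_num⟩
    have h := sub_pow_char_pow_of_commute (R := Module.End K X) (p := 3) (n := 2) hc
    refine h.trans ?_
    rw [sub_eq_zero]
    refine (map_pow X.ρ g (3^2)).symm.trans (Eq.trans ?_ (map_pow X.ρ (g ^ 141) (3^2)))
    congr 1
    rw [← pow_mul, show 141 * 3 ^ 2 = 420 * 3 + 3 ^ 2 by norm_num, pow_add, pow_mul, pow420, one_pow, one_mul]
  · rw [not_nontrivial_iff_subsingleton] at hn
    exact ⟨1, LinearMap.ext fun v => Subsingleton.elim _ _⟩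

def κ (g : S7) : ℕ × ℕ × ℕ × ℕ :=
  let m := (g ^ 141).cycleType
  (m.count 2, m.count 4, m.count 5, m.count 7)

def κT : Finset (ℕ × ℕ × ℕ × ℕ) :=
  (Finset.range 4 ×ˢ Finset.range 2 ×ˢ Finset.range 2 ×ˢ Finset.range 2).filter
    (fun p => 2 * p.1 + 4 * p.2.1 + 5 * p.2.2.1 + 7 * p.2.2.2 ≤ 7)

theorem κsub (g : S7) : (g ^ 141).cycleType.toFinset ⊆ {2, 4, 5, 7} := by
  intro b hb
  rw [Multiset.mem_toFinset] at hb
  have h1 := Multiset.single_le_sum (fun _ _ => Nat.zero_le _) b hb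
  have h2 := Equiv.Perm.sum_cycleType_le (g ^ 141)
  have h3 := Equiv.Perm.two_le_of_mem_cycleType hb
  have h4 : b ≤ 7 := by simpa using h1.trans h2
  have h5 := Equiv.Perm.dvd_of_mem_cycleType hb
  have h6 : orderOf (g ^ 141) ∣ 140 := by
    rw [orderOf_dvd_iff_pow_eq_one, ← pow_mul, show 141 * 140 = 420 * 47 by norm_num, pow_mul, pow420, one_pow]
  have h7 := h5.trans h6
  interval_cases b <;> first | decide | (exfalso; revert h7; decide)

theorem κmem (g : S7) : κ g ∈ κT := by
  have h := Finset.sum_multiset_count_of_subset _ _ (κsub g)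
  have h2 := Equiv.Perm.sum_cycleType_le (g ^ 141)
  rw [h] at h2
  simp at h2
  simp only [κT, κ, Finset.mem_filter, Finset.mem_product, Finset.mem_range]
  omega

theorem κconj {g g' : S7} (h : κ g = κ g') : IsConj (g ^ 141) (g' ^ 141) := by
  rw [Equiv.Perm.isConj_iff_cycleType_eq]
  simp only [κ, Prod.mk.injEq] at h
  ext b
  by_cases hb : b ∈ ({2, 4, 5, 7} : Finset ℕ)
  · simp at hb
    rcases hb with rfl | rfl | rfl | rfl <;> tauto
  · rw [Multiset.count_eq_zero_of_notMem, Multiset.count_eq_zero_of_notMem]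
    · intro h; exact hb (κsub g' (Multiset.mem_toFinset.2 h))
    · intro h; exact hb (κsub g (Multiset.mem_toFinset.2 h))

theorem trace_conj {K : Type} [Field K] (X : FDRep K S7) {g g' : S7} (h : IsConj g g') :
    LinearMap.trace K _ (X.ρ g) = LinearMap.trace K _ (X.ρ g') := by
  obtain ⟨c, rfl⟩ := isConj_iff.1 h
  have := LinearMap.trace_mul_comm K (X.ρ (c * g)) (X.ρ c⁻¹)
  rw [← map_mul] at this
  refine Eq.trans ?_ this.symm
  congr 1
  refine Eq.trans ?_ (map_mul X.ρ _ _)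
  congr 1; group

theorem trace_κ {K : Type} [Field K] [CharP K 3] (X : FDRep K S7) {g g' : S7} (h : κ g = κ g') :
    LinearMap.trace K _ (X.ρ g) = LinearMap.trace K _ (X.ρ g') := by
  rw [trace_pow141 X g, trace_pow141 X g', trace_conj X (κconj h)]

theorem card_irr {K : Type} [Field K] [IsAlgClosed K] [CharP K 3] {ι : Type} [Fintype ι]
   (X : ι → FDRep K S7) (hX : ∀ i, IrrF (X i)) (hni : ∀ i j, i ≠ j → ¬ Nonempty (X i ≅ X j)) :
   Fintype.card ι ≤ 9 := by
  classical
  have h := trace_indep' X hX hni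
  let rep : κT → S7 := fun t => if h : ∃ g, κ g = t.1 then h.choose else 1
  have hrep : ∀ g, κ (rep ⟨κ g, κmem g⟩) = κ g := by
    intro g
    have h : ∃ g', κ g' = κ g := ⟨g, rfl⟩
    simp only [rep, dif_pos h]
    exact h.choose_spec
  have h2 : LinearIndependent K (fun i (t : κT) => LinearMap.trace K _ ((X i).ρ (rep t))) := by
    rw [Fintype.linearIndependent_iff] at h ⊢
    intro c hc
    apply h
    funext g
    have := congrFun hc ⟨κ g, κmem g⟩
    simp only [Finset.sum_apply, Pi.smul_apply] at this ⊢
    refine Eq.trans ?_ this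
    apply Finset.sum_congr rfl
    intro i _
    rw [trace_κ (X i) (hrep g)]
  have h3 := h2.fintype_card_le_finrank
  rw [Module.finrank_fintype_fun_eq_card] at h3
  refine h3.trans ?_
  rw [Fintype.card_coe]
  decide
end A7

namespace A7
open TensorProduct
structure Fam where
  X : ∀ (F : Type) [Field F] [CharP F 3], FDRep F S7
  irr : ∀ (F : Type) [Field F] [CharP F 3], IrrF (X F)
  bc : ∀ (k K : Type) [Field k] [CharP k 3] [Field K] [CharP K 3] [Algebra k K],
    ∃ b : X k →+ X K, (∀ (c : k) v, b (c • v) = algebraMap k K c • b v) ∧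
      (∀ g v, b ((X k).ρ g v) = (X K).ρ g (b v)) ∧ ∃ u, b u ≠ 0

theorem iso_of_ne_zero {k G : Type} [Field k] [Monoid G] {X Y : FDRep k G} (hX : IrrF X) (hY : IrrF Y) (f : X ⟶ Y)
    (h : ∃ u, toLin f u ≠ 0) : Nonempty (X ≅ Y) := by
  obtain ⟨u, hu⟩ := h
  have hk : LinearMap.ker (toLin f) = ⊥ := by
    refine (hX.2 _ ?_).resolve_right ?_
    · intro g v hv
      rw [LinearMap.mem_ker] at hv ⊢
      rw [toLin_comm, hv, map_zero]
    · intro h; apply hu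
      rw [← LinearMap.mem_ker, h]; trivial
  have hr : LinearMap.range (toLin f) = ⊤ := by
    refine (hY.2 _ ?_).resolve_left ?_
    · rintro g _ ⟨v, rfl⟩
      exact ⟨_, toLin_comm f g v⟩
    · intro h; apply hu
      have : toLin f u ∈ LinearMap.range (toLin f) := ⟨u, rfl⟩
      rwa [h] at this
  exact ⟨mkIso (LinearEquiv.ofBijective (toLin f) ⟨LinearMap.ker_eq_bot.1 hk, LinearMap.range_eq_top.1 hr⟩)
    (fun g v => toLin_comm f g v)⟩

noncomputable def bcRep {k : Type} (K : Type) {G : Type} [Field k] [Field K] [Algebra k K] [Group G] (N : FDRep k G) : FDRep K G :=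
  FDRep.of (V := K ⊗[k] N) 
   { toFun := fun g => (N.ρ g).baseChange K
     map_one' := by rw [map_one]; exact LinearMap.baseChange_id
     map_mul' := fun a b => by rw [map_mul]; exact LinearMap.baseChange_comp _ _ }

theorem exists_sep {k K N : Type} [Field k] [Field K] [Algebra k K] [AddCommGroup N] [Module k N] (t : K ⊗[k] N) (ht : t ≠ 0) :
   ∃ l : K →ₗ[k] k, TensorProduct.lid k N (l.rTensor N t) ≠ 0 := by
  classical
  let b := Module.Basis.ofVectorSpace k N
  have h1 : TensorProduct.equivFinsuppOfBasisRight b t ≠ 0 := by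
    simpa using ht
  obtain ⟨i, hi⟩ := Finsupp.ne_iff.1 h1
  obtain ⟨l, hl⟩ := Module.Projective.exists_dual_ne_zero k hi
  refine ⟨l, fun h0 => hl ?_⟩
  have key : ∀ t : K ⊗[k] N, l (TensorProduct.equivFinsuppOfBasisRight b t i) = b.repr (TensorProduct.lid k N (l.rTensor N t)) i := by
    intro t
    induction t with
    | zero => simp
    | tmul x y => simp [mul_comm]
    | add x y hx hy => rw [map_add, Finsupp.add_apply, map_add, hx, hy, map_add, map_add, map_add, Finsupp.add_apply]
  rw [key, h0]; simp

theorem classify (Fs : Fin 9 → Fam)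
    (hni : ∀ (K : Type) [Field K] [CharP K 3] (i j), i ≠ j → ¬ Nonempty ((Fs i).X K ≅ (Fs j).X K))
    (k : Type) [Field k] [CharP k 3] (N : FDRep k S7) (hN : IrrF N) : ∃ j, Nonempty ((Fs j).X k ≅ N) := by
  let K := AlgebraicClosure k
  have : CharP K 3 := charP_of_injective_algebraMap (algebraMap k K).injective 3
  have hnt : Nontrivial (bcRep K N) := by
    have := hN.1
    exact inferInstanceAs (Nontrivial (K ⊗[k] N))
  obtain ⟨W, hW, hWi⟩ := exists_irr_sub (bcRep K N) hnt
  have h1 : ∃ j, Nonempty ((Fs j).X K ≅ subrep _ W hW) := by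
    by_contra hcon
    push Not at hcon
    have h2 : ∀ j, ¬ Nonempty ((Fs j).X K ≅ subrep _ W hW) := by
      intro j ⟨e⟩; exact (hcon j).false e
    have := card_irr (K := K) (ι := Option (Fin 9)) (fun o => match o with
      | none => subrep _ W hW
      | some j => (Fs j).X K) (by
        rintro (_ | j)
        · exact hWi
        · exact (Fs j).irr K) (by
        rintro (_ | i) (_ | j) hij
        · exact (hij rfl).elim
        · rintro ⟨e⟩; exact h2 j ⟨e.symm⟩
        · exact h2 i
        · exact hni K i j (fun h => hij (congrArg some h)))
    simp at this
  obtain ⟨j, ⟨e⟩⟩ := h1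
  refine ⟨j, ?_⟩
  obtain ⟨b, hb1, hb2, u, hu⟩ := (Fs j).bc k K
  let Φ : (Fs j).X K ⟶ bcRep K N := e.hom ≫ subrepι _ W hW
  have hΦ : toLin Φ (b u) ≠ 0 := by
    intro h0
    apply hu
    have h3 : (toLin e.hom (b u)) = 0 := Subtype.ext h0
    have h4 := LinearMap.congr_fun (congrArg toLin e.hom_inv_id) (b u)
    refine h4.symm.trans ?_
    change toLin e.inv (toLin e.hom (b u)) = 0
    rw [h3, map_zero]
  obtain ⟨l, hl⟩ := exists_sep (k := k) (K := K) (N := N) (toLin Φ (b u)) hΦ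
  have hcomm : ∀ g (t : K ⊗[k] N), TensorProduct.lid k N (l.rTensor N ((N.ρ g).baseChange K t)) = N.ρ g (TensorProduct.lid k N (l.rTensor N t)) := by
    intro g t
    induction t with
    | zero => simp
    | tmul x y => simp
    | add x y hx hy => simp only [map_add, hx, hy]
  let f : (Fs j).X k →ₗ[k] N :=
    { toFun := fun v => TensorProduct.lid k N (l.rTensor N (toLin Φ (b v)))
      map_add' := fun x y => by rw [map_add, map_add]; exact ((congrArg _ (map_add (l.rTensor N) _ _)).trans (map_add _ _ _))
      map_smul' := fun c x => by
        rw [hb1, map_smul]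
        have h5 : ∀ t : K ⊗[k] N, algebraMap k K c • t = c • t := fun t => algebraMap_smul K c t
        refine (congrArg (fun t => TensorProduct.lid k N (l.rTensor N t)) (h5 _)).trans ?_
        have h6 : ∀ t : K ⊗[k] N, TensorProduct.lid k N (l.rTensor N (c • t)) = c • TensorProduct.lid k N (l.rTensor N t) := fun t => by rw [map_smul, map_smul]
        exact h6 _ }
  refine iso_of_ne_zero ((Fs j).irr k) hN (mkHom f ?_) ⟨u, hl⟩
  intro g v
  refine Eq.trans ?_ (hcomm g _)
  change TensorProduct.lid k N (l.rTensor N (toLin Φ (b _))) = _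
  rw [hb2, toLin_comm]
  rfl
end A7

namespace A7
section
variable {F G : Type} [Field F] [Group G]

theorem core_form (Y : FDRep F G) (B : Y →ₗ[F] Y →ₗ[F] F) (hB : ∀ g x y, B (Y.ρ g x) (Y.ρ g y) = B x y)
    (V C : Submodule F Y) (hV : Inv Y V) (hCV : C ≤ V) (hC : ∀ x ∈ V, ∀ y ∈ C, B x y = 0) (u : Y)
    (h1 : ∀ W, Inv Y W → ∀ x ∈ W, x ∈ V → B x u • u ∈ W)
    (h2 : ∀ x ∈ V, (∀ g, B (Y.ρ g x) u = 0) → x ∈ C)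
    (W : Submodule F Y) (hW : Inv Y W) (hCW : C ≤ W) (hWV : W ≤ V) : W = C ∨ W = V := by
  by_cases h : W ≤ C
  · exact .inl (le_antisymm h hCW)
  right
  obtain ⟨x, hx, hxC⟩ := Set.not_subset.1 h
  have h3 : ∃ g, B (Y.ρ g x) u ≠ 0 := by
    by_contra hcon; push Not at hcon
    exact hxC (h2 x (hWV hx) hcon)
  obtain ⟨g, hg⟩ := h3
  have hu : u ∈ W := by
    have := W.smul_mem (B (Y.ρ g x) u)⁻¹ (h1 W hW _ (hW g x hx) (hWV (hW g x hx)))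
    rwa [smul_smul, inv_mul_cancel₀ hg, one_smul] at this
  let L : V →ₗ[F] Module.Dual F W := (B.domRestrict₁₂ V W)
  have hL : ∀ (v : V) (w : W), L v w = B v.1 w.1 := fun v w => rfl
  let C' : Submodule F W := C.comap W.subtype
  have hC' : Module.finrank F C' = Module.finrank F C := (Submodule.comapSubtypeEquivOfLe hCW).finrank_eq
  have hr : LinearMap.range L ≤ C'.dualAnnihilator := by
    rintro _ ⟨v, rfl⟩
    rw [Submodule.mem_dualAnnihilator]
    intro w hw
    exact hC _ v.2 _ hw
  have hk : LinearMap.ker L ≤ C.comap V.subtype := by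
    intro v hv
    apply h2 v.1 v.2
    intro g
    have h4 := LinearMap.congr_fun (LinearMap.mem_ker.1 hv) ⟨_, hW g⁻¹ u hu⟩
    rw [hL] at h4
    have h5 := hB g v.1 (Y.ρ g⁻¹ u)
    rw [ρρ, mul_inv_cancel, map_one] at h5
    exact h5.trans h4
  have e1 := LinearMap.finrank_range_add_finrank_ker L
  have e2 := Subspace.finrank_add_finrank_dualAnnihilator_eq C'
  have e3 := Submodule.finrank_mono hr
  have e4 := Submodule.finrank_mono hk
  have e5 := (Submodule.comapSubtypeEquivOfLe hCV).finrank_eq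
  exact Submodule.eq_of_le_of_finrank_le hWV (by omega)

noncomputable def quotRep (X : FDRep F G) (C : Submodule F X) (h : Inv X C) : FDRep F G :=
  FDRep.of (V := X ⧸ C)
   { toFun := fun g => C.mapQ C (X.ρ g) (fun v hv => h g v hv)
     map_one' := by ext v; simp
     map_mul' := fun a b => by ext v; simp }

theorem irr_sub (Y : FDRep F G) (V : Submodule F Y) (hV : Inv Y V)
   (h0 : V ≠ ⊥) (h : ∀ W, Inv Y W → W ≤ V → W = ⊥ ∨ W = V) : IrrF (subrep Y V hV) := by
  refine ⟨Submodule.nontrivial_iff_ne_bot.2 h0, ?_⟩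
  intro W hW
  let W' : Submodule F V := W
  have h1 := h (W'.map V.subtype) (by
    rintro g _ ⟨w, hw, rfl⟩
    exact ⟨_, hW g w hw, rfl⟩) (Submodule.map_subtype_le _ _)
  rcases h1 with h1 | h1
  · left
    show W' = ⊥
    apply Submodule.map_injective_of_injective V.injective_subtype
    rw [h1, Submodule.map_bot]
  · right
    show W' = ⊤
    apply Submodule.map_injective_of_injective V.injective_subtype
    rw [h1, Submodule.map_subtype_top]

theorem irr_quot (Y : FDRep F G) (C : Submodule F Y) (hC : Inv Y C)
   (h0 : C ≠ ⊤) (h : ∀ W, Inv Y W → C ≤ W → W = C ∨ W = ⊤) : IrrF (quotRep Y C hC) := by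
  refine ⟨Submodule.Quotient.nontrivial_iff.2 h0, ?_⟩
  intro W hW
  let W' : Submodule F (Y ⧸ C) := W
  have h1 := h (W'.comap C.mkQ) (by
    intro g w hw
    exact hW g _ hw) (by
    intro c hc
    rw [Submodule.mem_comap, Submodule.mkQ_apply, (Submodule.Quotient.mk_eq_zero C).2 hc]
    exact zero_mem W')
  rcases h1 with h1 | h1
  · left
    rw [Submodule.eq_bot_iff]
    intro x hx
    obtain ⟨y, rfl⟩ := C.mkQ_surjective x
    have : y ∈ W'.comap C.mkQ := hx
    rw [h1] at this
    exact (Submodule.Quotient.mk_eq_zero C).2 this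
  · right
    rw [Submodule.eq_top_iff']
    intro x
    obtain ⟨y, rfl⟩ := C.mkQ_surjective x
    have : y ∈ W'.comap C.mkQ := by rw [h1]; trivial
    exact this

noncomputable def fnRep (F : Type) [Field F] (G : Type) [Group G] (Ω : Type) [Finite Ω] [MulAction G Ω] : FDRep F G :=
  FDRep.of (V := Ω → F)
    { toFun := fun g => LinearMap.funLeft F F (fun w => g⁻¹ • w)
      map_one' := by ext v; simp
      map_mul' := fun a b => by ext v; simp [mul_smul, LinearMap.funLeft] }

variable {Ω : Type} [Fintype Ω] [MulAction G Ω]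
theorem fn_ρ (g : G) (x : Ω → F) (w : Ω) : (fnRep F G Ω).ρ g x w = x (g⁻¹ • w) := rfl

def Bf (F Ω : Type) [Field F] [Fintype Ω] : (Ω → F) →ₗ[F] (Ω → F) →ₗ[F] F :=
  LinearMap.mk₂ F (fun x y => ∑ w, x w * y w) (by intros; simp [add_mul, Finset.sum_add_distrib])
    (by intros; simp [Finset.mul_sum, mul_assoc]) (by intros; simp [mul_add, Finset.sum_add_distrib])
    (by intros; simp [Finset.mul_sum, mul_left_comm])
theorem Bf_apply (x y : Ω → F) : Bf F Ω x y = ∑ w, x w * y w := rfl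
theorem Bf_inv (g : G) (x y : Ω → F) : Bf F Ω ((fnRep F G Ω).ρ g x) ((fnRep F G Ω).ρ g y) = Bf F Ω x y := by
  exact Equiv.sum_comp (MulAction.toPerm g⁻¹) (fun w => x w * y w)
end
end A7

namespace A7
def cc : S7 := Equiv.swap 0 1 * Equiv.swap 1 2
def dd : S7 := Equiv.swap 3 4 * Equiv.swap 4 5
def tt : S7 := Equiv.swap 1 2
def ss : S7 := Equiv.swap 0 3 * Equiv.swap 1 4 * Equiv.swap 2 5
section
variable {F : Type} [Field F]
noncomputable def n3 (X : FDRep F S7) : X →ₗ[F] X := LinearMap.id + X.ρ cc + X.ρ (cc ^ 2)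
noncomputable def m3 (X : FDRep F S7) : X →ₗ[F] X := LinearMap.id + X.ρ dd + X.ρ (dd ^ 2)
noncomputable def NP (X : FDRep F S7) : X →ₗ[F] X := m3 X ∘ₗ n3 X
theorem n3_apply (X : FDRep F S7) (x : X) : n3 X x = x + X.ρ cc x + X.ρ (cc ^ 2) x := rfl
theorem NP_apply (X : FDRep F S7) (x : X) : NP X x = n3 X x + X.ρ dd (n3 X x) + X.ρ (dd ^ 2) (n3 X x) := rfl
theorem n3_mem {X : FDRep F S7} {W : Submodule F X} (hW : Inv X W) {x : X} (hx : x ∈ W) : n3 X x ∈ W :=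
  add_mem (add_mem hx (hW _ _ hx)) (hW _ _ hx)
theorem NP_mem {X : FDRep F S7} {W : Submodule F X} (hW : Inv X W) {x : X} (hx : x ∈ W) : NP X x ∈ W :=
  add_mem (add_mem (n3_mem hW hx) (hW _ _ (n3_mem hW hx))) (hW _ _ (n3_mem hW hx))
theorem n3_comm {X Y : FDRep F S7} (f : X ⟶ Y) (x : X) : toLin f (n3 X x) = n3 Y (toLin f x) := by
  rw [n3_apply, n3_apply, map_add, map_add, toLin_comm, toLin_comm]
theorem NP_comm {X Y : FDRep F S7} (f : X ⟶ Y) (x : X) : toLin f (NP X x) = NP Y (toLin f x) := by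
  rw [NP_apply, NP_apply, map_add, map_add, toLin_comm, toLin_comm, n3_comm]

inductive Tag where
  | t0 : ℤˣ → Tag
  | t1 : ℤˣ → Tag
  | t2 : ℤˣ → ℤˣ → Tag
  | t3 : Tag
deriving DecidableEq

def Ty (X : FDRep F S7) : Tag → Prop
  | .t0 s => (∀ x, X.ρ cc x = x) ∧ ∀ x, X.ρ tt x = ((s : ℤ) : F) • x
  | .t1 s => (∀ x, NP X x = 0) ∧ (∃ x, n3 X x ≠ 0) ∧ ∀ x, X.ρ tt (n3 X x) = ((s : ℤ) : F) • n3 X x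
  | .t2 s s' => (∃ x, NP X x ≠ 0) ∧ (∀ x, X.ρ tt (NP X x) = ((s : ℤ) : F) • NP X x) ∧
      (∀ x, X.ρ ss (NP X x) = ((s' : ℤ) : F) • NP X x)
  | .t3 => ∀ s : ℤˣ, ∃ x, X.ρ tt (NP X x) ≠ ((s : ℤ) : F) • NP X x

theorem Ty.iso {X Y : FDRep F S7} (e : X ≅ Y) {τ : Tag} (h : Ty X τ) : Ty Y τ := by
  have h1 : ∀ y, toLin e.hom (toLin e.inv y) = y := fun y => LinearMap.congr_fun (congrArg toLin e.inv_hom_id) y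
  have h0 : ∀ x, toLin e.hom x = 0 → x = 0 := fun x hx => by
    have h3 : toLin e.inv (toLin e.hom x) = x := LinearMap.congr_fun (congrArg toLin e.hom_inv_id) x
    rw [← h3, hx, map_zero]
  have h2 : ∀ P : Y → Prop, (∀ x, P (toLin e.hom x)) → ∀ y, P y := fun P hP y => by rw [← h1 y]; exact hP _
  cases τ with
  | t0 s =>
    refine ⟨h2 _ fun x => ?_, h2 _ fun x => ?_⟩
    · rw [← toLin_comm, h.1]
    · rw [← toLin_comm, h.2, map_smul]
  | t1 s =>
    refine ⟨h2 _ fun x => ?_, ?_, h2 _ fun x => ?_⟩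
    · rw [← NP_comm, h.1, map_zero]
    · obtain ⟨x, hx⟩ := h.2.1
      exact ⟨toLin e.hom x, fun h => hx (h0 _ (by rw [n3_comm, h]))⟩
    · rw [← n3_comm, ← toLin_comm, h.2.2, map_smul]
  | t2 s s' =>
    refine ⟨?_, h2 _ fun x => ?_, h2 _ fun x => ?_⟩
    · obtain ⟨x, hx⟩ := h.1
      exact ⟨toLin e.hom x, fun h => hx (h0 _ (by rw [NP_comm, h]))⟩
    · rw [← NP_comm, ← toLin_comm, h.2.1, map_smul]
    · rw [← NP_comm, ← toLin_comm, h.2.2, map_smul]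
  | t3 =>
    intro s
    obtain ⟨x, hx⟩ := h s
    refine ⟨toLin e.hom x, fun h => hx ?_⟩
    rw [← NP_comm, ← toLin_comm, ← map_smul, ← sub_eq_zero, ← map_sub] at h
    exact sub_eq_zero.1 (h0 _ h)

theorem unit_eq [CharP F 3] {V : Type} [AddCommGroup V] [Module F V] {x : V} (hx : x ≠ 0) {s s' : ℤˣ}
    (h : ((s : ℤ) : F) • x = ((s' : ℤ) : F) • x) : s = s' := by
  have h2 : (2 : F) ≠ 0 := by
    intro h
    have := (CharP.cast_eq_zero_iff F 3 2).1 (by exact_mod_cast h)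
    revert this; decide
  by_contra hne
  apply hx
  have : (2 : F) • x = 0 := by
    rcases Int.units_eq_one_or s with rfl | rfl <;> rcases Int.units_eq_one_or s' with rfl | rfl
    · exact (hne rfl).elim
    · simp at h
      rw [two_smul]; nth_rewrite 1 [h]; simp
    · simp at h
      rw [two_smul]; nth_rewrite 1 [← h]; simp
    · exact (hne rfl).elim
  exact (smul_eq_zero.1 this).resolve_left h2

theorem n3_of_triv [CharP F 3] {X : FDRep F S7} (h : ∀ x, X.ρ cc x = x) (x : X) : n3 X x = 0 := by
  have h3 : (3 : F) = 0 := by exact_mod_cast CharP.cast_eq_zero F 3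
  rw [n3_apply, pow_two, ← ρρ, h, h]
  have : x + x + x = (3 : F) • x := by module
  rw [this, h3, zero_smul]
theorem NP_of_n3 {X : FDRep F S7} {x : X} (h : n3 X x = 0) : NP X x = 0 := by
  rw [NP_apply, h]; simp

theorem Ty.excl [CharP F 3] {X : FDRep F S7} [Nontrivial X] {τ τ' : Tag} (h : Ty X τ) (h' : Ty X τ') : τ = τ' := by
  obtain ⟨x0, hx0⟩ := exists_ne (0 : X)
  have h01 : ∀ s s', Ty X (.t0 s) → Ty X (.t1 s') → False := fun s s' h h' => by
    obtain ⟨x, hx⟩ := h'.2.1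
    exact hx (n3_of_triv h.1 x)
  have h02 : ∀ s s' s'', Ty X (.t0 s) → Ty X (.t2 s' s'') → False := fun s s' s'' h h' => by
    obtain ⟨x, hx⟩ := h'.1
    exact hx (NP_of_n3 (n3_of_triv h.1 x))
  have h03 : ∀ s, Ty X (.t0 s) → Ty X .t3 → False := fun s h h' => by
    obtain ⟨x, hx⟩ := h' 1
    apply hx
    rw [(NP_of_n3 (n3_of_triv h.1 x))]; simp
  have h12 : ∀ s s' s'', Ty X (.t1 s) → Ty X (.t2 s' s'') → False := fun s s' s'' h h' => by
    obtain ⟨x, hx⟩ := h'.1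
    exact hx (h.1 x)
  have h13 : ∀ s, Ty X (.t1 s) → Ty X .t3 → False := fun s h h' => by
    obtain ⟨x, hx⟩ := h' 1
    apply hx
    rw [h.1]; simp
  have h23 : ∀ s s', Ty X (.t2 s s') → Ty X .t3 → False := fun s s' h h' => by
    obtain ⟨x, hx⟩ := h' s
    exact hx (h.2.1 x)
  cases τ <;> cases τ'
  case t0.t0 a b => rw [unit_eq hx0 ((h.2 x0).symm.trans (h'.2 x0))]
  case t1.t1 a b =>
    obtain ⟨x, hx⟩ := h.2.1
    rw [unit_eq hx ((h.2.2 x).symm.trans (h'.2.2 x))]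
  case t2.t2 a b a' b' =>
    obtain ⟨x, hx⟩ := h.1
    rw [unit_eq hx ((h.2.1 x).symm.trans (h'.2.1 x)), unit_eq hx ((h.2.2 x).symm.trans (h'.2.2 x))]
  case t3.t3 => rfl
  all_goals exfalso; first
    | exact h01 _ _ h h' | exact h01 _ _ h' h | exact h02 _ _ _ h h' | exact h02 _ _ _ h' h
    | exact h03 _ h h' | exact h03 _ h' h | exact h12 _ _ _ h h' | exact h12 _ _ _ h' h
    | exact h13 _ h h' | exact h13 _ h' h | exact h23 _ _ h h' | exact h23 _ _ h' h

noncomputable def twR (X : FDRep F S7) : FDRep F S7 :=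
  FDRep.of (V := X)
   { toFun := fun g => (((Equiv.Perm.sign g : ℤˣ) : ℤ) : F) • X.ρ g
     map_one' := by simp
     map_mul' := fun a b => by
      rw [map_mul, map_mul, Units.val_mul, Int.cast_mul, smul_mul_smul_comm] }
theorem tw_ρ (X : FDRep F S7) (g : S7) (x : X) : (twR X).ρ g x = (((Equiv.Perm.sign g : ℤˣ) : ℤ) : F) • X.ρ g x := rfl
theorem tw_ρ1 (X : FDRep F S7) {g : S7} (hg : Equiv.Perm.sign g = 1) (x : X) : (twR X).ρ g x = X.ρ g x := by
  rw [tw_ρ, hg]; exact (by simp : (((1 : ℤˣ) : ℤ) : F) • X.ρ g x = X.ρ g x)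
theorem tw_n3 (X : FDRep F S7) (x : X) : @Eq X (n3 (twR X) x) (n3 X x) :=
  congrArg₂ (fun a b : X => x + a + b) (tw_ρ1 X (by decide) x) (tw_ρ1 X (by decide) x)
theorem tw_NP (X : FDRep F S7) (x : X) : @Eq X (NP (twR X) x) (NP X x) :=
  (congrArg (fun y : twR X => y + (twR X).ρ dd y + (twR X).ρ (dd ^ 2) y) (tw_n3 X x)).trans
   (congrArg₂ (fun a b : X => n3 X x + a + b) (tw_ρ1 X (g := dd) (by decide) (n3 X x)) (tw_ρ1 X (g := dd ^ 2) (by decide) (n3 X x)))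

def Tag.tw : Tag → Tag
  | .t0 s => .t0 (-s)
  | .t1 s => .t1 (-s)
  | .t2 s s' => .t2 (-s) (-s')
  | .t3 => .t3
theorem sgn_tt : Equiv.Perm.sign tt = -1 := by decide
theorem sgn_ss : Equiv.Perm.sign ss = -1 := by decide

theorem Ty.tw {X : FDRep F S7} {τ : Tag} (h : Ty X τ) : Ty (twR X) τ.tw := by
  have hs : ∀ (g : S7) (hg : Equiv.Perm.sign g = -1) (s : ℤˣ) (x : X), X.ρ g x = ((s : ℤ) : F) • x →
      (twR X).ρ g x = (((-s : ℤˣ) : ℤ) : F) • x := by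
    intro g hg s x hx
    refine (tw_ρ X g x).trans ?_
    rw [hx, hg]; simp only [Units.val_neg, Units.val_one, Int.cast_neg, Int.cast_one, neg_smul, one_smul]; rfl
  cases τ with
  | t0 s =>
    exact ⟨fun x => (tw_ρ1 X (by decide) x).trans (h.1 x), fun x => hs tt sgn_tt s x (h.2 x)⟩
  | t1 s =>
    refine ⟨fun x => (tw_NP X x).trans (h.1 x), ?_, fun x => ?_⟩
    · obtain ⟨x, hx⟩ := h.2.1
      exact ⟨x, fun h => hx ((tw_n3 X x).symm.trans h)⟩
    · have := hs tt sgn_tt s _ (h.2.2 x)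
      exact (congrArg (fun y : X => ((twR X).ρ tt y : X)) (tw_n3 X x)).trans (this.trans
        (congrArg (fun y : X => (((-s : ℤˣ) : ℤ) : F) • y) (tw_n3 X x).symm))
  | t2 s s' =>
    refine ⟨?_, fun x => ?_, fun x => ?_⟩
    · obtain ⟨x, hx⟩ := h.1
      exact ⟨x, fun h => hx ((tw_NP X x).symm.trans h)⟩
    · have := hs tt sgn_tt s _ (h.2.1 x)
      exact (congrArg (fun y : X => ((twR X).ρ tt y : X)) (tw_NP X x)).trans (this.trans
        (congrArg (fun y : X => (((-s : ℤˣ) : ℤ) : F) • y) (tw_NP X x).symm))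
    · have := hs ss sgn_ss s' _ (h.2.2 x)
      exact (congrArg (fun y : X => ((twR X).ρ ss y : X)) (tw_NP X x)).trans (this.trans
        (congrArg (fun y : X => (((-s' : ℤˣ) : ℤ) : F) • y) (tw_NP X x).symm))
  | t3 =>
    intro s
    obtain ⟨x, hx⟩ := h (-s)
    refine ⟨x, fun h => hx ?_⟩
    have h1 : @Eq X ((twR X).ρ tt (NP X x)) (((s : ℤ) : F) • NP X x) :=
      (congrArg (fun y : X => ((twR X).ρ tt y : X)) (tw_NP X x).symm).trans (Eq.trans h
        (congrArg (fun y : X => ((s : ℤ) : F) • y) (tw_NP X x)))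
    have h2 := (tw_ρ X tt (NP X x)).symm.trans h1
    rw [sgn_tt] at h2
    simp at h2 ⊢
    rw [← h2]; simp

theorem sgn_smul_mem {V : Type} [AddCommGroup V] [Module F V] (W : Submodule F V) (s : ℤˣ) (v : V)
    (h : ((s : ℤ) : F) • v ∈ W) : v ∈ W := by
  rcases Int.units_eq_one_or s with rfl | rfl <;> simpa using h

theorem irr_tw {X : FDRep F S7} (h : IrrF X) : IrrF (twR X) := by
  refine ⟨h.1, fun W hW => h.2 W fun g v hv => ?_⟩
  exact sgn_smul_mem (V := X) W (Equiv.Perm.sign g) (X.ρ g v) (hW g v hv)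
end

noncomputable def Fam.tw (Φ : Fam) : Fam where
  X F _ _ := twR (Φ.X F)
  irr F _ _ := irr_tw (Φ.irr F)
  bc k K _ _ _ _ _ := by
    obtain ⟨b, h1, h2, h3⟩ := Φ.bc k K
    refine ⟨b, h1, fun g v => ?_, h3⟩
    refine (congrArg b (tw_ρ (Φ.X k) g v)).trans (Eq.trans ?_ (tw_ρ (Φ.X K) g (b v)).symm)
    refine (h1 _ _).trans ?_
    refine (congrArg (fun y => algebraMap k K _ • y) (h2 g v)).trans ?_
    simp
end A7

namespace A7
theorem forall7 {P : Fin 7 → Prop} (h0 : P 0) (h1 : P 1) (h2 : P 2) (h3 : P 3) (h4 : P 4) (h5 : P 5) (h6 : P 6) : ∀ a, P a := by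
  intro a
  fin_cases a <;> assumption
theorem exists_perm4 (a b c d : Fin 7) (h : a ≠ b ∧ a ≠ c ∧ a ≠ d ∧ b ≠ c ∧ b ≠ d ∧ c ≠ d) :
    ∃ g : S7, g 0 = a ∧ g 1 = b ∧ g 2 = c ∧ g 3 = d := by
  let e : Fin 4 → Fin 7 := ![a, b, c, d]
  have he : Function.Injective e := by
    intro i j hij
    fin_cases i <;> fin_cases j <;> simp [e] at hij ⊢ <;> grind
  let f : Fin 4 → Fin 7 := ![0, 1, 2, 3]
  have hf : Function.Injective f := by decide
  have hp := Equiv.Perm.isMultiplyPretransitive (Fin 7) 4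
  obtain ⟨g, hg⟩ := hp.exists_smul_eq ⟨f, hf⟩ ⟨e, he⟩
  have h : ∀ i, g (f i) = e i := fun i => DFunLike.congr_fun hg i
  exact ⟨g, h 0, h 1, h 2, h 3⟩

section
variable {F : Type} [Field F]
theorem sub_n3 {X : FDRep F S7} {V : Submodule F X} (hV : Inv X V) (x : subrep X V hV) :
   (subrepι X V hV |> toLin) (n3 _ x) = n3 X (toLin (subrepι X V hV) x) := n3_comm _ _
theorem NP_fn {Ω : Type} [Finite Ω] [MulAction S7 Ω] (x : Ω → F) (w : Ω) : NP (fnRep F S7 Ω) x w =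
   (x w + x (cc⁻¹ • w) + x ((cc ^ 2)⁻¹ • w)) + (x (dd⁻¹ • w) + x (cc⁻¹ • dd⁻¹ • w) + x ((cc ^ 2)⁻¹ • dd⁻¹ • w))
   + (x ((dd ^ 2)⁻¹ • w) + x (cc⁻¹ • (dd ^ 2)⁻¹ • w) + x ((cc ^ 2)⁻¹ • (dd ^ 2)⁻¹ • w)) := rfl
theorem n3_fn {Ω : Type} [Finite Ω] [MulAction S7 Ω] (x : Ω → F) (w : Ω) : n3 (fnRep F S7 Ω) x w =
   x w + x (cc⁻¹ • w) + x ((cc ^ 2)⁻¹ • w) := rfl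
end

-- base change for submodules of function modules
theorem bc_fn {Ω : Type} [Finite Ω] [MulAction S7 Ω] (k K : Type) [Field k] [Field K] [Algebra k K]
    (V : Submodule k (fnRep k S7 Ω)) (hV : Inv _ V) (V' : Submodule K (fnRep K S7 Ω)) (hV' : Inv _ V')
    (h : ∀ f : Ω → k, f ∈ V → (fun w => algebraMap k K (f w)) ∈ V') (hn : Nontrivial (subrep _ V hV)) :
    ∃ b : subrep _ V hV →+ subrep _ V' hV', (∀ (c : k) v, b (c • v) = algebraMap k K c • b v) ∧
      (∀ g v, b ((subrep _ V hV).ρ g v) = (subrep _ V' hV').ρ g (b v)) ∧ ∃ u, b u ≠ 0 := by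
  let b : V →+ V' :=
    { toFun := fun f => ⟨fun w => algebraMap k K (f.1 w), h f.1 f.2⟩
      map_zero' := Subtype.ext (funext fun w => map_zero _)
      map_add' := fun f g => Subtype.ext (funext fun w => map_add _ _ _) }
  refine ⟨b, fun c v => Subtype.ext (funext fun w => map_mul _ _ _), fun g v => rfl, ?_⟩
  obtain ⟨u, hu⟩ := @exists_ne V hn 0
  refine ⟨u, fun h0 => hu ?_⟩
  apply Subtype.ext; funext w
  have := congrFun (congrArg Subtype.val h0) w
  exact (map_eq_zero (algebraMap k K)).1 this

-- trivial module
noncomputable def fam1 : Fam where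
  X F _ _ := FDRep.of (V := F) (1 : Representation F S7 F)
  irr F _ _ := by
    refine ⟨inferInstanceAs (Nontrivial F), fun W _ => ?_⟩
    have := eq_bot_or_eq_top (show Submodule F F from W)
    exact this
  bc k K _ _ _ _ _ := ⟨(algebraMap k K).toAddMonoidHom, fun c v => map_mul (algebraMap k K) c v, fun g v => rfl, (1 : k), by
    show algebraMap k K 1 ≠ 0
    simp⟩
theorem fam1_ty (F : Type) [Field F] [CharP F 3] : Ty (fam1.X F) (.t0 1) := by
  refine ⟨fun x => rfl, fun x => ?_⟩
  rw [show (((1 : ℤˣ) : ℤ) : F) = 1 by simp, one_smul]; rfl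

section six
variable (F : Type) [Field F] 
def V6' : Submodule F (Fin 7 → F) where
  carrier := {f | ∑ i, f i = 0}
  add_mem' := fun {a b} ha hb => by
    simp only [Set.mem_setOf_eq, Pi.add_apply, Finset.sum_add_distrib] at *; rw [ha, hb, add_zero]
  zero_mem' := by simp
  smul_mem' := fun c a ha => by
    simp only [Set.mem_setOf_eq, Pi.smul_apply, ← Finset.smul_sum] at *; rw [ha, smul_zero]
noncomputable def V6 : Submodule F (fnRep F S7 (Fin 7)) := V6' F
theorem mem_V6 (f : Fin 7 → F) : f ∈ V6 F ↔ ∑ i, f i = 0 := Iff.rfl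
theorem V6_inv : Inv _ (V6 F) := by
  intro g f hf
  refine (mem_V6 F _).2 ?_
  refine Eq.trans ?_ ((mem_V6 F f).1 hf)
  exact Equiv.sum_comp g⁻¹ f
def uA : Fin 7 → F := ![1, 1, 1, 0, 0, 0, 0]
theorem B6 (x : Fin 7 → F) : Bf F (Fin 7) x (uA F) = x 0 + x 1 + x 2 := by
  rw [Bf_apply, Fin.sum_univ_seven]; simp [uA]
variable [CharP F 3]
theorem h3F : (3 : F) = 0 := by exact_mod_cast CharP.cast_eq_zero F 3
theorem n36 (x : Fin 7 → F) : @Eq (Fin 7 → F) (n3 (fnRep F S7 (Fin 7)) x) ((x 0 + x 1 + x 2) • uA F) := by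
  have h3 := h3F F
  funext a
  revert a
  apply forall7
  · change x 0 + x 2 + x 1 = (x 0 + x 1 + x 2) * 1; ring
  · change x 1 + x 0 + x 2 = (x 0 + x 1 + x 2) * 1; ring
  · change x 2 + x 1 + x 0 = (x 0 + x 1 + x 2) * 1; ring
  · change x 3 + x 3 + x 3 = (x 0 + x 1 + x 2) * 0; linear_combination x 3 * h3
  · change x 4 + x 4 + x 4 = (x 0 + x 1 + x 2) * 0; linear_combination x 4 * h3
  · change x 5 + x 5 + x 5 = (x 0 + x 1 + x 2) * 0; linear_combination x 5 * h3
  · change x 6 + x 6 + x 6 = (x 0 + x 1 + x 2) * 0; linear_combination x 6 * h3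
theorem rad6 (x : Fin 7 → F) (hx : x ∈ V6 F) (H : ∀ g : S7, x (g 0) + x (g 1) + x (g 2) = 0) : x = 0 := by
  funext a
  have hs := (mem_V6 F x).1 hx
  rw [← Equiv.sum_comp (Equiv.swap 6 a), Fin.sum_univ_seven] at hs
  have h1 := H (Equiv.swap 6 a)
  have h2 := H (Equiv.swap 6 a * ss)
  change x (Equiv.swap 6 a 3) + x (Equiv.swap 6 a 4) + x (Equiv.swap 6 a 5) = 0 at h2
  rw [Equiv.swap_apply_left] at hs
  show x a = 0
  linear_combination hs - h1 - h2
theorem V6_irr : IrrF (subrep _ (V6 F) (V6_inv F)) := by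
  apply irr_sub
  · intro h
    have h1 : (![1, -1, 0, 0, 0, 0, 0] : Fin 7 → F) ∈ V6 F := (mem_V6 F _).2 (by rw [Fin.sum_univ_seven]; simp)
    rw [h] at h1
    have h2 : (![1, -1, 0, 0, 0, 0, 0] : Fin 7 → F) = 0 := h1
    have := congrFun h2 0
    simp at this
  · intro W hW hWV
    refine core_form _ (Bf F (Fin 7)) (Bf_inv) (V6 F) ⊥ (V6_inv F) bot_le ?_ (uA F) ?_ ?_ W hW bot_le hWV
    · rintro x hx y rfl
      exact map_zero _
    · intro W hW x hx hxV
      have := n3_mem hW hx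
      refine Set.mem_of_eq_of_mem ?_ this
      refine Eq.trans ?_ (n36 F x).symm
      exact congrArg (fun c : F => c • uA F) (B6 F x)
    · intro x hx H
      refine rad6 F x hx fun g => ?_
      have := (B6 F _).symm.trans (H g⁻¹)
      have h : x ((g⁻¹)⁻¹ 0) + x ((g⁻¹)⁻¹ 1) + x ((g⁻¹)⁻¹ 2) = 0 := this
      rwa [inv_inv] at h
end six
noncomputable def fam6 : Fam where
  X F _ _ := subrep _ (V6 F) (V6_inv F)
  irr F _ _ := V6_irr F
  bc k K _ _ _ _ _ := bc_fn k K _ _ _ _ (fun f hf => (mem_V6 K _).2 (by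
    rw [← map_sum, (mem_V6 k f).1 hf, map_zero])) (V6_irr k).1
theorem fam6_ty (F : Type) [Field F] [CharP F 3] : Ty (fam6.X F) (.t1 1) := by
  have key : ∀ x : V6 F, (n3 (fam6.X F) x : V6 F).1 = (x.1 0 + x.1 1 + x.1 2) • uA F := fun x =>
    (n3_comm (subrepι _ (V6 F) (V6_inv F)) x).trans (n36 F x.1)
  refine ⟨fun x => ?_, ?_, fun x => ?_⟩
  · have : ∀ x : V6 F, (NP (fam6.X F) x : V6 F).1 = (x.1 0 + x.1 1 + x.1 2) • (uA F + uA F + uA F) := fun x => by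
      refine (NP_comm (subrepι _ (V6 F) (V6_inv F)) x).trans ?_
      funext w
      have h := n36 F x.1
      have e : ∀ w, n3 (fnRep F S7 (Fin 7)) x.1 w = (x.1 0 + x.1 1 + x.1 2) * uA F w := fun w => congrFun h w
      change n3 (fnRep F S7 (Fin 7)) x.1 w + n3 (fnRep F S7 (Fin 7)) x.1 (dd⁻¹ • w) + n3 (fnRep F S7 (Fin 7)) x.1 ((dd ^ 2)⁻¹ • w) = (x.1 0 + x.1 1 + x.1 2) * (uA F w + uA F w + uA F w)
      rw [e, e, e]
      have : ∀ w, uA F (dd⁻¹ • w) = uA F w ∧ uA F ((dd ^ 2)⁻¹ • w) = uA F w := by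
        apply forall7 <;> exact ⟨rfl, rfl⟩
      rw [(this w).1, (this w).2]; ring
    apply Subtype.ext
    refine (this x).trans ?_
    funext w
    show _ * (uA F w + uA F w + uA F w) = 0
    linear_combination ((show V6 F from x).1 0 + (show V6 F from x).1 1 + (show V6 F from x).1 2) * uA F w * h3F F
  · refine ⟨(⟨![1, 0, 0, -1, 0, 0, 0], (mem_V6 F _).2 (by rw [Fin.sum_univ_seven]; simp)⟩ : V6 F), fun h => ?_⟩
    have h1 := (key _).symm.trans (congrArg Subtype.val h)
    have h2 := congrFun h1 0
    change ((1:F) + 0 + 0) * 1 = 0 at h2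
    simp at h2
  · rw [show (((1 : ℤˣ) : ℤ) : F) = 1 by simp, one_smul]
    apply Subtype.ext
    have h1 := key x
    funext w
    have e : ∀ w, (n3 (fam6.X F) x : V6 F).1 w = ((show V6 F from x).1 0 + (show V6 F from x).1 1 + (show V6 F from x).1 2) * uA F w := fun w => congrFun h1 w
    refine (e (tt⁻¹ w)).trans (Eq.trans ?_ (e w).symm)
    have : ∀ w, uA F (tt⁻¹ w) = uA F w := by apply forall7 <;> rfl
    rw [this w]
end A7

namespace A7
theorem pv : (∀ a : Fin 7, cc⁻¹ • a = ![2,0,1,3,4,5,6] a) ∧ (∀ a : Fin 7, (cc ^ 2)⁻¹ • a = ![1,2,0,3,4,5,6] a) ∧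
  (∀ a : Fin 7, dd⁻¹ • a = ![0,1,2,5,3,4,6] a) ∧ (∀ a : Fin 7, (dd ^ 2)⁻¹ • a = ![0,1,2,4,5,3,6] a) := by decide
section
variable (F : Type) [Field F]
def uB : Fin 7 → F := ![0, 0, 0, 1, 1, 1, 0]
def ell (x : Fin 7 × Fin 7 → F) : F := x (0,3) + x (0,4) + x (0,5) + x (1,3) + x (1,4) + x (1,5) + x (2,3) + x (2,4) + x (2,5)
def ell' (x : Fin 7 × Fin 7 → F) : F := x (3,0) + x (4,0) + x (5,0) + x (3,1) + x (4,1) + x (5,1) + x (3,2) + x (4,2) + x (5,2)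
variable [CharP F 3]
set_option maxHeartbeats 1000000 in
theorem NP2 (x : Fin 7 × Fin 7 → F) (a b : Fin 7) : NP (fnRep F S7 (Fin 7 × Fin 7)) x (a, b) =
   ell F x * (uA F a * uB F b) + ell' F x * (uB F a * uA F b) := by
  have h3 := h3F F
  refine (NP_fn x (a, b)).trans ?_
  simp only [Prod.smul_mk, pv.1, pv.2.1, pv.2.2.1, pv.2.2.2]
  revert a b
  apply forall7 <;> apply forall7 <;> simp [uA, uB, ell, ell'] <;> grind
end
theorem exists_perm3 (a b c : Fin 7) (h : a ≠ b ∧ a ≠ c ∧ b ≠ c) :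
    ∃ g : S7, g 0 = a ∧ g 1 = b ∧ g 2 = c := by
  have : ∀ a b c : Fin 7, ∃ d, a ≠ d ∧ b ≠ d ∧ c ≠ d := by decide
  obtain ⟨d, h1, h2, h3⟩ := this a b c
  obtain ⟨g, h4, h5, h6, _⟩ := exists_perm4 a b c d ⟨h.1, h.2.1, h1, h.2.2, h2, h3⟩
  exact ⟨g, h4, h5, h6⟩
theorem exists_perm2 (a b : Fin 7) (h : a ≠ b) : ∃ g : S7, g 0 = a ∧ g 1 = b := by
  have : ∀ a b : Fin 7, ∃ d, a ≠ d ∧ b ≠ d := by decide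
  obtain ⟨d, h1, h2⟩ := this a b
  obtain ⟨g, h4, h5, h6⟩ := exists_perm3 a b d ⟨h, h1, h2⟩
  exact ⟨g, h4, h5⟩
section fifteen
variable (F : Type) [Field F]
def V15' : Submodule F (Fin 7 × Fin 7 → F) where
  carrier := {f | (∀ a b, f (a, b) = - f (b, a)) ∧ ∀ a, ∑ i, f (a, i) = 0}
  add_mem' := fun {f g} hf hg => by
    refine ⟨fun a b => ?_, fun a => ?_⟩
    · simp only [Pi.add_apply]; rw [hf.1, hg.1]; ring
    · simp only [Pi.add_apply]; rw [Finset.sum_add_distrib, hf.2, hg.2, add_zero]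
  zero_mem' := by refine ⟨fun a b => ?_, fun a => ?_⟩ <;> simp
  smul_mem' := fun c f hf => by
    refine ⟨fun a b => ?_, fun a => ?_⟩
    · simp only [Pi.smul_apply]; rw [hf.1, smul_neg]
    · simp only [Pi.smul_apply]; rw [← Finset.smul_sum, hf.2, smul_zero]
noncomputable def V15 : Submodule F (fnRep F S7 (Fin 7 × Fin 7)) := V15' F
theorem mem_V15 (f : Fin 7 × Fin 7 → F) : f ∈ V15 F ↔ (∀ a b, f (a, b) = - f (b, a)) ∧ ∀ a, ∑ i, f (a, i) = 0 := Iff.rfl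
theorem V15_inv : Inv _ (V15 F) := by
  intro g f hf
  exact ⟨fun a b => hf.1 _ _, fun a => (Equiv.sum_comp g⁻¹ (fun i => f (g⁻¹ a, i))).trans (hf.2 _)⟩
def u15 : Fin 7 × Fin 7 → F := fun p => uA F p.1 * uB F p.2 - uB F p.1 * uA F p.2
theorem B15 (x : Fin 7 × Fin 7 → F) : Bf F (Fin 7 × Fin 7) x (u15 F) = ell F x - ell' F x := by
  rw [Bf_apply, Fintype.sum_prod_type, Fin.sum_univ_seven]
  simp only [Fin.sum_univ_seven]
  simp [uA, uB, u15, ell, ell']; ring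
theorem ell15 {x : Fin 7 × Fin 7 → F} (hx : x ∈ V15 F) : ell' F x = - ell F x := by
  unfold ell ell'
  rw [hx.1 3, hx.1 4, hx.1 5, hx.1 3, hx.1 4, hx.1 5, hx.1 3, hx.1 4, hx.1 5]; ring
variable [CharP F 3]
theorem h2F {x : F} (h : 2 * x = 0) : x = 0 := by linear_combination (-1) * h + x * h3F F
theorem NP15 {x : Fin 7 × Fin 7 → F} (hx : x ∈ V15 F) : @Eq (Fin 7 × Fin 7 → F) (NP (fnRep F S7 (Fin 7 × Fin 7)) x) (ell F x • u15 F) := by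
  funext ⟨a, b⟩
  refine (NP2 F x a b).trans ?_
  show _ = ell F x * (uA F a * uB F b - uB F a * uA F b)
  rw [ell15 F hx]; ring
theorem rad15 (x : Fin 7 × Fin 7 → F) (hx : x ∈ V15 F) (H : ∀ g : S7, ell F (fun p => x (g p.1, g p.2)) = 0) : x = 0 := by
  have T : ∀ g : S7, x (g 0, g 6) + x (g 1, g 6) + x (g 2, g 6) = 0 := by
    intro g
    have h := H g
    have r : ∀ a, x (g a, g 0) + x (g a, g 1) + x (g a, g 2) + x (g a, g 3) + x (g a, g 4) + x (g a, g 5) + x (g a, g 6) = 0 := fun a => by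
      have := hx.2 (g a)
      rwa [← Equiv.sum_comp g, Fin.sum_univ_seven] at this
    have s : ∀ a b, x (g a, g b) = - x (g b, g a) := fun a b => hx.1 _ _
    have d : ∀ a, x (g a, g a) = 0 := fun a => h2F F (by linear_combination s a a)
    simp only [ell] at h
    linear_combination r 0 + r 1 + r 2 - h - d 0 - d 1 - d 2 - s 0 1 - s 0 2 - s 1 2
  have E : ∀ g : S7, x (g 0, g 6) = x (g 3, g 6) := fun g => by
    have h1 := T g
    have h2 := T (g * Equiv.swap 0 3)
    change x (g 3, g 6) + x (g 1, g 6) + x (g 2, g 6) = 0 at h2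
    linear_combination h1 - h2
  have E' : ∀ g : S7, x (g 0, g 1) = x (g 2, g 1) := fun g => E (g * (Equiv.swap 6 1 * Equiv.swap 3 2))
  have s : ∀ a b, x (a, b) = - x (b, a) := fun a b => hx.1 _ _
  have Z : ∀ g : S7, x (g 0, g 1) = 0 := fun g => by
    have e1 := E' g
    have e2 : x (g 1, g 2) = x (g 0, g 2) := E' (g * (Equiv.swap 0 2 * Equiv.swap 0 1))
    have e3 : x (g 2, g 0) = x (g 1, g 0) := E' (g * (Equiv.swap 0 1 * Equiv.swap 0 2))
    apply h2F
    linear_combination e1 + s (g 2) (g 1) - e2 - s (g 0) (g 2) + e3 + s (g 1) (g 0)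
  funext ⟨a, b⟩
  by_cases hab : a = b
  · subst hab
    exact h2F F (by linear_combination s a a)
  · obtain ⟨g, rfl, rfl⟩ := exists_perm2 a b hab
    exact Z g
theorem u15_mem : u15 F ∈ V15 F := by
  refine ⟨fun a b => by simp only [u15]; ring, ?_⟩
  have h3 := h3F F
  apply forall7 <;> rw [Fin.sum_univ_seven] <;> simp [u15, uA, uB] <;> grind
theorem u15_ne : u15 F ≠ 0 := fun h => by
  have := congrFun h (0, 3)
  simp [u15, uA, uB] at this
theorem V15_irr : IrrF (subrep _ (V15 F) (V15_inv F)) := by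
  apply irr_sub
  · intro h
    have h1 := u15_mem F
    rw [h] at h1
    exact u15_ne F h1
  · intro W hW hWV
    refine core_form _ (Bf F _) (Bf_inv) (V15 F) ⊥ (V15_inv F) bot_le ?_ (u15 F) ?_ ?_ W hW bot_le hWV
    · rintro x hx y rfl
      exact map_zero _
    · intro W hW x hx hxV
      have := W.smul_mem (2 : F) (NP_mem hW hx)
      refine Set.mem_of_eq_of_mem ?_ this
      refine (congrArg (fun c : F => c • u15 F) (B15 F x)).trans ?_
      refine Eq.trans ?_ (congrArg (fun c : Fin 7 × Fin 7 → F => (2 : F) • c) (NP15 F hxV).symm)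
      show _ = (2 : F) • (ell F x • u15 F)
      rw [ell15 F hxV, smul_smul]; congr 1; ring
    · intro x hx H
      refine rad15 F x hx fun g => ?_
      have := (B15 F _).symm.trans (H g⁻¹)
      rw [ell15 F (V15_inv F _ _ hx)] at this
      have h : ell F (fun p => x ((g⁻¹)⁻¹ p.1, (g⁻¹)⁻¹ p.2)) = 0 := by
        refine h2F F (Eq.trans (two_mul _) (Eq.trans (sub_neg_eq_add _ _).symm this))
      rwa [inv_inv] at h
end fifteen
noncomputable def fam15 : Fam where
  X F _ _ := subrep _ (V15 F) (V15_inv F)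
  irr F _ _ := V15_irr F
  bc k K _ _ _ _ _ := bc_fn k K _ _ _ _ (fun f hf => ⟨fun a b => (congrArg (algebraMap k K) (hf.1 a b)).trans (map_neg _ _), fun a => by
    rw [← map_sum, hf.2, map_zero]⟩) (V15_irr k).1
theorem fam15_ty (F : Type) [Field F] [CharP F 3] : Ty (fam15.X F) (.t2 1 (-1)) := by
  have key : ∀ x : V15 F, (NP (fam15.X F) x : V15 F).1 = ell F x.1 • u15 F := fun x =>
    (NP_comm (subrepι _ (V15 F) (V15_inv F)) x).trans (NP15 F x.2)
  refine ⟨?_, fun x => ?_, fun x => ?_⟩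
  · by_contra! hc
    let v : Fin 7 → F := ![1,0,0,0,0,0,-1]
    let w : Fin 7 → F := ![0,0,0,1,0,0,-1]
    have hv : ∑ i, v i = 0 := by rw [Fin.sum_univ_seven]; simp [v]
    have hw : ∑ i, w i = 0 := by rw [Fin.sum_univ_seven]; simp [w]
    let x : V15 F := ⟨fun p => v p.1 * w p.2 - w p.1 * v p.2, fun a b => by ring, fun a => by
      show ∑ i, (v a * w i - w a * v i) = 0
      rw [Finset.sum_sub_distrib, ← Finset.mul_sum, ← Finset.mul_sum, hv, hw]; ring⟩
    have h1 := (key x).symm.trans (congrArg Subtype.val (hc x))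
    have h2 := congrFun h1 (0, 3)
    change ell F (fun p => v p.1 * w p.2 - w p.1 * v p.2) * (uA F 0 * uB F 3 - uB F 0 * uA F 3) = 0 at h2
    simp [ell, v, w, uA, uB] at h2
  · rw [show (((1 : ℤˣ) : ℤ) : F) = 1 by simp, one_smul]
    apply Subtype.ext
    funext w
    have e : ∀ w, (NP (fam15.X F) x : V15 F).1 w = ell F (show V15 F from x).1 * u15 F w := fun w => congrFun (key x) w
    refine (e (tt⁻¹ • w)).trans (Eq.trans ?_ (e w).symm)
    have : ∀ a b, u15 F (tt⁻¹ a, tt⁻¹ b) = u15 F (a, b) := by apply forall7 <;> apply forall7 <;> rfl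
    rw [← this w.1 w.2]; rfl
  · rw [show (((-1 : ℤˣ) : ℤ) : F) = -1 by simp, neg_one_smul]
    apply Subtype.ext
    funext w
    have e : ∀ w, (NP (fam15.X F) x : V15 F).1 w = ell F (show V15 F from x).1 * u15 F w := fun w => congrFun (key x) w
    refine (e (ss⁻¹ • w)).trans (Eq.trans ?_ (congrArg Neg.neg (e w).symm))
    have h1 : ∀ a, uA F (ss⁻¹ a) = uB F a ∧ uB F (ss⁻¹ a) = uA F a := by apply forall7 <;> exact ⟨rfl, rfl⟩
    have : ∀ a b, u15 F (ss⁻¹ a, ss⁻¹ b) = - u15 F (a, b) := fun a b => by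
      simp only [u15, h1]; ring
    rw [← mul_neg, ← this w.1 w.2]; rfl
end A7

namespace A7
noncomputable def quotπ {F G : Type} [Field F] [Group G] (X : FDRep F G) (C : Submodule F X) (h : Inv X C) : X ⟶ quotRep X C h :=
  mkHom (X := X) (Y := quotRep X C h) C.mkQ (fun g v => rfl)
section
variable (F : Type) [Field F]
def V14' : Submodule F (Fin 7 × Fin 7 → F) where
  carrier := {f | (∀ a b, f (a, b) = f (b, a)) ∧ (∀ a, f (a, a) = 0) ∧ ∀ a, ∑ i, f (a, i) = 0}
  add_mem' := fun {f g} hf hg => by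
    refine ⟨fun a b => ?_, fun a => ?_, fun a => ?_⟩
    · simp only [Pi.add_apply]; rw [hf.1, hg.1]
    · simp only [Pi.add_apply]; rw [hf.2.1, hg.2.1, add_zero]
    · simp only [Pi.add_apply]; rw [Finset.sum_add_distrib, hf.2.2, hg.2.2, add_zero]
  zero_mem' := by refine ⟨fun a b => ?_, fun a => ?_, fun a => ?_⟩ <;> simp
  smul_mem' := fun c f hf => by
    refine ⟨fun a b => ?_, fun a => ?_, fun a => ?_⟩
    · simp only [Pi.smul_apply]; rw [hf.1]
    · simp only [Pi.smul_apply]; rw [hf.2.1, smul_zero]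
    · simp only [Pi.smul_apply]; rw [← Finset.smul_sum, hf.2.2, smul_zero]
noncomputable def V14 : Submodule F (fnRep F S7 (Fin 7 × Fin 7)) := V14' F
theorem mem_V14 (f : Fin 7 × Fin 7 → F) : f ∈ V14 F ↔ (∀ a b, f (a, b) = f (b, a)) ∧ (∀ a, f (a, a) = 0) ∧ ∀ a, ∑ i, f (a, i) = 0 := Iff.rfl
theorem V14_inv : Inv _ (V14 F) := by
  intro g f hf
  exact ⟨fun a b => hf.1 _ _, fun a => hf.2.1 _, fun a => (Equiv.sum_comp g⁻¹ (fun i => f (g⁻¹ a, i))).trans (hf.2.2 _)⟩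
def u13 : Fin 7 × Fin 7 → F := fun p => uA F p.1 * uB F p.2 + uB F p.1 * uA F p.2
theorem B13 (x : Fin 7 × Fin 7 → F) : Bf F (Fin 7 × Fin 7) x (u13 F) = ell F x + ell' F x := by
  rw [Bf_apply, Fintype.sum_prod_type, Fin.sum_univ_seven]
  simp only [Fin.sum_univ_seven]
  simp [uA, uB, u13, ell, ell']; ring
theorem ell13 {x : Fin 7 × Fin 7 → F} (hx : x ∈ V14 F) : ell' F x = ell F x := by
  unfold ell ell'
  rw [hx.1 3, hx.1 4, hx.1 5, hx.1 3, hx.1 4, hx.1 5, hx.1 3, hx.1 4, hx.1 5]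
noncomputable def Y14 : FDRep F S7 := subrep _ (V14 F) (V14_inv F)
def C1' : Submodule F (V14' F) where
  carrier := {f | ∃ c, ∀ a b, a ≠ b → f.1 (a, b) = c}
  add_mem' := by
    rintro f g ⟨c, hc⟩ ⟨d, hd⟩
    exact ⟨c + d, fun a b h => by rw [← hc a b h, ← hd a b h]; rfl⟩
  zero_mem' := ⟨0, fun a b h => rfl⟩
  smul_mem' := by
    rintro e f ⟨c, hc⟩
    exact ⟨e * c, fun a b h => by rw [← hc a b h]; rfl⟩
noncomputable def C1s : Submodule F (Y14 F) := C1' F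
theorem mem_C1 (f : V14' F) : f ∈ C1' F ↔ ∃ c, ∀ a b, a ≠ b → f.1 (a, b) = c := Iff.rfl
theorem C1_inv : Inv _ (C1s F) := by
  rintro g f ⟨c, hc⟩
  exact ⟨c, fun a b h => hc (g⁻¹ a) (g⁻¹ b) (fun h' => h (g⁻¹.injective h'))⟩
variable [CharP F 3]
theorem NP13 {x : Fin 7 × Fin 7 → F} (hx : x ∈ V14 F) : @Eq (Fin 7 × Fin 7 → F) (NP (fnRep F S7 (Fin 7 × Fin 7)) x) (ell F x • u13 F) := by
  funext ⟨a, b⟩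
  refine (NP2 F x a b).trans ?_
  show _ = ell F x * (uA F a * uB F b + uB F a * uA F b)
  rw [ell13 F hx]; ring
theorem u13_mem : u13 F ∈ V14 F := by
  have h3 := h3F F
  refine ⟨fun a b => by simp only [u13]; ring, ?_, ?_⟩
  · apply forall7 <;> simp [u13, uA, uB]
  · apply forall7 <;> rw [Fin.sum_univ_seven] <;> simp [u13, uA, uB] <;> grind
theorem rad13 (x : Fin 7 × Fin 7 → F) (hx : x ∈ V14 F) (H : ∀ g : S7, ell F (fun p => x (g p.1, g p.2)) = 0) :
    ∃ c, ∀ a b, a ≠ b → x (a, b) = c := by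
  have h3 := h3F F
  have s : ∀ a b, x (a, b) = x (b, a) := fun a b => hx.1 _ _
  have R : ∀ g : S7, x (g 0, g 6) + x (g 1, g 6) + x (g 2, g 6) = x (g 0, g 1) + x (g 0, g 2) + x (g 1, g 2) := by
    intro g
    have h := H g
    have r : ∀ a, x (g a, g 0) + x (g a, g 1) + x (g a, g 2) + x (g a, g 3) + x (g a, g 4) + x (g a, g 5) + x (g a, g 6) = 0 := fun a => by
      have := hx.2.2 (g a)
      rwa [← Equiv.sum_comp g, Fin.sum_univ_seven] at this
    have d : ∀ a, x (g a, g a) = 0 := fun a => hx.2.1 _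
    simp only [ell] at h
    linear_combination r 0 + r 1 + r 2 - h - d 0 - d 1 - d 2 + s (g 0) (g 1) + s (g 0) (g 2) + s (g 1) (g 2) - (x (g 0, g 1) + x (g 0, g 2) + x (g 1, g 2)) * h3
  have E : ∀ g : S7, x (g 0, g 1) = x (g 2, g 6) := fun g => by
    have h1 := R g
    have h2 := R (g * Equiv.swap 2 6)
    change x (g 0, g 2) + x (g 1, g 2) + x (g 6, g 2) = x (g 0, g 1) + x (g 0, g 6) + x (g 1, g 6) at h2
    rw [s (g 6) (g 2)] at h2
    linear_combination h1 + h2 + (x (g 0, g 1) - x (g 2, g 6)) * h3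
  have E2 : ∀ g : S7, x (g 0, g 1) = x (g 0, g 2) := fun g => by
    have h1 : x (g 0, g 1) = x (g 3, g 4) := E (g * (Equiv.swap 2 3 * Equiv.swap 6 4))
    have h2 : x (g 0, g 2) = x (g 3, g 4) := E (g * (Equiv.swap 1 2 * (Equiv.swap 2 3 * Equiv.swap 6 4)))
    rw [h1, h2]
  have E3 : ∀ a b c, a ≠ b → a ≠ c → x (a, b) = x (a, c) := fun a b c h1 h2 => by
    by_cases hbc : b = c
    · rw [hbc]
    · obtain ⟨g, rfl, rfl, rfl⟩ := exists_perm3 a b c ⟨h1, h2, hbc⟩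
      exact E2 g
  refine ⟨x (0, 1), fun a b hab => ?_⟩
  by_cases ha : a = 0
  · subst ha; exact E3 _ _ _ hab (by decide)
  · rw [E3 a b 0 hab ha, s a 0]
    exact E3 _ _ _ (Ne.symm ha) (by decide)
theorem NPY (x : V14 F) : (NP (Y14 F) x : V14 F) = ell F x.1 • (⟨u13 F, u13_mem F⟩ : V14 F) := 
  Subtype.ext ((NP_comm (subrepι _ (V14 F) (V14_inv F)) x).trans (NP13 F x.2))
theorem u13_nc : ¬ (⟨u13 F, u13_mem F⟩ : V14' F) ∈ C1' F := by
  rintro ⟨c, hc⟩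
  have h1 := hc 0 1 (by decide)
  have h2 := hc 0 3 (by decide)
  simp [u13, uA, uB] at h1 h2
  rw [← h1] at h2; exact one_ne_zero h2
theorem X13_irr : IrrF (quotRep (Y14 F) (C1s F) (C1_inv F)) := by
  apply irr_quot
  · intro h
    apply u13_nc F
    have : (⟨u13 F, u13_mem F⟩ : V14' F) ∈ C1s F := by rw [h]; trivial
    exact this
  · intro W hW hWV
    have hB : ∀ g (x y : Y14 F), ((Bf F (Fin 7 × Fin 7)).domRestrict₁₂ (V14' F) (V14' F)) ((Y14 F).ρ g x) ((Y14 F).ρ g y) = ((Bf F (Fin 7 × Fin 7)).domRestrict₁₂ (V14' F) (V14' F)) x y := fun g x y =>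
       Bf_inv g (show V14' F from x).1 (show V14' F from y).1
    refine core_form (Y14 F) ((Bf F (Fin 7 × Fin 7)).domRestrict₁₂ (V14' F) (V14' F)) hB ⊤ (C1s F) (fun _ _ _ => trivial) le_top ?_ (⟨u13 F, u13_mem F⟩ : V14' F) ?_ ?_ W hW hWV le_top
    · rintro (x : V14' F) _ (y : V14' F) ⟨c, hc⟩
      show Bf F _ x.1 y.1 = 0
      have h1 : ∀ w, x.1 w * y.1 w = x.1 w * c := fun ⟨a, b⟩ => by
        by_cases h : a = b
        · subst h
          rw [x.2.2.1]; ring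
        · rw [hc a b h]
      rw [Bf_apply, Finset.sum_congr rfl (fun w _ => h1 w), ← Finset.sum_mul, Fintype.sum_prod_type]
      rw [Finset.sum_congr rfl (fun a _ => x.2.2.2 a)]; simp
    · intro W hW x hx _
      have := W.smul_mem (2 : F) (NP_mem hW hx)
      refine Set.mem_of_eq_of_mem ?_ this
      have hB' := B13 F (show V14' F from x).1
      rw [ell13 F (show V14' F from x).2] at hB'
      refine (congrArg (fun c : F => c • (⟨u13 F, u13_mem F⟩ : V14' F)) hB').trans ?_
      refine Eq.trans ?_ (congrArg (fun c : V14' F => (2 : F) • c) (NPY F x).symm)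
      refine Eq.trans ?_ (smul_smul (2:F) (ell F (show V14' F from x).1) (⟨u13 F, u13_mem F⟩ : V14' F)).symm
      rw [two_mul]
    · intro x _ H
      refine rad13 F (show V14' F from x).1 (show V14' F from x).2 fun g => ?_
      have := (B13 F _).symm.trans (H g⁻¹)
      have e := ell13 F (V14_inv F g⁻¹ _ (show V14' F from x).2)
      have h : ell F (fun p => (show V14' F from x).1 ((g⁻¹)⁻¹ p.1, (g⁻¹)⁻¹ p.2)) = 0 := by
        refine h2F F (Eq.trans (two_mul _) (Eq.trans (congrArg (fun z => _ + z) e.symm) this))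
      rwa [inv_inv] at h
end
section
variable (k K : Type) [Field k] [Field K] [Algebra k K]
noncomputable def sl14 : V14' k →ₛₗ[algebraMap k K] V14' K where
  toFun f := ⟨fun w => algebraMap k K (f.1 w), fun a b => congrArg _ (f.2.1 a b), fun a => by
    show algebraMap k K _ = 0
    rw [f.2.2.1, map_zero], fun a => by
    show ∑ i, algebraMap k K _ = 0
    rw [← map_sum, f.2.2.2, map_zero]⟩
  map_add' f g := Subtype.ext (funext fun w => map_add _ _ _)
  map_smul' c g := Subtype.ext (funext fun w => map_mul _ _ _)
noncomputable def sl13 : (V14' k ⧸ C1' k) →ₛₗ[algebraMap k K] (V14' K ⧸ C1' K) :=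
  (C1' k).mapQ (C1' K) (sl14 k K) (by
    rintro f ⟨c, hc⟩
    exact ⟨algebraMap k K c, fun a b h => congrArg _ (hc a b h)⟩)
end
noncomputable def fam13 : Fam where
  X F _ _ := quotRep (Y14 F) (C1s F) (C1_inv F)
  irr F _ _ := X13_irr F
  bc k K _ _ _ _ _ := by
    refine ⟨(sl13 k K).toAddMonoidHom, fun c v => (sl13 k K).map_smulₛₗ c v, fun g v => ?_, (Submodule.Quotient.mk (⟨u13 k, u13_mem k⟩ : V14' k)), ?_⟩
    · obtain ⟨f, rfl⟩ := (C1' k).mkQ_surjective v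
      rfl
    · intro h
      have h1 := (Submodule.Quotient.mk_eq_zero (C1' K)).1 h
      refine u13_nc K (Set.mem_of_eq_of_mem ?_ h1)
      apply Subtype.ext; funext ⟨a, b⟩
      have hA : ∀ a, algebraMap k K (uA k a) = uA K a := by apply forall7 <;> simp [uA]
      have hB : ∀ a, algebraMap k K (uB k a) = uB K a := by apply forall7 <;> simp [uB]
      show u13 K (a, b) = algebraMap k K (u13 k (a, b))
      simp only [u13, map_add, map_mul, hA, hB]
theorem fam13_ty (F : Type) [Field F] [CharP F 3] : Ty (fam13.X F) (.t2 1 1) := by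
  have key : ∀ x : V14 F, NP (fam13.X F) ((C1' F).mkQ x) = ell F x.1 • (C1' F).mkQ ⟨u13 F, u13_mem F⟩ := fun x =>
    ((NP_comm (quotπ _ (C1s F) (C1_inv F)) x).symm.trans (congrArg (C1' F).mkQ (NPY F x))).trans (map_smul _ _ _)
  have h1 : ∀ g : S7, (∀ a b, u13 F (g⁻¹ a, g⁻¹ b) = u13 F (a, b)) → ∀ x, (fam13.X F).ρ g (NP (fam13.X F) x) = NP (fam13.X F) x := by
    intro g hg x
    obtain ⟨x, rfl⟩ := (C1' F).mkQ_surjective x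
    refine (congrArg ((fam13.X F).ρ g) (key x)).trans (Eq.trans ?_ (key x).symm)
    refine (map_smul ((fam13.X F).ρ g) _ _).trans (congrArg (fun y : V14' F ⧸ C1' F => ell F x.1 • y) ?_)
    refine congrArg (C1' F).mkQ (Subtype.ext (funext fun w => ?_))
    exact hg w.1 w.2
  refine ⟨?_, fun x => ?_, fun x => ?_⟩
  · by_contra! hc
    let v : Fin 7 → F := ![1,-1,0,0,0,0,0]
    let w : Fin 7 → F := ![0,0,0,1,-1,0,0]
    let m : Fin 7 → Fin 7 → F := ![![0,0,0,1,0,0,-1],![0,0,-1,0,0,0,1],![0,-1,0,0,0,0,1],![1,0,0,0,0,0,-1],![0,0,0,0,0,0,0],![0,0,0,0,0,0,0],![-1,1,1,-1,0,0,0]]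
    let x : V14 F := ⟨fun p => m p.1 p.2, by apply forall7 <;> apply forall7 <;> rfl, by apply forall7 <;> rfl, by
      apply forall7 <;> rw [Fin.sum_univ_seven] <;> simp [m]⟩
    have h1 := (key x).symm.trans (hc ((C1' F).mkQ x))
    have h2 : ell F x.1 = 1 := by simp [ell, x, m]
    rw [h2, one_smul] at h1
    exact u13_nc F ((Submodule.Quotient.mk_eq_zero (C1' F)).1 h1)
  · rw [show (((1 : ℤˣ) : ℤ) : F) = 1 by simp, one_smul]
    exact h1 tt (by apply forall7 <;> apply forall7 <;> rfl) x
  · rw [show (((1 : ℤˣ) : ℤ) : F) = 1 by simp, one_smul]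
    refine h1 ss (fun a b => ?_) x
    have h1 : ∀ a, uA F (ss⁻¹ a) = uB F a ∧ uB F (ss⁻¹ a) = uA F a := by apply forall7 <;> exact ⟨rfl, rfl⟩
    simp only [u13, h1]; ring
end A7

namespace A7
@[ext] structure Cj where
  q : S7
deriving DecidableEq
instance : Fintype Cj := Fintype.ofEquiv S7 ⟨fun p => ⟨p⟩, fun p => p.q, fun _ => rfl, fun _ => rfl⟩
def Cj.inv (π : Cj) : Cj := ⟨π.q⁻¹⟩
instance : MulAction S7 Cj where
  smul g π := ⟨g * π.q * g⁻¹⟩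
  one_smul π := Cj.ext (show ((1 : S7) * π.q * 1⁻¹ : S7) = π.q by simp)
  mul_smul g h π := Cj.ext (show ((g * h) * π.q * (g * h)⁻¹ : S7) = g * (h * π.q * h⁻¹) * g⁻¹ by simp [mul_assoc])
abbrev T3 := Fin 7 × Fin 7 × Fin 7
def cyc (p : T3) : Cj := ⟨Equiv.swap p.1 p.2.1 * Equiv.swap p.2.1 p.2.2⟩
def D3 (p : T3) : Prop := p.1 ≠ p.2.1 ∧ p.1 ≠ p.2.2 ∧ p.2.1 ≠ p.2.2
instance : DecidablePred D3 := fun p => by unfold D3; infer_instance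
theorem cyc_conj (g : S7) (p : T3) : g • cyc p = cyc (g • p) := by
  apply Cj.ext
  show (g * (Equiv.swap p.1 p.2.1 * Equiv.swap p.2.1 p.2.2) * g⁻¹ : S7) = Equiv.swap (g p.1) (g p.2.1) * Equiv.swap (g p.2.1) (g p.2.2)
  rw [Equiv.swap_apply_apply, Equiv.swap_apply_apply]; group
theorem D3_smul (g : S7) (p : T3) : D3 (g • p) ↔ D3 p := by
  show (g p.1 ≠ g p.2.1 ∧ g p.1 ≠ g p.2.2 ∧ g p.2.1 ≠ g p.2.2) ↔ _
  simp [D3]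
theorem conj_inv (g : S7) (π : Cj) : (g • π).inv = g • π.inv := by
  apply Cj.ext
  show ((g * π.q * g⁻¹ : S7)⁻¹ : S7) = g * (π.q)⁻¹ * g⁻¹
  group
theorem cyc_app (a b c : Fin 7) (h : D3 (a, b, c)) (m : Fin 7) : (cyc (a, b, c)).q m = if m = a then b else if m = b then c else if m = c then a else m := by
  obtain ⟨h1, h2, h3⟩ := h
  simp only at h1 h2 h3
  show Equiv.swap a b (Equiv.swap b c m) = _
  simp only [Equiv.swap_apply_def]
  grind
theorem cyc_rot (a b c : Fin 7) (h : D3 (a, b, c)) : cyc (b, c, a) = cyc (a, b, c) := by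
  refine Cj.ext (Equiv.ext fun m => ?_)
  obtain ⟨h1, h2, h3⟩ := id h
  simp only at h1 h2 h3
  refine (cyc_app b c a ⟨h3, h1.symm, h2.symm⟩ m).trans (Eq.trans ?_ (cyc_app a b c h m).symm)
  grind
theorem cyc_inv (a b c : Fin 7) : (cyc (a, b, c)).inv = cyc (c, b, a) := by
  apply Cj.ext
  show ((Equiv.swap a b * Equiv.swap b c : S7)⁻¹ : S7) = Equiv.swap c b * Equiv.swap b a
  rw [mul_inv_rev, Equiv.swap_inv, Equiv.swap_inv, Equiv.swap_comm b c, Equiv.swap_comm a b]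
theorem cyc_inj {a b c p q r : Fin 7} (h : D3 (a, b, c)) (h' : D3 (p, q, r)) (e : cyc (a, b, c) = cyc (p, q, r)) :
   (p = a ∧ q = b ∧ r = c) ∨ (p = b ∧ q = c ∧ r = a) ∨ (p = c ∧ q = a ∧ r = b) := by
  have e1 : ∀ m : Fin 7, (cyc (a, b, c)).q m = (cyc (p, q, r)).q m := fun m => congrArg (fun π : Cj => π.q m) e
  have e2 := e1 p
  have e3 := e1 q
  rw [cyc_app a b c h, cyc_app p q r h'] at e2 e3
  obtain ⟨h1, h2, h3⟩ := h
  obtain ⟨h1', h2', h3'⟩ := h'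
  simp only at h1 h2 h3 h1' h2' h3'
  grind
section
variable (F : Type) [Field F]
def tt3 {F : Type} [Field F] (h : Cj → F) (p : T3) : F := if D3 p then h (cyc p) else 0
def V20' : Submodule F (Cj → F) where
  carrier := {h | (∀ π, (¬ ∃ p, D3 p ∧ π = cyc p) → h π = 0) ∧ (∀ π : Cj, h π.inv = - h π) ∧ ∀ a b, ∑ c, tt3 h (a, b, c) = 0}
  add_mem' := fun {f g} hf hg => by
    refine ⟨fun a b => ?_, fun a => ?_, fun a b => ?_⟩
    · simp only [Pi.add_apply]; rw [hf.1 a b, hg.1 a b, add_zero]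
    · simp only [Pi.add_apply]; rw [hf.2.1, hg.2.1]; ring
    · have : ∀ p, tt3 (f + g) p = tt3 f p + tt3 g p := fun p => by unfold tt3; split_ifs <;> simp
      simp only [this]; rw [Finset.sum_add_distrib, hf.2.2, hg.2.2, add_zero]
  zero_mem' := by refine ⟨fun a b => ?_, fun a => ?_, fun a b => ?_⟩ <;> simp [tt3]
  smul_mem' := fun c f hf => by
    refine ⟨fun a b => ?_, fun a => ?_, fun a b => ?_⟩
    · simp only [Pi.smul_apply]; rw [hf.1 a b, smul_zero]
    · simp only [Pi.smul_apply]; rw [hf.2.1, smul_neg]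
    · have : ∀ p, tt3 (c • f) p = c • tt3 f p := fun p => by unfold tt3; split_ifs <;> simp
      simp only [this]; rw [← Finset.smul_sum, hf.2.2, smul_zero]
noncomputable def V20 : Submodule F (fnRep F S7 Cj) := V20' F
theorem mem_V20 (h : Cj → F) : h ∈ V20 F ↔ (∀ π, (¬ ∃ p, D3 p ∧ π = cyc p) → h π = 0) ∧ (∀ π : Cj, h π.inv = - h π) ∧ ∀ a b, ∑ c, tt3 h (a, b, c) = 0 := Iff.rfl
variable {F}
theorem t_ρ (g : S7) (h : Cj → F) (p : T3) : tt3 ((fnRep F S7 Cj).ρ g h) p = tt3 h (g⁻¹ • p) := by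
  unfold tt3
  simp only [D3_smul]
  rw [← cyc_conj]; rfl
theorem V20_inv : Inv _ (V20 F) := by
  intro g f hf
  refine ⟨fun π hπ => hf.1 _ ?_, fun π => ?_, fun a b => ?_⟩
  · rintro ⟨p, hp, e⟩
    refine hπ ⟨g • p, (D3_smul _ _).2 hp, ?_⟩
    rw [← cyc_conj, ← e, smul_inv_smul]
  · show f (g⁻¹ • π.inv) = - f (g⁻¹ • π)
    rw [← conj_inv]; exact hf.2.1 _
  · refine Eq.trans ?_ ((Equiv.sum_comp g⁻¹ (fun i => tt3 f (g⁻¹ a, g⁻¹ b, i))).trans (hf.2.2 _ _))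
    exact Finset.sum_congr rfl fun c _ => t_ρ g f (a, b, c)
theorem t_rot (h : Cj → F) (a b c : Fin 7) : tt3 h (b, c, a) = tt3 h (a, b, c) := by
  unfold tt3
  by_cases H : D3 (a, b, c)
  · rw [if_pos H, if_pos (by obtain ⟨h1, h2, h3⟩ := id H; exact ⟨h3, h1.symm, h2.symm⟩), cyc_rot _ _ _ H]
  · rw [if_neg H, if_neg]
    rintro ⟨h1, h2, h3⟩; exact H ⟨Ne.symm h2, Ne.symm h3, h1⟩
theorem t_sw {h : Cj → F} (hh : h ∈ V20 F) (a b c : Fin 7) : tt3 h (c, b, a) = - tt3 h (a, b, c) := by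
  unfold tt3
  by_cases H : D3 (a, b, c)
  · rw [if_pos H, if_pos (by obtain ⟨h1, h2, h3⟩ := id H; exact ⟨Ne.symm h3, Ne.symm h2, h1.symm⟩), ← cyc_inv, hh.2.1]
  · rw [if_neg H, if_neg, neg_zero]
    rintro ⟨h1, h2, h3⟩; exact H ⟨Ne.symm h3, Ne.symm h2, h1.symm⟩
theorem t_ne (h : Cj → F) {p : T3} (H : ¬ D3 p) : tt3 h p = 0 := if_neg H
theorem V20_zero {h : Cj → F} (hh : h ∈ V20 F) (H : ∀ p, tt3 h p = 0) : h = 0 := by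
  funext π
  by_cases hp : ∃ p, D3 p ∧ π = cyc p
  · obtain ⟨p, hp, rfl⟩ := hp
    have := H p
    rwa [tt3, if_pos hp] at this
  · exact hh.1 _ hp
-- from alternating functions on triples
def iT (f : T3 → F) : Cj → F := fun π => ∑ p : T3, if (p.1 < p.2.1 ∧ p.1 < p.2.2 ∧ p.2.1 ≠ p.2.2) then (if cyc p = π then f p else 0) else 0
structure IsAlt (f : T3 → F) : Prop where
  rot : ∀ a b c, f (b, c, a) = f (a, b, c)
  sw : ∀ a b c, f (c, b, a) = - f (a, b, c)
  sum : ∀ a b, ∑ c, f (a, b, c) = 0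
theorem iT_cyc1 (f : T3 → F) (a b c : Fin 7) (h : D3 (a, b, c)) (h1 : a < b) (h2 : a < c) : iT f (cyc (a, b, c)) = f (a, b, c) := by
  unfold iT
  rw [Finset.sum_eq_single (a, b, c), if_pos ⟨h1, h2, h.2.2⟩, if_pos rfl]
  · rintro ⟨p, q, r⟩ - hne
    by_cases hc : p < q ∧ p < r ∧ q ≠ r
    · rw [if_pos hc, if_neg]
      intro e
      rcases cyc_inj h ⟨hc.1.ne, hc.2.1.ne, hc.2.2⟩ e.symm with h | h | h
      · exact hne (by rw [h.1, h.2.1, h.2.2])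
      · rw [h.1, h.2.2] at hc; exact absurd hc.2.1 (not_lt.2 h1.le)
      · rw [h.1, h.2.1] at hc; exact absurd hc.1 (not_lt.2 h2.le)
    · rw [if_neg hc]
  · intro h; exact absurd (Finset.mem_univ _) h
theorem iT_cyc {f : T3 → F} (hf : ∀ a b c, f (b, c, a) = f (a, b, c)) (a b c : Fin 7) (h : D3 (a, b, c)) : iT f (cyc (a, b, c)) = f (a, b, c) := by
  have h' := h
  obtain ⟨h1, h2, h3⟩ := h
  simp only at h1 h2 h3
  by_cases hab : a < b
  · by_cases hac : a < c
    · exact iT_cyc1 f a b c h' hab hac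
    · have hca : c < a := by omega
      rw [cyc_rot c a b ⟨Ne.symm h2, Ne.symm h3, h1⟩, hf c a b]
      exact iT_cyc1 f c a b ⟨Ne.symm h2, Ne.symm h3, h1⟩ hca (hca.trans hab)
  · have hba : b < a := by omega
    by_cases hbc : b < c
    · rw [← cyc_rot a b c h', ← hf a b c]
      exact iT_cyc1 f b c a ⟨h3, Ne.symm h1, Ne.symm h2⟩ hbc hba
    · have hcb : c < b := by omega
      rw [cyc_rot c a b ⟨Ne.symm h2, Ne.symm h3, h1⟩, hf c a b]
      exact iT_cyc1 f c a b ⟨Ne.symm h2, Ne.symm h3, h1⟩ (hcb.trans hba) hcb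
theorem iT_supp (f : T3 → F) (π : Cj) (h : ¬ ∃ p, D3 p ∧ π = cyc p) : iT f π = 0 := by
  unfold iT
  refine Finset.sum_eq_zero fun p _ => ?_
  split_ifs with h1 h2
  · exact (h ⟨p, ⟨h1.1.ne, h1.2.1.ne, h1.2.2⟩, h2.symm⟩).elim
  · rfl
  · rfl
theorem iT_t {f : T3 → F} (hf : IsAlt f) (h2 : ∀ x : F, 2 * x = 0 → x = 0) (p : T3) : tt3 (iT f) p = f p := by
  obtain ⟨a, b, c⟩ := p
  unfold tt3
  split_ifs with h
  · exact iT_cyc hf.rot a b c h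
  · symm
    have hz : ∀ a b, f (a, b, a) = 0 := fun a b => h2 _ (by linear_combination hf.sw a b a)
    simp only [D3, not_and_or, not_not] at h
    rcases h with h | h | h
    · subst h; rw [← hf.rot]; exact hz a c
    · subst h; exact hz a b
    · subst h; rw [← hf.rot, ← hf.rot]; exact hz b a
theorem iT_mem {f : T3 → F} (hf : IsAlt f) (h2 : ∀ x : F, 2 * x = 0 → x = 0) : iT f ∈ V20 F := by
  refine ⟨fun π h => iT_supp f π h, fun π => ?_, fun a b => ?_⟩
  · by_cases h : ∃ p, D3 p ∧ π = cyc p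
    · obtain ⟨⟨a, b, c⟩, h, rfl⟩ := h
      rw [cyc_inv, iT_cyc hf.rot _ _ _ h, iT_cyc hf.rot _ _ _ ⟨Ne.symm h.2.2, Ne.symm h.2.1, Ne.symm h.1⟩, hf.sw]
    · rw [iT_supp f π h, iT_supp, neg_zero]
      rintro ⟨⟨a, b, c⟩, h', e⟩
      refine h ⟨(c, b, a), ⟨Ne.symm h'.2.2, Ne.symm h'.2.1, Ne.symm h'.1⟩, ?_⟩
      rw [← cyc_inv, ← e]; apply Cj.ext; exact (inv_inv π.q).symm
  · rw [Finset.sum_congr rfl fun c _ => iT_t hf h2 (a, b, c)]; exact hf.sum a b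
theorem B_iT (x : Cj → F) (f : T3 → F) : Bf F Cj x (iT f) =
    ∑ p : T3, if (p.1 < p.2.1 ∧ p.1 < p.2.2 ∧ p.2.1 ≠ p.2.2) then x (cyc p) * f p else 0 := by
  rw [Bf_apply]
  simp only [iT, Finset.mul_sum]
  rw [Finset.sum_comm]
  refine Finset.sum_congr rfl fun p _ => ?_
  split_ifs with h
  · simp
  · simp
end
end A7

namespace A7
def cS : Fin 7 → Fin 7 := ![1,2,0,3,4,5,6]
def dS : Fin 7 → Fin 7 := ![0,1,2,4,5,3,6]
def mv (i j : Fin 3) (a : Fin 7) : Fin 7 := cS^[i.1] (dS^[j.1] a)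
theorem T3_cover : ∀ a b c : Fin 7, (a = b ∨ a = c ∨ b = c) ∨ ∃ i j : Fin 3, 
   ∃ r ∈ [(0,1,2),(3,4,5),(0,1,3),(3,4,0),(0,1,6),(3,4,6),(0,3,6)],
     (mv i j a, mv i j b, mv i j c) ∈ ([(r.1,r.2.1,r.2.2),(r.2.1,r.2.2,r.1),(r.2.2,r.1,r.2.1),(r.2.2,r.2.1,r.1),(r.2.1,r.1,r.2.2),(r.1,r.2.2,r.2.1)] : List T3) := by
  decide +kernel
section
variable {F : Type} [Field F]
theorem t_add (f g : Cj → F) (p : T3) : tt3 (f + g) p = tt3 f p + tt3 g p := by unfold tt3; split_ifs <;> simp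
theorem t_sub (f g : Cj → F) (p : T3) : tt3 (f - g) p = tt3 f p - tt3 g p := by unfold tt3; split_ifs <;> simp
theorem t_smul (c : F) (f : Cj → F) (p : T3) : tt3 (c • f) p = c * tt3 f p := by unfold tt3; split_ifs <;> simp
def zA : Fin 7 → Fin 7 → ℤ := ![![0,1,-1,0,0,0,0],![-1,0,1,0,0,0,0],![1,-1,0,0,0,0,0],0,0,0,0]
def zs : Fin 7 → ℤ := ![0,0,0,1,1,1,0]
def oB : Fin 7 → Fin 7 := ![3,4,5,0,1,2,6]
def z1 (p : T3) : ℤ := zA p.1 p.2.1 * zs p.2.2 + zA p.2.1 p.2.2 * zs p.1 + zA p.2.2 p.1 * zs p.2.1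
def z2 (p : T3) : ℤ := z1 (oB p.1, oB p.2.1, oB p.2.2)
theorem t_NP (h : Cj → F) (p : T3) : tt3 (NP (fnRep F S7 Cj) h) p = 
   (tt3 h p + tt3 h (cc⁻¹ • p) + tt3 h ((cc ^ 2)⁻¹ • p)) + (tt3 h (dd⁻¹ • p) + tt3 h (cc⁻¹ • dd⁻¹ • p) + tt3 h ((cc ^ 2)⁻¹ • dd⁻¹ • p))
   + (tt3 h ((dd ^ 2)⁻¹ • p) + tt3 h (cc⁻¹ • (dd ^ 2)⁻¹ • p) + tt3 h ((cc ^ 2)⁻¹ • (dd ^ 2)⁻¹ • p)) := by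
  unfold tt3
  simp only [D3_smul]
  split_ifs
  · refine (NP_fn h (cyc p)).trans ?_
    simp only [cyc_conj]
  · ring
def l1 (h : Cj → F) : F := tt3 h (0,1,3) + tt3 h (0,1,4) + tt3 h (0,1,5) + tt3 h (1,2,3) + tt3 h (1,2,4) + tt3 h (1,2,5) + tt3 h (2,0,3) + tt3 h (2,0,4) + tt3 h (2,0,5)
def l2 (h : Cj → F) : F := tt3 h (3,4,0) + tt3 h (3,4,1) + tt3 h (3,4,2) + tt3 h (4,5,0) + tt3 h (4,5,1) + tt3 h (4,5,2) + tt3 h (5,3,0) + tt3 h (5,3,1) + tt3 h (5,3,2)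
variable [CharP F 3]
theorem inv_zero {h : Cj → F} (hh : h ∈ V20 F) (hc : ∀ a b c, tt3 h (cS a, cS b, cS c) = tt3 h (a, b, c))
   (hd : ∀ a b c, tt3 h (dS a, dS b, dS c) = tt3 h (a, b, c)) (h1 : tt3 h (0,1,2) = 0) (h2 : tt3 h (3,4,5) = 0)
   (h3 : tt3 h (0,1,3) = 0) (h4 : tt3 h (3,4,0) = 0) : h = 0 := by
  have rot := t_rot h
  have sw := t_sw hh
  have n : ∀ a b, tt3 h (a, b, a) = 0 := fun a b => t_ne h (by simp [D3])
  have n' : ∀ a b, tt3 h (a, b, b) = 0 := fun a b => t_ne h (by simp [D3])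
  have i3 := h3F F
  have s := hh.2.2
  have h5 : tt3 h (0,1,6) = 0 := by
    have := s 0 1
    rw [Fin.sum_univ_seven] at this
    have e1 : tt3 h (0,1,4) = tt3 h (0,1,3) := hd 0 1 3
    have e2 : tt3 h (0,1,5) = tt3 h (0,1,4) := hd 0 1 4
    rw [n, n', e2, e1, h1, h3] at this
    linear_combination this
  have h6 : tt3 h (3,4,6) = 0 := by
    have := s 3 4
    rw [Fin.sum_univ_seven] at this
    have e1 : tt3 h (3,4,1) = tt3 h (3,4,0) := hc 3 4 0
    have e2 : tt3 h (3,4,2) = tt3 h (3,4,1) := hc 3 4 1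
    rw [n, n', e2, e1, h2, h4] at this
    linear_combination this
  have h7 : tt3 h (0,3,6) = 0 := by
    have := s 0 3
    rw [Fin.sum_univ_seven] at this
    have e1 : tt3 h (0,1,3) = tt3 h (2,0,3) := (hc 2 0 3)
    have e2 : tt3 h (3,4,0) = tt3 h (5,3,0) := (hd 5 3 0)
    have e3 := sw 3 1 0
    have e4 := rot 0 3 2
    have e5 := sw 4 0 3
    have e6 := rot 0 3 5
    rw [n, n'] at this
    have a1 := rot 0 1 3
    have a1' := rot 3 0 1
    have a3 := sw 0 3 1
    have a4 := rot 1 3 0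
    have a2 := rot 2 0 3
    have b1 := rot 3 4 0
    have b2 := rot 5 3 0
    have b3 := sw 0 3 4
    have b4 := rot 3 4 0
    have b5 := rot 4 0 3
    have b6 := rot 0 3 5
    have b7 := rot 3 5 0
    have c1 := sw 1 3 0
    grind
  apply V20_zero hh
  rintro ⟨a, b, c⟩
  rcases T3_cover a b c with hn | ⟨i, j, r, hr, hm⟩
  · exact t_ne h (by simp only [D3]; tauto)
  · have hc' : ∀ (i : ℕ) a b c, tt3 h (cS^[i] a, cS^[i] b, cS^[i] c) = tt3 h (a, b, c) := by
      intro i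
      induction i with
      | zero => intros; rfl
      | succ n ih => intro a b c; simp only [Function.iterate_succ_apply]; rw [ih, hc]
    have hd' : ∀ (i : ℕ) a b c, tt3 h (dS^[i] a, dS^[i] b, dS^[i] c) = tt3 h (a, b, c) := by
      intro i
      induction i with
      | zero => intros; rfl
      | succ n ih => intro a b c; simp only [Function.iterate_succ_apply]; rw [ih, hd]
    have hmv : tt3 h (mv i j a, mv i j b, mv i j c) = tt3 h (a, b, c) := (hc' _ _ _ _).trans (hd' _ _ _ _)
    rw [← hmv]
    have hr0 : tt3 h (r.1, r.2.1, r.2.2) = 0 := by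
      simp only [List.mem_cons, List.not_mem_nil, or_false] at hr
      rcases hr with rfl | rfl | rfl | rfl | rfl | rfl | rfl <;> assumption
    obtain ⟨p, q, r⟩ := r
    simp only [List.mem_cons, List.not_mem_nil, or_false] at hm hr0
    rcases hm with e | e | e | e | e | e <;> rw [e]
    · exact hr0
    · rw [rot]; exact hr0
    · rw [rot, rot]; exact hr0
    · rw [sw, hr0, neg_zero]
    · rw [sw, ← rot, hr0, neg_zero]
    · rw [sw, ← rot, ← rot, hr0, neg_zero]
theorem alt_z1 : IsAlt (fun p : T3 => ((z1 p : ℤ) : F)) := by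
  have ha : ∀ a b, zA a b = - zA b a := by decide
  refine ⟨fun a b c => ?_, fun a b c => ?_, ?_⟩
  · simp only [z1]; push_cast; ring
  · simp only [z1]; rw [ha c b, ha b a, ha a c]; push_cast; ring
  · intro a b
    rw [← Int.cast_sum]
    have : ∀ a b, (3:ℤ) ∣ ∑ c, z1 (a, b, c) := by decide +kernel
    obtain ⟨m, hm⟩ := this a b
    rw [hm]; push_cast; rw [h3F F, zero_mul]
theorem alt_z2 : IsAlt (fun p : T3 => ((z2 p : ℤ) : F)) := by
  refine ⟨fun a b c => alt_z1.rot (oB a) (oB b) (oB c), fun a b c => alt_z1.sw (oB a) (oB b) (oB c), fun a b => ?_⟩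
  have h : Function.Bijective oB := by decide
  exact (Function.Bijective.sum_comp h (fun c => ((z1 (oB a, oB b, c) : ℤ) : F))).trans (alt_z1.sum (oB a) (oB b))
variable (F) in
def u1 : Cj → F := iT (fun p : T3 => ((z1 p : ℤ) : F))
variable (F) in
def u2 : Cj → F := iT (fun p : T3 => ((z2 p : ℤ) : F))
theorem t_u1 (p : T3) : tt3 (u1 F) p = ((z1 p : ℤ) : F) := iT_t alt_z1 (fun x => h2F F) p
theorem t_u2 (p : T3) : tt3 (u2 F) p = ((z2 p : ℤ) : F) := iT_t alt_z2 (fun x => h2F F) p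
theorem NP20 {h : Cj → F} (hh : h ∈ V20 F) : @Eq (Cj → F) (NP (fnRep F S7 Cj) h) (l1 h • u1 F + l2 h • u2 F) := by
  have i3 := h3F F
  let y : Cj → F := NP (fnRep F S7 Cj) h
  have hy : y ∈ V20 F := NP_mem V20_inv hh
  have hz : y - (l1 h • u1 F + l2 h • u2 F) ∈ V20 F :=
    (V20' F).sub_mem hy ((V20' F).add_mem ((V20' F).smul_mem _ (iT_mem alt_z1 fun x => h2F F)) ((V20' F).smul_mem _ (iT_mem alt_z2 fun x => h2F F)))
  have ty : ∀ p, tt3 y p = _ := t_NP h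
  have tz : ∀ p, tt3 (y - (l1 h • u1 F + l2 h • u2 F)) p = tt3 y p - (l1 h * ((z1 p : ℤ) : F) + l2 h * ((z2 p : ℤ) : F)) := fun p => by
    rw [t_sub, t_add, t_smul, t_smul, t_u1, t_u2]
  have hcy : ∀ a b c, tt3 y (cS a, cS b, cS c) = tt3 y (a, b, c) := by
    have e1 : (∀ a : Fin 7, cc⁻¹ • (cS a) = a) ∧ (∀ a : Fin 7, (cc ^ 2)⁻¹ • a = cS a) ∧ (∀ a : Fin 7, cS (cS a) = cc⁻¹ • a) ∧
       (∀ a : Fin 7, dd⁻¹ • cS a = cS (dd⁻¹ • a)) ∧ (∀ a : Fin 7, (dd ^ 2)⁻¹ • cS a = cS ((dd ^ 2)⁻¹ • a)) := by decide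
    intro a b c
    rw [ty, ty]
    simp only [Prod.smul_mk, e1.1, e1.2.1, e1.2.2.1, e1.2.2.2.1, e1.2.2.2.2]
    ring
  have hdy : ∀ a b c, tt3 y (dS a, dS b, dS c) = tt3 y (a, b, c) := by
    have e1 : (∀ a : Fin 7, dd⁻¹ • (dS a) = a) ∧ (∀ a : Fin 7, (dd ^ 2)⁻¹ • a = dS a) ∧ (∀ a : Fin 7, dS (dS a) = dd⁻¹ • a) := by decide
    intro a b c
    rw [ty, ty]
    simp only [Prod.smul_mk, e1.1, e1.2.1, e1.2.2]
    ring
  have hz1 : ∀ a b c, z1 (cS a, cS b, cS c) = z1 (a, b, c) ∧ z1 (dS a, dS b, dS c) = z1 (a, b, c) := by decide +kernel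
  have hz2 : ∀ a b c, z2 (cS a, cS b, cS c) = z2 (a, b, c) ∧ z2 (dS a, dS b, dS c) = z2 (a, b, c) := by decide +kernel
  have := inv_zero hz (fun a b c => by rw [tz, tz, hcy, (hz1 a b c).1, (hz2 a b c).1])
    (fun a b c => by rw [tz, tz, hdy, (hz1 a b c).2, (hz2 a b c).2]) ?_ ?_ ?_ ?_
  · exact sub_eq_zero.1 this
  · rw [tz, ty, show z1 (0,1,2) = 0 by decide, show z2 (0,1,2) = 0 by decide]
    simp only [Prod.smul_mk, pv.1, pv.2.1, pv.2.2.1, pv.2.2.2]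
    simp
    have := t_rot h 0 1 2
    have := t_rot h 1 2 0
    grind
  · rw [tz, ty, show z1 (3,4,5) = 0 by decide, show z2 (3,4,5) = 0 by decide]
    simp only [Prod.smul_mk, pv.1, pv.2.1, pv.2.2.1, pv.2.2.2]
    simp
    have := t_rot h 3 4 5
    have := t_rot h 4 5 3
    grind
  · rw [tz, ty, show z1 (0,1,3) = 1 by decide, show z2 (0,1,3) = 0 by decide]
    simp only [Prod.smul_mk, pv.1, pv.2.1, pv.2.2.1, pv.2.2.2]
    simp [l1]
    ring
  · rw [tz, ty, show z1 (3,4,0) = 0 by decide, show z2 (3,4,0) = 1 by decide]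
    simp only [Prod.smul_mk, pv.1, pv.2.1, pv.2.2.1, pv.2.2.2]
    simp [l2]
    ring
theorem rad20 (h : Cj → F) (hh : h ∈ V20 F) (H : ∀ g : S7, l1 ((fnRep F S7 Cj).ρ g h) = 0) : h = 0 := by
  have i3 := h3F F
  have rot := t_rot h
  have sw := t_sw hh
  have n : ∀ a b, tt3 h (a, b, a) = 0 := fun a b => t_ne h (by simp [D3])
  have n' : ∀ a b, tt3 h (a, b, b) = 0 := fun a b => t_ne h (by simp [D3])
  have Wz : ∀ g : S7, tt3 h (g 0, g 1, g 6) + tt3 h (g 1, g 2, g 6) + tt3 h (g 2, g 0, g 6) = 0 := by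
    intro g
    have h1 := H g⁻¹
    simp only [l1, t_ρ, inv_inv] at h1
    change tt3 h (g 0, g 1, g 3) + tt3 h (g 0, g 1, g 4) + tt3 h (g 0, g 1, g 5) + tt3 h (g 1, g 2, g 3) + tt3 h (g 1, g 2, g 4) + tt3 h (g 1, g 2, g 5) + tt3 h (g 2, g 0, g 3) + tt3 h (g 2, g 0, g 4) + tt3 h (g 2, g 0, g 5) = 0 at h1
    have r : ∀ a b, tt3 h (g a, g b, g 0) + tt3 h (g a, g b, g 1) + tt3 h (g a, g b, g 2) + tt3 h (g a, g b, g 3) + tt3 h (g a, g b, g 4) + tt3 h (g a, g b, g 5) + tt3 h (g a, g b, g 6) = 0 := fun a b => by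
      have := hh.2.2 (g a) (g b)
      rwa [← Equiv.sum_comp g, Fin.sum_univ_seven] at this
    have r1 := r 0 1
    have r2 := r 1 2
    have r3 := r 2 0
    rw [n, n'] at r1 r2 r3
    linear_combination r1 + r2 + r3 - h1 - rot (g 0) (g 1) (g 2) + rot (g 2) (g 0) (g 1) - tt3 h (g 0, g 1, g 2) * i3
  have W' : ∀ g : S7, tt3 h (g 0, g 1, g 3) + tt3 h (g 1, g 2, g 3) + tt3 h (g 2, g 0, g 3) = 0 := fun g => Wz (g * Equiv.swap 3 6)
  have E : ∀ g : S7, tt3 h (g 0, g 1, g 2) = - tt3 h (g 0, g 1, g 3) := fun g => by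
    have h1 := W' g
    have h2 : tt3 h (g 0, g 1, g 2) + tt3 h (g 1, g 3, g 2) + tt3 h (g 3, g 0, g 2) = 0 := W' (g * Equiv.swap 2 3)
    have e1 := rot (g 3) (g 2) (g 1)
    have e2 := sw (g 1) (g 2) (g 3)
    have e3 := rot (g 3) (g 0) (g 2)
    have e4 := rot (g 2) (g 1) (g 3)
    have e5 := sw (g 3) (g 0) (g 2)
    have e6 := rot (g 0) (g 2) (g 3)
    grind
  have Z : ∀ g : S7, tt3 h (g 0, g 1, g 2) = 0 := fun g => by
    have h1 := E g
    have h2 : tt3 h (g 0, g 1, g 3) = - tt3 h (g 0, g 1, g 4) := E (g * (Equiv.swap 2 3 * Equiv.swap 3 4))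
    have h3 : tt3 h (g 0, g 1, g 2) = - tt3 h (g 0, g 1, g 4) := E (g * (Equiv.swap 3 4))
    exact h2F F (by linear_combination h1 - h2 + h3)
  apply V20_zero hh
  rintro ⟨a, b, c⟩
  by_cases hd : D3 (a, b, c)
  · obtain ⟨g, rfl, rfl, rfl⟩ := exists_perm3 a b c hd
    exact Z g
  · exact t_ne h hd
theorem B20 {h : Cj → F} (hh : h ∈ V20 F) : Bf F Cj h (u1 F) = 2 * l1 h := by
  have rot := t_rot h
  have sw := t_sw hh
  rw [u1, B_iT]
  have e : ∀ p : T3, (if (p.1 < p.2.1 ∧ p.1 < p.2.2 ∧ p.2.1 ≠ p.2.2) then h (cyc p) * ((z1 p : ℤ) : F) else 0)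
     = if (p.1 < p.2.1 ∧ p.1 < p.2.2 ∧ p.2.1 ≠ p.2.2) then tt3 h p * ((z1 p : ℤ) : F) else 0 := fun p => by
    split_ifs with h1
    · rw [tt3, if_pos ⟨h1.1.ne, h1.2.1.ne, h1.2.2⟩]
    · rfl
  rw [Finset.sum_congr rfl fun p _ => e p]
  let T : Finset T3 := {(0,1,3),(0,1,4),(0,1,5),(0,3,1),(0,4,1),(0,5,1),(1,2,3),(1,2,4),(1,2,5),(1,3,2),(1,4,2),(1,5,2),(0,2,3),(0,2,4),(0,2,5),(0,3,2),(0,4,2),(0,5,2)}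
  rw [← Finset.sum_subset (Finset.subset_univ T)]
  · have hT : ∀ a b c, (tt3 h (c, b, a) = - tt3 h (a, b, c)) ∧ (tt3 h (a, c, b) = - tt3 h (a, b, c)) ∧ tt3 h (b, a, c) = - tt3 h (a, b, c) := fun a b c => 
      ⟨sw a b c, by rw [sw b c a, rot], by rw [← rot, sw, ← rot, rot] ; rw [← rot, ← rot, rot]⟩
    simp [T, z1, zA, zs, l1]
    have q : ∀ b : Fin 7, tt3 h (0,b,1) = -tt3 h (0,1,b) ∧ tt3 h (1,b,2) = -tt3 h (1,2,b) ∧ tt3 h (0,2,b) = - tt3 h (2,0,b) ∧ tt3 h (0,b,2) = tt3 h (2,0,b) :=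
      fun b => ⟨(hT 0 1 b).2.1, (hT 1 2 b).2.1, (hT 2 0 b).2.2, rot 2 0 b⟩
    simp only [q]
    ring
  · have : ∀ a b c : Fin 7, (a, b, c) ∉ T → (a < b ∧ a < c ∧ b ≠ c) → z1 (a, b, c) = 0 := by decide +kernel
    rintro ⟨a, b, c⟩ - hT
    split_ifs with h1
    · rw [this a b c hT h1]; simp
    · rfl
end
end A7

namespace A7
section
variable {F : Type} [Field F] [CharP F 3]
theorem u1_mem : u1 F ∈ V20 F := iT_mem alt_z1 fun x => h2F F
theorem u2_mem : u2 F ∈ V20 F := iT_mem alt_z2 fun x => h2F F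
theorem V20_ext {h h' : Cj → F} (hh : h ∈ V20 F) (hh' : h' ∈ V20 F) (H : ∀ p, tt3 h p = tt3 h' p) : h = h' := by
  refine sub_eq_zero.1 (V20_zero ((V20' F).sub_mem hh hh') fun p => ?_)
  rw [t_sub, H, sub_self]
theorem tt_u1 : @Eq (Cj → F) ((fnRep F S7 Cj).ρ tt (u1 F)) (- u1 F) := by
  refine V20_ext (V20_inv _ _ u1_mem) ((V20' F).neg_mem u1_mem) fun p => ?_
  have h : ∀ a b c : Fin 7, z1 (tt⁻¹ • a, tt⁻¹ • b, tt⁻¹ • c) = - z1 (a, b, c) := by decide +kernel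
  refine (t_ρ tt (u1 F) p).trans ((t_u1 _).trans ?_)
  rw [← neg_one_smul F (u1 F), t_smul, t_u1]
  obtain ⟨a, b, c⟩ := p
  rw [Prod.smul_mk, Prod.smul_mk, h]; push_cast; ring
theorem tt_u2 : @Eq (Cj → F) ((fnRep F S7 Cj).ρ tt (u2 F)) (u2 F) := by
  refine V20_ext (V20_inv _ _ u2_mem) u2_mem fun p => ?_
  have h : ∀ a b c : Fin 7, z2 (tt⁻¹ • a, tt⁻¹ • b, tt⁻¹ • c) = z2 (a, b, c) := by decide +kernel
  refine (t_ρ tt (u2 F) p).trans ((t_u2 _).trans ?_)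
  rw [t_u2]
  obtain ⟨a, b, c⟩ := p
  rw [Prod.smul_mk, Prod.smul_mk, h]
theorem tt_NP {h : Cj → F} (hh : h ∈ V20 F) : @Eq (Cj → F) ((fnRep F S7 Cj).ρ tt (NP (fnRep F S7 Cj) h)) (-(l1 h • u1 F) + l2 h • u2 F) := by
  refine (congrArg (fun z : Cj → F => ((fnRep F S7 Cj).ρ tt z : Cj → F)) (NP20 hh)).trans ?_
  refine (map_add ((fnRep F S7 Cj).ρ tt) (l1 h • u1 F : Cj → F) (l2 h • u2 F : Cj → F)).trans ?_
  refine congrArg₂ (fun a b : Cj → F => a + b) ?_ ?_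
  · refine (map_smul ((fnRep F S7 Cj).ρ tt) (l1 h) (u1 F : Cj → F)).trans ?_
    refine (congrArg (fun z : Cj → F => l1 h • z) tt_u1).trans (smul_neg _ _)
  · refine (map_smul ((fnRep F S7 Cj).ρ tt) (l2 h) (u2 F : Cj → F)).trans ?_
    exact (congrArg (fun z : Cj → F => l2 h • z) tt_u2)
theorem V20_irr : IrrF (subrep _ (V20 F) V20_inv) := by
  apply irr_sub
  · intro h
    have h1 := u1_mem (F := F)
    rw [h] at h1
    have h2 : u1 F = 0 := h1
    have h3 := t_u1 (F := F) (0,1,3)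
    rw [h2, show z1 (0,1,3) = 1 by decide] at h3
    simp [tt3] at h3
  · intro W hW hWV
    refine core_form _ (Bf F _) (Bf_inv) (V20 F) ⊥ V20_inv bot_le ?_ (u1 F) ?_ ?_ W hW bot_le hWV
    · rintro x hx y rfl
      exact map_zero _
    · intro W hW x hx hxV
      have hy := NP_mem hW hx
      have := W.sub_mem hy (hW tt _ hy)
      refine Set.mem_of_eq_of_mem ?_ this
      refine (congrArg (fun c : F => c • u1 F) (B20 hxV)).trans ?_
      refine Eq.trans ?_ (congrArg₂ (fun a b : Cj → F => a - b) (NP20 hxV) (tt_NP hxV)).symm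
      rw [mul_smul, two_smul]; abel
    · intro x hx H
      refine rad20 x hx fun g => h2F F ?_
      exact (B20 (V20_inv _ _ hx)).symm.trans (H g)
end
noncomputable def fam20 : Fam where
  X F _ _ := subrep _ (V20 F) V20_inv
  irr F _ _ := V20_irr
  bc k K _ _ _ _ _ := bc_fn k K _ _ _ _ (fun f hf => ⟨fun π h => (congrArg (algebraMap k K) (hf.1 π h)).trans (map_zero _), 
    fun π => (congrArg (algebraMap k K) (hf.2.1 π)).trans (map_neg _ _), fun a b => by
      have : ∀ p, tt3 (fun w => algebraMap k K (f w)) p = algebraMap k K (tt3 f p) := fun p => by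
        unfold tt3; split_ifs <;> simp
      simp only [this]
      rw [← map_sum, hf.2.2, map_zero]⟩) (V20_irr (F := k)).1
section
variable {F : Type} [Field F] [CharP F 3]
def det3 (v w z : Fin 7 → F) (p : T3) : F := v p.1 * w p.2.1 * z p.2.2 + w p.1 * z p.2.1 * v p.2.2 + z p.1 * v p.2.1 * w p.2.2
  - v p.1 * z p.2.1 * w p.2.2 - z p.1 * w p.2.1 * v p.2.2 - w p.1 * v p.2.1 * z p.2.2
theorem alt_det (v w z : Fin 7 → F) (hv : ∑ i, v i = 0) (hw : ∑ i, w i = 0) (hz : ∑ i, z i = 0) : IsAlt (det3 v w z) := by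
  refine ⟨fun a b c => ?_, fun a b c => ?_, fun a b => ?_⟩
  · simp only [det3]; ring
  · simp only [det3]; ring
  · simp only [det3, Finset.sum_add_distrib, Finset.sum_sub_distrib, ← Finset.mul_sum, hv, hw, hz]; ring
theorem fam20_ty (F : Type) [Field F] [CharP F 3] : Ty (fam20.X F) .t3 := by
  have key : ∀ (x : V20 F), (NP (fam20.X F) x : V20 F).1 = l1 x.1 • u1 F + l2 x.1 • u2 F := fun x =>
    (NP_comm (subrepι _ (V20 F) V20_inv) x).trans (NP20 x.2)
  have key2 : ∀ (x : V20 F), ((fam20.X F).ρ tt (NP (fam20.X F) x) : V20 F).1 = -(l1 x.1 • u1 F) + l2 x.1 • u2 F := fun x =>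
    (congrArg (fun z : Cj → F => ((fnRep F S7 Cj).ρ tt z : Cj → F)) (NP_comm (subrepι _ (V20 F) V20_inv) x)).trans (tt_NP x.2)
  have n0 : (2 : F) ≠ 0 := fun h => one_ne_zero (α := F) (h2F F (by rw [h]; ring))
  have key3 : ∀ (x : V20 F) (s : F), (fam20.X F).ρ tt (NP (fam20.X F) x) = s • NP (fam20.X F) x →
      -(l1 x.1 • u1 F) + l2 x.1 • u2 F = s • (l1 x.1 • u1 F + l2 x.1 • u2 F) := fun x s h => by
    refine (key2 x).symm.trans ((congrArg Subtype.val h).trans ?_)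
    exact congrArg (fun z : Cj → F => s • z) (key x)
  have key4 : ∀ (x : V20 F) (s : F), (fam20.X F).ρ tt (NP (fam20.X F) x) = s • NP (fam20.X F) x → ∀ p,
      -(l1 x.1 * (z1 p : F)) + l2 x.1 * (z2 p : F) = s * (l1 x.1 * (z1 p : F) + l2 x.1 * (z2 p : F)) := fun x s h p => by
    have := congrArg (fun f => tt3 f p) (key3 x s h)
    simp only [t_add, t_smul, t_u1, t_u2, ← neg_smul] at this
    linear_combination this
  have mk : ∀ f : T3 → F, IsAlt f → ∃ x : V20 F, ∀ p, tt3 x.1 p = f p := fun f hf =>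
    ⟨⟨iT f, iT_mem hf fun x => h2F F⟩, iT_t hf fun x => h2F F⟩
  intro s
  rcases Int.units_eq_one_or s with rfl | rfl
  · obtain ⟨x, hx⟩ := mk (det3 ![1,0,0,0,0,0,-1] ![0,1,0,0,0,0,-1] ![0,0,0,1,0,0,-1]) (alt_det _ _ _ (by rw [Fin.sum_univ_seven]; simp) (by rw [Fin.sum_univ_seven]; simp) (by rw [Fin.sum_univ_seven]; simp))
    refine ⟨x, fun h => n0 ?_⟩
    have h1 := key4 x _ h (0,1,3)
    have : l1 x.1 = 1 := by simp only [l1, hx, det3]; simp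
    rw [this, show z1 (0,1,3) = 1 by decide, show z2 (0,1,3) = 0 by decide] at h1
    simp at h1
    linear_combination -h1
  · obtain ⟨x, hx⟩ := mk (det3 ![0,0,0,1,0,0,-1] ![0,0,0,0,1,0,-1] ![1,0,0,0,0,0,-1]) (alt_det _ _ _ (by rw [Fin.sum_univ_seven]; simp) (by rw [Fin.sum_univ_seven]; simp) (by rw [Fin.sum_univ_seven]; simp))
    refine ⟨x, fun h => n0 ?_⟩
    have h1 := key4 x _ h (3,4,0)
    have : l2 x.1 = 1 := by simp only [l2, hx, det3]; simp
    rw [this, show z1 (3,4,0) = 0 by decide, show z2 (3,4,0) = 1 by decide] at h1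
    simp at h1
    linear_combination h1
end
noncomputable def Fs : Fin 9 → Fam := ![fam1, fam1.tw, fam6, fam6.tw, fam13, fam13.tw, fam15, fam15.tw, fam20]
def tg : Fin 9 → Tag := ![.t0 1, (Tag.t0 1).tw, .t1 1, (Tag.t1 1).tw, .t2 1 1, (Tag.t2 1 1).tw, .t2 1 (-1), (Tag.t2 1 (-1)).tw, .t3]
theorem Fs_ty (F : Type) [Field F] [CharP F 3] : ∀ j, Ty ((Fs j).X F) (tg j) := by
  intro j
  fin_cases j
  · exact fam1_ty F
  · exact (fam1_ty F).tw
  · exact fam6_ty F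
  · exact (fam6_ty F).tw
  · exact fam13_ty F
  · exact (fam13_ty F).tw
  · exact fam15_ty F
  · exact (fam15_ty F).tw
  · exact fam20_ty F
theorem classify' (k : Type) [Field k] [CharP k 3] (N : FDRep k S7) (hN : IrrF N) : ∃ j, Nonempty ((Fs j).X k ≅ N) := by
  refine classify Fs (fun K _ _ i j hij ⟨e⟩ => hij ?_) k N hN
  have := ((Fs j).irr K).1
  have h : tg i = tg j := Ty.excl (Ty.iso e (Fs_ty K i)) (Fs_ty K j)
  have inj : ∀ i j, tg i = tg j → i = j := by decide
  exact inj i j h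
end A7

namespace A7
open scoped TensorProduct
section
variable (R ι κ : Type) [Field R] [Finite ι] [Finite κ]
noncomputable def tE : (ι → R) ⊗[R] (κ → R) ≃ₗ[R] (ι × κ → R) :=
  ((Pi.basisFun R ι).tensorProduct (Pi.basisFun R κ)).equivFun
theorem tE_tmul (f : ι → R) (h : κ → R) (p : ι × κ) : tE R ι κ (f ⊗ₜ h) p = f p.1 * h p.2 := by
  obtain ⟨i, j⟩ := p
  simp [tE, Module.Basis.tensorProduct_repr_tmul_apply, mul_comm]
end
section
variable {k P : Type} [Field k] [Group P]
section
variable {Ω Ω' : Type} [Fintype Ω] [Fintype Ω'] [MulAction P Ω] [MulAction P Ω']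
variable (k P Ω Ω') in
noncomputable def fnT : fnRep k P Ω ⊗ fnRep k P Ω' ≅ fnRep k P (Ω × Ω') :=
  mkIso (X := fnRep k P Ω ⊗ fnRep k P Ω') (tE k Ω Ω') (fun g v => by
    revert v
    refine fun v => LinearMap.congr_fun (f := (tE k Ω Ω').toLinearMap ∘ₗ (TensorProduct.map ((fnRep k P Ω).ρ g) ((fnRep k P Ω').ρ g)))
      (g := ((fnRep k P (Ω × Ω')).ρ g) ∘ₗ (tE k Ω Ω').toLinearMap) ?_ v
    refine TensorProduct.ext' fun f h => ?_
    funext p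
    exact (tE_tmul k Ω Ω' _ _ p).trans (tE_tmul k Ω Ω' f h (g⁻¹ • p)).symm)
noncomputable def pullH (π : Ω' → Ω) (h : ∀ (g : P) q, π (g • q) = g • π q) : fnRep k P Ω ⟶ fnRep k P Ω' :=
  mkHom (X := fnRep k P Ω) (Y := fnRep k P Ω') (LinearMap.funLeft k k π) (fun g f => by
    funext q
    show (f : Ω → k) (g⁻¹ • π q) = (f : Ω → k) (π (g⁻¹ • q))
    rw [h])
open Classical in
noncomputable def pushL (k : Type) [Field k] (π : Ω' → Ω) : (Ω' → k) →ₗ[k] (Ω → k) where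
  toFun f w := ∑ q, if π q = w then f q else 0
  map_add' f g := by funext w; simp only [Pi.add_apply, ← Finset.sum_add_distrib]; refine Finset.sum_congr rfl fun q _ => ?_; split_ifs <;> simp
  map_smul' c f := by funext w; simp only [Pi.smul_apply, smul_eq_mul, Finset.mul_sum, RingHom.id_apply]; refine Finset.sum_congr rfl fun q _ => ?_; split_ifs <;> simp
open Classical in
theorem pushL_apply (π : Ω' → Ω) (f : Ω' → k) (w : Ω) : pushL k π f w = ∑ q, if π q = w then f q else 0 := by
  show (∑ q, _) = _
  refine Finset.sum_congr rfl fun q _ => ?_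
  congr
noncomputable def pushH (π : Ω' → Ω) (h : ∀ (g : P) q, π (g • q) = g • π q) : fnRep k P Ω' ⟶ fnRep k P Ω :=
  mkHom (X := fnRep k P Ω') (Y := fnRep k P Ω) (pushL k π) (fun g f => by
    classical
    funext w
    refine (pushL_apply π _ w).trans (Eq.trans ?_ (pushL_apply π f (g⁻¹ • w)).symm)
    rw [← Equiv.sum_comp (MulAction.toPerm g)]
    refine Finset.sum_congr rfl fun q _ => ?_
    rw [MulAction.toPerm_apply, h]
    have e1 : g • π q = w ↔ π q = g⁻¹ • w := by rw [eq_inv_smul_iff]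
    have e2 : (fnRep k P Ω').ρ g f (g • q) = f q := congrArg (f : Ω' → k) (inv_smul_smul g q)
    simp only [e1, e2])
end
theorem fn_inAdd [Finite P] (Ω : Type) [Fintype Ω] [MulAction P Ω] : InAdd (fun z => ∃ Q : Subgroup P, z = fnRep k P (P ⧸ Q)) (fnRep k P Ω) := by
  classical
  letI := Fintype.ofFinite P
  letI : Fintype (Quotient (MulAction.orbitRel P Ω)) := Fintype.ofFinite _
  let st := fun o : Quotient (MulAction.orbitRel P Ω) => MulAction.stabilizer P o.out
  letI : ∀ o, Fintype (P ⧸ st o) := fun o => Fintype.ofFinite _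
  let π : ∀ o, P ⧸ st o → Ω := fun o => MulAction.ofQuotientStabilizer P o.out
  have hπ : ∀ o (g : P) q, π o (g • q) = g • π o q := fun o g q => MulAction.ofQuotientStabilizer_smul P o.out g q
  refine InAdd.of_sum Finset.univ (fun o => fnRep k P (P ⧸ st o)) (fun o => pullH (π o) (hπ o)) (fun o => pushH (π o) (hπ o)) ?_
    (fun o _ => .of_mem ⟨_, rfl⟩)
  apply toLin_inj
  refine LinearMap.ext fun f => ?_
  rw [toLin_sum]
  refine (LinearMap.sum_apply _ _ _).trans ?_
  funext w
  refine (Finset.sum_apply w Finset.univ (fun o => (pushL k (π o) (fun q => (f : Ω → k) (π o q))))).trans ?_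
  simp only [pushL_apply]
  let E := MulAction.selfEquivSigmaOrbitsQuotientStabilizer P Ω
  have hE : ∀ x : Σ o : Quotient (MulAction.orbitRel P Ω), P ⧸ st o, E.symm x = π x.1 x.2 := by
    rintro ⟨o, q⟩
    rfl
  refine (Fintype.sum_sigma' (fun o (q : P ⧸ st o) => if π o q = w then (f : Ω → k) (π o q) else 0)).symm.trans ?_
  simp only [← hE]
  refine Eq.trans (Equiv.sum_comp E.symm (fun v => if v = w then (f : Ω → k) v else 0)) ?_
  exact (Finset.sum_ite_eq' Finset.univ w (f : Ω → k)).trans (if_pos (Finset.mem_univ w))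
theorem good_fn [Finite P] (Ω : Type) [Fintype Ω] [MulAction P Ω] : Good (fnRep k P Ω) := by
  classical
  letI := Fintype.ofFinite P
  letI : Fintype (Subgroup P) := Fintype.ofFinite _
  have h : ∀ (Ω : Type) [Fintype Ω] [MulAction P Ω], InAdd (· ∈ (Finset.univ : Finset (Subgroup P)).toList.map (fun Q => fnRep k P (P ⧸ Q))) (fnRep k P Ω) := by
    intro Ω _ _
    refine (fn_inAdd Ω).mono ?_
    rintro z ⟨Q, rfl⟩
    exact List.mem_map.2 ⟨Q, by simp, rfl⟩
  refine ⟨_, h Ω, fun z hz => ?_⟩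
  obtain ⟨Q, -, rfl⟩ := List.mem_map.1 hz
  letI : Fintype (P ⧸ Q) := Fintype.ofFinite _
  exact (h ((P ⧸ Q) × Ω)).iso (fnT k P (P ⧸ Q) Ω)
end
end A7

namespace A7
abbrev PP := Multiplicative (ZMod 3 × ZMod 3)
def ψ0 (g : PP) : S7 := cc ^ (g.toAdd.1.val) * dd ^ (g.toAdd.2.val)
theorem ψ0_mul : ∀ g h : PP, ψ0 (g * h) = ψ0 g * ψ0 h := by
  have hc : cc ^ 3 = 1 := by decide
  have hd : dd ^ 3 = 1 := by decide
  have hcd : Commute cc dd := by show cc * dd = dd * cc; decide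
  have e : ∀ (x : S7), x ^ 3 = 1 → ∀ a b : ZMod 3, x ^ ((a + b).val) = x ^ a.val * x ^ b.val := fun x hx a b => by
    rw [← pow_add, ZMod.val_add, ← pow_eq_pow_mod _ hx]
  intro g h
  simp only [ψ0, toAdd_mul, Prod.fst_add, Prod.snd_add, e cc hc, e dd hd]
  exact Commute.mul_mul_mul_comm (hcd.pow_pow _ _) _ _
theorem ψ0_alt (g : PP) : Equiv.Perm.sign (ψ0 g) = 1 := by
  have h1 : Equiv.Perm.sign cc = 1 := by decide
  have h2 : Equiv.Perm.sign dd = 1 := by decide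
  simp [ψ0, h1, h2]
def φP : PP →* alternatingGroup (Fin 7) where
  toFun g := ⟨ψ0 g, Equiv.Perm.mem_alternatingGroup.2 (ψ0_alt g)⟩
  map_one' := Subtype.ext (by show ψ0 1 = 1; simp [ψ0])
  map_mul' g h := Subtype.ext (ψ0_mul g h)
theorem φP_inj : Function.Injective φP := by
  rw [injective_iff_map_eq_one]
  intro g hg
  have h : ψ0 g = 1 := congrArg Subtype.val hg
  have h1 : ∀ a b : ZMod 3, (cc ^ a.val * dd ^ b.val : S7) = 1 → a = 0 ∧ b = 0 := by decide +kernel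
  obtain ⟨h2, h3⟩ := h1 _ _ h
  exact congrArg Multiplicative.ofAdd (Prod.ext h2 h3)
theorem φP_idx (k : Type) [Field k] [CharP k 3] : (φP.range.index : k) ≠ 0 := by
  have h1 : Nat.card φP.range = 9 := by
    rw [Nat.card_congr (MonoidHom.ofInjective φP_inj).toEquiv.symm]
    simp [Nat.card_eq_fintype_card, Fintype.card_multiplicative]
  have h2 := Subgroup.card_mul_index φP.range
  have h3 : 2 * Nat.card (alternatingGroup (Fin 7)) = 5040 := by
    rw [two_mul_nat_card_alternatingGroup, Nat.card_eq_fintype_card, Fintype.card_perm, Fintype.card_fin]; rfl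
  have h4 : φP.range.index = 280 := by rw [h1] at h2; omega
  rw [h4]
  intro h
  have := (CharP.cast_eq_zero_iff k 3 280).1 h
  omega
def ψ : PP →* S7 := aι.comp φP
theorem ψ_sgn (g : PP) : Equiv.Perm.sign (ψ g) = 1 := ψ0_alt g
section
variable {F : Type} [Field F]
theorem Good.iso {M N : FDRep F PP} (h : Good N) (e : M ≅ N) : Good M := h.retract e.hom e.inv e.hom_inv_id
theorem good_res (Ω : Type) [Fintype Ω] [MulAction S7 Ω] : Good ((Action.res _ ψ).obj (fnRep F S7 Ω)) := by
  letI : MulAction PP Ω := MulAction.compHom Ω ψ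
  refine (good_fn (k := F) (P := PP) Ω).iso (mkIso (X := (Action.res _ ψ).obj (fnRep F S7 Ω)) (Y := fnRep F PP Ω) (LinearEquiv.refl F (Ω → F)) fun g v => ?_)
  funext w
  show (v : Ω → F) ((ψ g)⁻¹ • w) = (v : Ω → F) (ψ g⁻¹ • w)
  rw [map_inv]
theorem good_retr (X : FDRep F S7) (Ω : Type) [Fintype Ω] [MulAction S7 Ω] (i : X ⟶ fnRep F S7 Ω) (r : fnRep F S7 Ω ⟶ X) (h : i ≫ r = 𝟙 X) :
    Good ((Action.res _ ψ).obj X) :=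
  (good_res Ω).retract ((Action.res _ ψ).map i) ((Action.res _ ψ).map r) (by
    rw [← CategoryTheory.Functor.map_comp, h, CategoryTheory.Functor.map_id])
theorem good_tw (X : FDRep F S7) (h : Good ((Action.res _ ψ).obj X)) : Good ((Action.res _ ψ).obj (twR X)) :=
  h.iso (mkIso (X := (Action.res _ ψ).obj (twR X)) (Y := (Action.res _ ψ).obj X) (LinearEquiv.refl F X) fun g v => tw_ρ1 X (ψ_sgn g) v)
theorem good_sub {Ω : Type} [Fintype Ω] [MulAction S7 Ω] (V : Submodule F (fnRep F S7 Ω)) (hV : Inv _ V)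
   (p : (Ω → F) →ₗ[F] (Ω → F)) (h1 : ∀ f, p f ∈ V) (h2 : ∀ f ∈ V, p f = f)
   (h3 : ∀ (g : S7) (f : Ω → F), p (fun w => f (g⁻¹ • w)) = fun w => p f (g⁻¹ • w)) : Good ((Action.res _ ψ).obj (subrep _ V hV)) := by
  let p' : fnRep F S7 Ω →ₗ[F] fnRep F S7 Ω := p
  refine good_retr _ Ω (subrepι _ V hV) (mkHom (X := fnRep F S7 Ω) (Y := subrep _ V hV) (p'.codRestrict V h1) fun g f => Subtype.ext (h3 g f)) ?_
  apply toLin_inj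
  refine LinearMap.ext fun v => Subtype.ext (h2 _ (show V from v).2)
variable [CharP F 3]
theorem good1 : Good ((Action.res _ ψ).obj (fam1.X F)) := by
  let i : F →ₗ[F] (Fin 7 → F) := LinearMap.pi fun _ => LinearMap.id
  let r : (Fin 7 → F) →ₗ[F] F := ∑ j, LinearMap.proj j
  have hr : ∀ f, r f = ∑ j, f j := fun f => by simp [r]
  refine good_retr (fam1.X F) (Fin 7) (mkHom (X := fam1.X F) (Y := fnRep F S7 (Fin 7)) i fun g f => rfl)
    (mkHom (X := fnRep F S7 (Fin 7)) (Y := fam1.X F) r fun g f => ?_) ?_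
  · refine (hr _).trans (Eq.trans ?_ (hr f).symm)
    exact Equiv.sum_comp g⁻¹ (f : Fin 7 → F)
  · apply toLin_inj
    refine LinearMap.ext fun v => ?_
    refine (hr (fun _ => v)).trans ?_
    refine (Finset.sum_const _).trans ?_
    rw [Finset.card_univ, Fintype.card_fin]
    have h3 := h3F F
    have : ∀ v : F, 7 • v = v := fun v => by rw [nsmul_eq_mul]; push_cast; linear_combination 2 * v * h3
    exact this v
theorem good6 : Good ((Action.res _ ψ).obj (fam6.X F)) := by
  have h3 := h3F F
  refine good_sub (V6 F) (V6_inv F) ⟨⟨fun f a => f a - ∑ j, f j, fun f g => ?_⟩, fun c f => ?_⟩ (fun f => ?_) (fun f hf => ?_) (fun g f => ?_)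
  · funext a; simp only [Pi.add_apply, Finset.sum_add_distrib]; ring
  · funext a; simp only [Pi.smul_apply, smul_eq_mul, ← Finset.mul_sum, RingHom.id_apply]; ring
  · refine (mem_V6 F _).2 ?_
    show ∑ a, (f a - ∑ j, f j) = 0
    rw [Finset.sum_sub_distrib, Finset.sum_const, Finset.card_univ, Fintype.card_fin, nsmul_eq_mul]; push_cast
    linear_combination - 2 * (∑ j, f j) * h3
  · funext a
    show (f : Fin 7 → F) a - ∑ j, (f : Fin 7 → F) j = _
    rw [(mem_V6 F f).1 hf, sub_zero]
  · funext a
    exact congrArg (fun s => f (g⁻¹ a) - s) (Equiv.sum_comp g⁻¹ f)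
theorem good15 : Good ((Action.res _ ψ).obj (fam15.X F)) := by
  have h3 := h3F F
  let q : (Fin 7 × Fin 7 → F) → (Fin 7 × Fin 7 → F) := fun f p => f (p.2, p.1) - f p - (∑ j, (f (j, p.1) - f (p.1, j)) - ∑ j, (f (j, p.2) - f (p.2, j)))
  refine good_sub (V15 F) (V15_inv F) ⟨⟨q, fun f g => ?_⟩, fun c f => ?_⟩ (fun f => ?_) (fun f hf => ?_) (fun g f => ?_)
  · funext a; simp only [q, Pi.add_apply, Finset.sum_add_distrib, Finset.sum_sub_distrib]; ring
  · funext a; simp only [q, Pi.smul_apply, smul_eq_mul, Finset.sum_sub_distrib, ← Finset.mul_sum, RingHom.id_apply]; ring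
  · refine ⟨fun a b => ?_, fun a => ?_⟩
    · show q f (a, b) = - q f (b, a)
      simp only [q]; ring
    · show ∑ b, q f (a, b) = 0
      simp only [q, Finset.sum_sub_distrib]
      simp only [Finset.sum_const, Finset.card_univ, Fintype.card_fin, nsmul_eq_mul]
      rw [Finset.sum_comm (f := fun x i => f (i, x))]
      push_cast
      linear_combination - 2 * (∑ j, f (j, a) - ∑ j, f (a, j)) * h3
  · funext ⟨a, b⟩
    show q f (a, b) = (show Fin 7 × Fin 7 → F from f) (a, b)
    have h1 : ∀ a b, (show Fin 7 × Fin 7 → F from f) (a, b) = - (show Fin 7 × Fin 7 → F from f) (b, a) := hf.1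
    have h2 : ∀ a, ∑ b, (show Fin 7 × Fin 7 → F from f) (a, b) = 0 := hf.2
    have h4 : ∀ a, ∑ b, (show Fin 7 × Fin 7 → F from f) (b, a) = 0 := fun a => by
      rw [Finset.sum_congr rfl fun b _ => h1 b a, Finset.sum_neg_distrib, h2, neg_zero]
    generalize (show Fin 7 × Fin 7 → F from f) = f at *
    simp only [q, Finset.sum_sub_distrib, h2, h4]
    linear_combination h1 b a - f (a, b) * h3
  · funext ⟨a, b⟩
    show q (fun w => f (g⁻¹ • w)) (a, b) = q f (g⁻¹ a, g⁻¹ b)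
    refine congrArg₂ (fun x y => x - y) rfl ?_
    exact congrArg₂ (fun x y => x - y) (Equiv.sum_comp g⁻¹ (fun j => f (j, g⁻¹ a) - f (g⁻¹ a, j))) (Equiv.sum_comp g⁻¹ (fun j => f (j, g⁻¹ b) - f (g⁻¹ b, j)))
def q20 (h : Cj → F) (p : T3) : F := tt3 h (p.2.2, p.2.1, p.1) - tt3 h p
def r20 (h : Cj → F) (p : T3) : F := q20 h p - ((∑ m, q20 h (m, p.2.1, p.2.2)) + (∑ m, q20 h (p.1, m, p.2.2)) + ∑ m, q20 h (p.1, p.2.1, m))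
theorem r20_alt (h : Cj → F) : IsAlt (r20 h) := by
  have h3 := h3F F
  have rot : ∀ a b c, q20 h (b, c, a) = q20 h (a, b, c) := fun a b c => by
    simp only [q20]; rw [t_rot h a b c, ← t_rot h c b a, ← t_rot h b a c]
  have sw : ∀ a b c, q20 h (c, b, a) = - q20 h (a, b, c) := fun a b c => by
    simp only [q20]; ring
  refine ⟨fun a b c => ?_, fun a b c => ?_, fun a b => ?_⟩
  · simp only [r20]
    have e1 : ∑ m, q20 h (m, c, a) = ∑ m, q20 h (a, m, c) := Finset.sum_congr rfl fun m _ => rot a m c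
    have e2 : ∑ m, q20 h (b, m, a) = ∑ m, q20 h (a, b, m) := Finset.sum_congr rfl fun m _ => rot a b m
    have e3 : ∑ m, q20 h (b, c, m) = ∑ m, q20 h (m, b, c) := Finset.sum_congr rfl fun m _ => rot m b c
    rw [rot, e1, e2, e3]; ring
  · simp only [r20]
    rw [sw, Finset.sum_congr rfl fun m _ => (sw a b m), Finset.sum_congr rfl fun m _ => (sw a m c), Finset.sum_congr rfl fun m _ => (sw m b c)]
    simp only [Finset.sum_neg_distrib]; ring
  · simp only [r20, Finset.sum_add_distrib, Finset.sum_sub_distrib]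
    have e1 : ∑ c, ∑ m, q20 h (m, b, c) = 0 := by
      apply h2F F
      have : ∑ c, ∑ m, q20 h (m, b, c) = - ∑ c, ∑ m, q20 h (m, b, c) := by
        conv_lhs => rw [Finset.sum_comm]
        simp only [← Finset.sum_neg_distrib]
        exact Finset.sum_congr rfl fun c _ => Finset.sum_congr rfl fun m _ => sw m b c
      linear_combination this
    have e2 : ∑ c, ∑ m, q20 h (a, m, c) = 0 := by
      apply h2F F
      have : ∑ c, ∑ m, q20 h (a, m, c) = - ∑ c, ∑ m, q20 h (a, m, c) := by
        conv_lhs => rw [Finset.sum_comm]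
        simp only [← Finset.sum_neg_distrib]
        exact Finset.sum_congr rfl fun c _ => Finset.sum_congr rfl fun m _ => (rot a c m).symm.trans (sw a m c)
      linear_combination this
    rw [e1, e2]
    simp only [Finset.sum_const, Finset.card_univ, Fintype.card_fin, nsmul_eq_mul]
    push_cast
    linear_combination - 2 * (∑ m, q20 h (a, b, m)) * h3
theorem r20_fix {h : Cj → F} (hh : h ∈ V20 F) (p : T3) : r20 h p = tt3 h p := by
  have h3 := h3F F
  have e : ∀ p, q20 h p = tt3 h p := fun ⟨a, b, c⟩ => by
    simp only [q20]; rw [t_sw hh a b c]; linear_combination - tt3 h (a, b, c) * h3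
  have z : ∀ a b, ∑ c, tt3 h (a, b, c) = 0 := ((mem_V20 (F := F) h).1 hh).2.2
  obtain ⟨a, b, c⟩ := p
  simp only [r20, e]
  have e1 : ∑ m, tt3 h (m, b, c) = 0 := (Finset.sum_congr rfl fun m _ => (t_rot h m b c).symm).trans (z b c)
  have e2 : ∑ m, tt3 h (a, m, c) = 0 := (Finset.sum_congr rfl fun m _ => (t_rot h c a m)).trans (z c a)
  rw [e1, e2, z]; ring
theorem p20_t (h : Cj → F) (p : T3) : tt3 (iT (r20 h)) p = r20 h p := iT_t (r20_alt h) (fun x => h2F F) p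
theorem p20_mem (h : Cj → F) : iT (r20 h) ∈ V20 F := iT_mem (r20_alt h) (fun x => h2F F)
theorem good20 : Good ((Action.res _ ψ).obj (fam20.X F)) := by
  refine good_sub (V20 F) V20_inv ⟨⟨fun h => iT (r20 h), fun f g => ?_⟩, fun c f => ?_⟩ (fun f => ?_) (fun f hf => ?_) (fun g f => ?_)
  · refine V20_ext (p20_mem _) (add_mem (p20_mem f) (p20_mem g)) fun p => ?_
    refine (p20_t _ p).trans (Eq.trans ?_ (t_add _ _ p).symm)
    refine Eq.trans ?_ (congrArg₂ (· + ·) (p20_t f p) (p20_t g p)).symm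
    simp only [r20, q20, t_add, Finset.sum_add_distrib, Finset.sum_sub_distrib]; ring
  · refine V20_ext (p20_mem _) (Submodule.smul_mem _ c (p20_mem f)) fun p => ?_
    refine (p20_t _ p).trans (Eq.trans ?_ (t_smul _ _ p).symm)
    refine Eq.trans ?_ (congrArg (c * ·) (p20_t f p)).symm
    simp only [r20, q20, t_smul, Finset.sum_sub_distrib, ← Finset.mul_sum]; ring
  · exact p20_mem f
  · exact V20_ext (p20_mem f) hf fun p => (p20_t _ p).trans (r20_fix hf p)
  · refine V20_ext (p20_mem _) (V20_inv g _ (p20_mem f)) fun p => ?_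
    refine (p20_t _ p).trans (Eq.trans ?_ (t_ρ g (iT (r20 f)) p).symm)
    refine Eq.trans ?_ (p20_t f _).symm
    have e : ∀ p, q20 (fun w => f (g⁻¹ • w)) p = q20 f (g⁻¹ • p) := fun p =>
      congrArg₂ (· - ·) (t_ρ g f _) (t_ρ g f _)
    simp only [r20, e]
    refine congrArg₂ (· - ·) rfl ?_
    refine congrArg₂ (· + ·) (congrArg₂ (· + ·) ?_ ?_) ?_
    · exact Equiv.sum_comp g⁻¹ (fun m => q20 f (m, g⁻¹ p.2.1, g⁻¹ p.2.2))
    · exact Equiv.sum_comp g⁻¹ (fun m => q20 f (g⁻¹ p.1, m, g⁻¹ p.2.2))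
    · exact Equiv.sum_comp g⁻¹ (fun m => q20 f (g⁻¹ p.1, g⁻¹ p.2.1, m))
end
end A7

namespace A7
open scoped TensorProduct
section
variable {k R P : Type} [Field k] [Field R] [Algebra k R] [FiniteDimensional k R] [Group P]
def RS (k : Type) {R P : Type} [Field R] [Group P] (z : FDRep R P) : Type := z
variable (z : FDRep R P)
noncomputable instance : AddCommGroup (RS k z) := inferInstanceAs (AddCommGroup z)
noncomputable instance RSR : Module R (RS k z) := inferInstanceAs (Module R z)
noncomputable instance : Module k (RS k z) := Module.compHom z (algebraMap k R)
instance : IsScalarTower k R (RS k z) := IsScalarTower.of_algebraMap_smul fun _ _ => rfl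
instance : Module.Finite R (RS k z) := inferInstanceAs (Module.Finite R z)
instance : Module.Finite k (RS k z) := Module.Finite.trans (R := k) (A := R) (RS k z)
variable (k) in
noncomputable def rsL {z w : FDRep R P} (f : z →ₗ[R] w) : RS k z →ₗ[k] RS k w :=
  let f' : RS k z →ₗ[R] RS k w := f
  f'.restrictScalars k
variable (k) in
noncomputable def Uo (z : FDRep R P) : FDRep k P :=
  FDRep.of (V := RS k z)
   { toFun := fun g => rsL k (z.ρ g)
     map_one' := by apply LinearMap.ext; intro v; exact LinearMap.congr_fun (map_one z.ρ) v
     map_mul' := fun a b => by apply LinearMap.ext; intro v; exact LinearMap.congr_fun (map_mul z.ρ a b) v }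
variable (k R P) in
noncomputable def UF : FDRep R P ⥤ FDRep k P where
  obj z := Uo k z
  map {X Y} f := mkHom (X := Uo k X) (Y := Uo k Y) (rsL k (z := X) (w := Y) (toLin (X := X) (Y := Y) f)) (fun g v => toLin_comm f g v)
  map_id X := toLin_inj rfl
  map_comp f g := toLin_inj rfl
instance : (UF k R P).Additive where
  map_add := toLin_inj rfl
variable (X : FDRep k P)
noncomputable def cbc : RS k z ⊗[k] X ≃ₗ[k] RS k (MonoidalCategory.tensorObj z (bcRep R X)) :=
  let e := (TensorProduct.AlgebraTensorModule.cancelBaseChange k R R (RS k z) X).symm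
  { toFun := fun x => e x
    invFun := fun y => e.symm y
    left_inv := fun x => e.symm_apply_apply x
    right_inv := fun y => e.apply_symm_apply y
    map_add' := fun x y => e.map_add x y
    map_smul' := fun c x => by
      have := e.map_smul (algebraMap k R c) x
      rw [algebraMap_smul] at this
      exact this }
noncomputable def Ut : (UF k R P).obj z ⊗ X ≅ (UF k R P).obj (MonoidalCategory.tensorObj z (bcRep R X)) :=
  mkIso (X := (UF k R P).obj z ⊗ X) (Y := (UF k R P).obj (MonoidalCategory.tensorObj z (bcRep R X))) (cbc z X) (fun g v => by
    refine LinearMap.congr_fun (f := (cbc z X).toLinearMap ∘ₗ TensorProduct.map (rsL k (z.ρ g)) (X.ρ g))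
       (g := rsL k ((MonoidalCategory.tensorObj z (bcRep R X)).ρ g) ∘ₗ (cbc z X).toLinearMap) ?_ v
    refine TensorProduct.ext' fun v x => ?_
    rfl)
theorem bc_retr : ∃ (i : X ⟶ (UF k R P).obj (bcRep R X)) (r : (UF k R P).obj (bcRep R X) ⟶ X), i ≫ r = 𝟙 X := by
  obtain ⟨τ, hτ⟩ := LinearMap.exists_leftInverse_of_injective (Algebra.linearMap k R) (LinearMap.ker_eq_bot.2 (algebraMap k R).injective)
  let i0 : X →ₗ[k] R ⊗[k] X := TensorProduct.mk k R X 1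
  let r0 : R ⊗[k] X →ₗ[k] X := (TensorProduct.lid k X).toLinearMap ∘ₗ LinearMap.rTensor X τ
  have hs : ∀ (c : k) (y : R ⊗[k] X), @Eq (R ⊗[k] X) (@SMul.smul k (RS k (bcRep R X)) _ c y) (c • y) := fun c y => algebraMap_smul R c y
  let i : X →ₗ[k] RS k (bcRep R X) := ⟨⟨i0, fun a b => i0.map_add a b⟩, fun c x => (i0.map_smul c x).trans (hs c _).symm⟩
  let r : RS k (bcRep R X) →ₗ[k] X := ⟨⟨r0, fun a b => r0.map_add a b⟩, fun c x => (congrArg r0 (hs c x)).trans (r0.map_smul c x)⟩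
  refine ⟨mkHom (X := X) (Y := (UF k R P).obj (bcRep R X)) i fun g v => ?_, mkHom (X := (UF k R P).obj (bcRep R X)) (Y := X) r fun g v => ?_, ?_⟩
  · rfl
  · refine LinearMap.congr_fun (f := r0 ∘ₗ LinearMap.lTensor R (X.ρ g)) (g := X.ρ g ∘ₗ r0) ?_ v
    refine TensorProduct.ext' fun v x => ?_
    exact (map_smul (X.ρ g) (τ v) x).symm
  · apply toLin_inj
    refine LinearMap.ext fun x => ?_
    have h1 : τ 1 = 1 := by
      have := LinearMap.congr_fun hτ 1
      simpa using this
    show (τ 1) • x = x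
    rw [h1, one_smul]
theorem descent (X : FDRep k P) (h : Good (bcRep R X)) : Good X := by
  obtain ⟨L, h1, h2⟩ := h
  obtain ⟨i, r, hir⟩ := bc_retr (R := R) X
  refine ⟨L.map (UF k R P).obj, ?_, ?_⟩
  · exact (h1.map (UF k R P) fun z hz => .of_mem (List.mem_map_of_mem hz)).retract i r hir
  · intro _ hz
    obtain ⟨z, hz', rfl⟩ := List.mem_map.1 hz
    exact ((h2 z hz').map (UF k R P) fun z hz => .of_mem (List.mem_map_of_mem hz)).iso (Ut z X)
end
end A7

namespace A7
open scoped TensorProduct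
section
variable {R P : Type} [Field R] [CharP R 3] [Group P]
variable (R) in
def cst : ZMod 3 →+* R := ZMod.castHom (dvd_refl 3) R
variable {ι κ : Type} [Fintype ι] [DecidableEq ι] [Fintype κ] [DecidableEq κ]
def gA (N : Matrix ι ι (ZMod 3)) (w : ι → ℕ) (t : R) : Matrix ι ι R := fun p q => cst R (N p q) * t ^ (w q - w p)
structure Gr (X : FDRep R P) (N : Matrix ι ι (ZMod 3)) (w : ι → ℕ) (t : P → R) where
  e : X ≃ₗ[R] (ι → R)
  he : ∀ g x, e (X.ρ g x) = (gA N w (t g)).mulVec (e x)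
  sup : ∀ p q, N p q ≠ 0 → w p ≤ w q
variable {X Y : FDRep R P} {N : Matrix ι ι (ZMod 3)} {N' : Matrix κ κ (ZMod 3)} {w : ι → ℕ} {w' : κ → ℕ} {t : P → R}
noncomputable def Gr.tensor (gX : Gr X N w t) (gY : Gr Y N' w' t) :
    Gr (X ⊗ Y) (fun p q : ι × κ => N p.1 q.1 * N' p.2 q.2) (fun p => w p.1 + w' p.2) t where
  e := (TensorProduct.congr gX.e gY.e).trans (tE R ι κ)
  he g x := by
    refine LinearMap.congr_fun (f := ((TensorProduct.congr gX.e gY.e).trans (tE R ι κ)).toLinearMap ∘ₗ TensorProduct.map (X.ρ g) (Y.ρ g))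
      (g := (Matrix.mulVecLin (gA (fun p q : ι × κ => N p.1 q.1 * N' p.2 q.2) (fun p => w p.1 + w' p.2) (t g))) ∘ₗ ((TensorProduct.congr gX.e gY.e).trans (tE R ι κ)).toLinearMap) ?_ x
    refine TensorProduct.ext' fun u v => ?_
    funext p
    refine (tE_tmul R ι κ _ _ p).trans ?_
    refine (congrArg₂ (· * ·) (congrFun (gX.he g u) p.1) (congrFun (gY.he g v) p.2)).trans ?_
    show _ = ∑ q, gA (fun p q : ι × κ => N p.1 q.1 * N' p.2 q.2) (fun p => w p.1 + w' p.2) (t g) p q * ((TensorProduct.congr gX.e gY.e).trans (tE R ι κ)).toLinearMap (u ⊗ₜ v) q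
    simp only [Matrix.mulVec, dotProduct]
    rw [Finset.sum_mul_sum, Fintype.sum_prod_type]
    refine Finset.sum_congr rfl fun a _ => Finset.sum_congr rfl fun b _ => ?_
    have e1 : ((TensorProduct.congr gX.e gY.e).trans (tE R ι κ)).toLinearMap (u ⊗ₜ v) (a, b) = gX.e u a * gY.e v b := tE_tmul R ι κ _ _ (a, b)
    rw [e1]
    simp only [gA, map_mul]
    by_cases h1 : N p.1 a = 0
    · simp [h1]
    by_cases h2 : N' p.2 b = 0
    · simp [h2]
    have h3 := gX.sup _ _ h1
    have h4 := gY.sup _ _ h2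
    have : w a + w' b - (w p.1 + w' p.2) = (w a - w p.1) + (w' b - w' p.2) := by omega
    rw [this, pow_add]; ring
  sup p q h := Nat.add_le_add (gX.sup _ _ (left_ne_zero_of_mul h)) (gY.sup _ _ (right_ne_zero_of_mul h))
noncomputable def Gr.hom (gX : Gr X N w t) (gY : Gr Y N' w' t) (B : Matrix κ ι (ZMod 3)) (hB : B * N = N' * B) (s s' : ℕ)
    (hw : ∀ p q, B p q ≠ 0 → w' p + s' = w q + s) : X ⟶ Y :=
  mkHom (gY.e.symm.toLinearMap ∘ₗ Matrix.mulVecLin (B.map (cst R)) ∘ₗ gX.e.toLinearMap) (fun g x => by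
    apply gY.e.injective
    rw [gY.he]
    simp only [LinearMap.comp_apply, LinearEquiv.coe_coe, LinearEquiv.apply_symm_apply, Matrix.mulVecLin_apply]
    rw [gX.he, Matrix.mulVec_mulVec, Matrix.mulVec_mulVec]
    congr 1
    ext p q
    rw [Matrix.mul_apply, Matrix.mul_apply]
    have h1 : ∀ r, (B.map (cst R)) p r * gA N w (t g) r q = cst R (B p r * N r q) * t g ^ (w q + s - (w' p + s')) := fun r => by
      simp only [Matrix.map_apply, gA, map_mul]
      by_cases h1 : B p r = 0
      · simp [h1]
      by_cases h2 : N r q = 0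
      · simp [h2]
      have h3 := gX.sup _ _ h2
      have h4 := hw _ _ h1
      have : w q + s - (w' p + s') = w q - w r := by omega
      rw [this]; ring
    have h2 : ∀ r, gA N' w' (t g) p r * (B.map (cst R)) r q = cst R (N' p r * B r q) * t g ^ (w q + s - (w' p + s')) := fun r => by
      simp only [Matrix.map_apply, gA, map_mul]
      by_cases h1 : B r q = 0
      · simp [h1]
      by_cases h2 : N' p r = 0
      · simp [h2]
      have h3 := gY.sup _ _ h2
      have h4 := hw _ _ h1
      have : w q + s - (w' p + s') = w' r - w' p := by omega
      rw [this]; ring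
    rw [Finset.sum_congr rfl fun r _ => h1 r, Finset.sum_congr rfl fun r _ => h2 r, ← Finset.sum_mul, ← Finset.sum_mul, ← map_sum, ← map_sum,
      ← Matrix.mul_apply, ← Matrix.mul_apply, hB])
def HF (Z : FDRep R P → Prop) (gX : Gr X N w t) (C : Matrix ι ι (ZMod 3)) : Prop :=
  ∃ f ∈ Fact Z X X, ∀ x, gX.e (toLin f x) = (C.map (cst R)).mulVec (gX.e x)
variable {Z : FDRep R P → Prop}
theorem HF.add {gX : Gr X N w t} {C C' : Matrix ι ι (ZMod 3)} (h : HF Z gX C) (h' : HF Z gX C') : HF Z gX (C + C') := by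
  obtain ⟨f, hf, h⟩ := h
  obtain ⟨f', hf', h'⟩ := h'
  refine ⟨f + f', add_mem hf hf', fun x => ?_⟩
  rw [toLin_add, LinearMap.add_apply, map_add, h, h', Matrix.map_add _ (map_add _), Matrix.add_mulVec]
theorem HF.of (gX : Gr X N w t) (gY : Gr Y N' w' t) (hY : InAdd Z Y) (B : Matrix κ ι (ZMod 3)) (B' : Matrix ι κ (ZMod 3)) (s s' : ℕ)
   (h : (B * N = N' * B ∧ ∀ x : κ × ι, B x.1 x.2 ≠ 0 → w' x.1 + s' = w x.2 + s) ∧ (B' * N' = N * B' ∧ ∀ x : ι × κ, B' x.1 x.2 ≠ 0 → w x.1 + s = w' x.2 + s')) :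
   HF Z gX (B' * B) := by
  have h1 := fact_left (gX.hom gY B h.1.1 s s' fun p q => h.1.2 (p, q)) (fact_right (gY.hom gX B' h.2.1 s' s fun p q => h.2.2 (p, q)) hY)
  rw [Category.id_comp] at h1
  refine ⟨_, h1, fun x => ?_⟩
  rw [toLin_comp, Gr.hom, Gr.hom, toLin_mkHom, toLin_mkHom]
  simp only [LinearMap.comp_apply, LinearEquiv.coe_coe, LinearEquiv.apply_symm_apply, Matrix.mulVecLin_apply]
  rw [Matrix.mulVec_mulVec, Matrix.map_mul]
theorem HF.one {gX : Gr X N w t} (h : HF Z gX 1) : InAdd Z X := by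
  obtain ⟨f, hf, h⟩ := h
  have : f = 𝟙 X := by
    apply toLin_inj
    refine LinearMap.ext fun x => gX.e.injective ?_
    rw [h, Matrix.map_one _ (map_zero _) (map_one _), Matrix.one_mulVec]; rfl
  rw [this] at hf
  exact hf
end
end A7

namespace A7
section
variable {R P : Type} [Field R] [Group P]
noncomputable def mRep {ι : Type} [Fintype ι] [DecidableEq ι] (A : P → Matrix ι ι R) (h1 : A 1 = 1) (hm : ∀ g h, A (g * h) = A g * A h) : FDRep R P :=
  FDRep.of (V := ι → R)
   { toFun := fun g => Matrix.mulVecLin (A g)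
     map_one' := by rw [h1, Matrix.mulVecLin_one]; rfl
     map_mul' := fun a b => by rw [hm, Matrix.mulVecLin_mul]; rfl }
theorem prodAll {α β : Type} {Q : α → β → Prop} (h : ∀ x : α × β, Q x.1 x.2) : ∀ p q, Q p q := fun p q => h (p, q)
def NV : Matrix (Fin 2) (Fin 2) (ZMod 3) := !![1, 1; 0, 1]
def NS : Matrix (Fin 3) (Fin 3) (ZMod 3) := !![1, 1, 1; 0, 1, 2; 0, 0, 1]
def N1 : Matrix (Fin 1) (Fin 1) (ZMod 3) := !![1]
variable [CharP R 3]
theorem gV_mul (x y : R) : gA NV ![0, 1] (x + y) = gA NV ![0, 1] x * gA NV ![0, 1] y := by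
  ext p q; fin_cases p <;> fin_cases q <;> simp [gA, NV, Matrix.mul_apply, Fin.sum_univ_two, cst]; ring
theorem gV_zero : gA NV ![0, 1] (0 : R) = 1 := by
  ext p q; fin_cases p <;> fin_cases q <;> simp [gA, NV, cst]
theorem gS_mul (x y : R) : gA NS ![0, 1, 2] (x + y) = gA NS ![0, 1, 2] x * gA NS ![0, 1, 2] y := by
  have h2 : cst R 2 = 2 := map_ofNat _ 2
  ext p q; fin_cases p <;> fin_cases q <;> simp [gA, NS, Matrix.mul_apply, Fin.sum_univ_three, h2] <;> ring
theorem gS_zero : gA NS ![0, 1, 2] (0 : R) = 1 := by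
  ext p q; fin_cases p <;> fin_cases q <;> simp [gA, NS, cst]
structure AH (t : P → R) : Prop where
  one : t 1 = 0
  mul : ∀ g h, t (g * h) = t g + t h
variable {t : P → R}
theorem AH.cube (h : AH t) : AH (fun g => t g ^ 3) := ⟨by simp [h.one], fun a b => by
  have h3 := h3F R
  simp only [h.mul]; linear_combination (t a ^ 2 * t b + t a * t b ^ 2) * h3⟩
noncomputable def Vr (h : AH t) : FDRep R P := mRep (fun g => gA NV ![0, 1] (t g)) (by simp only [h.one, gV_zero]) (fun a b => by simp only [h.mul, gV_mul])
noncomputable def Sr (h : AH t) : FDRep R P := mRep (fun g => gA NS ![0, 1, 2] (t g)) (by simp only [h.one, gS_zero]) (fun a b => by simp only [h.mul, gS_mul])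
variable (R P) in
noncomputable def Or : FDRep R P := mRep (ι := Fin 1) (fun g => 1) rfl (fun a b => (one_mul _).symm)
noncomputable def Vr_gr (h : AH t) : Gr (Vr h) NV ![0, 1] t := ⟨LinearEquiv.refl R (Fin 2 → R), fun g x => rfl, prodAll (by decide)⟩
noncomputable def Vr_gr3 (h : AH t) : Gr (Vr h.cube) NV ![0, 3] t := ⟨LinearEquiv.refl R (Fin 2 → R), fun g x => by
  have e : gA NV ![0, 3] (t g) = gA NV ![0, 1] (t g ^ 3) := by
    ext p q; fin_cases p <;> fin_cases q <;> simp [gA, NV, cst]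
  rw [e]; rfl, prodAll (by decide)⟩
noncomputable def Sr_gr (h : AH t) : Gr (Sr h) NS ![0, 1, 2] t := ⟨LinearEquiv.refl R (Fin 3 → R), fun g x => rfl, prodAll (by decide)⟩
noncomputable def Or_gr (t : P → R) : Gr (Or R P) N1 ![0] t := ⟨LinearEquiv.refl R (Fin 1 → R), fun g x => by
  have e : gA N1 ![0] (t g) = 1 := by
    ext p q; fin_cases p; fin_cases q; simp [gA, N1, cst]
  rw [e]; rfl, prodAll (by decide)⟩
def f1 (p : Fin 1) : ℕ := p.val
def f3 (p : Fin 3) : ℕ := p.val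
def dm {ι κ : Type} (n L : ℕ) (f : κ → ℕ) (f' : ι → ℕ) : Matrix κ ι (ZMod 3) := fun p q => ((n / 3 ^ (f p * L + f' q) : ℕ) : ZMod 3)
def i2 (p : Fin 2 × Fin 2) : ℕ := p.1.val * 2 + p.2.val
def i3 (p : Fin 3 × Fin 2) : ℕ := p.1.val * 2 + p.2.val
def i6 (p : (Fin 3 × Fin 3) × Fin 2) : ℕ := (p.1.1.val * 3 + p.1.2.val) * 2 + p.2.val
theorem E1 (h : AH t) : InAdd (fun z => z = Or R P ∨ z = Sr h) (Vr h ⊗ Vr h) := by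
  let gX := (Vr_gr h).tensor (Vr_gr h)
  have a := HF.of (Z := fun z => z = Or R P ∨ z = Sr h) gX (Or_gr t) (.of_mem (.inl rfl)) (dm 21 4 f1 i2) (dm 15 1 i2 f1) 0 1 (by decide +kernel)
  have b := HF.of (Z := fun z => z = Or R P ∨ z = Sr h) gX (Sr_gr h) (.of_mem (.inr rfl)) (dm 356240 4 f3 i2) (dm 356564 3 i2 f3) 0 0 (by decide +kernel)
  have c := a.add b
  rw [show dm 15 1 i2 f1 * dm 21 4 f1 i2 + dm 356564 3 i2 f3 * dm 356240 4 f3 i2 = 1 by decide +kernel] at c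
  exact c.one
def a1 := 878203295329575389521810088345845165133174824606752
def b1 := 1546132889001708776599099684560710578455203568348
def a2 := 377256345214853825747652447335340107868878440477944
def b2 := 4243408800982988413753179284634080391832136973
def a3 := 2254261275706161622027028433399837229886506481765528
def b3 := 2254433539534780645170550575534258359909621705413604
theorem E2 (h : AH t) : InAdd (fun z => z = Sr h ⊗ Vr h ∨ z = Sr h ⊗ Vr h.cube) ((Sr h ⊗ Sr h) ⊗ Vr h) := by
  let gX := ((Sr_gr h).tensor (Sr_gr h)).tensor (Vr_gr h)
  have a := HF.of (Z := fun z => z = Sr h ⊗ Vr h ∨ z = Sr h ⊗ Vr h.cube) gX ((Sr_gr h).tensor (Vr_gr h)) (.of_mem (.inl rfl)) (dm a1 18 i3 i6) (dm b1 6 i6 i3) 0 1 (by decide +kernel)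
  have b := HF.of (Z := fun z => z = Sr h ⊗ Vr h ∨ z = Sr h ⊗ Vr h.cube) gX ((Sr_gr h).tensor (Vr_gr h)) (.of_mem (.inl rfl)) (dm a2 18 i3 i6) (dm b2 6 i6 i3) 0 1 (by decide +kernel)
  have d := HF.of (Z := fun z => z = Sr h ⊗ Vr h ∨ z = Sr h ⊗ Vr h.cube) gX ((Sr_gr h).tensor (Vr_gr3 h)) (.of_mem (.inr rfl)) (dm a3 18 i3 i6) (dm b3 6 i6 i3) 0 0 (by decide +kernel)
  have c := (a.add b).add d
  rw [show dm b1 6 i6 i3 * dm a1 18 i3 i6 + dm b2 6 i6 i3 * dm a2 18 i3 i6 + dm b3 6 i6 i3 * dm a3 18 i3 i6 = 1 by decide +kernel] at c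
  exact c.one
end
end A7

namespace A7
section
variable {R P : Type} [Field R] [Group P] [Fintype P]
def IsProj (X : FDRep R P) : Prop := ∃ t : X →ₗ[R] X, ∀ x, ∑ g, X.ρ g (t (X.ρ g⁻¹ x)) = x
theorem IsProj.inAdd {X : FDRep R P} (h : IsProj X) : InAdd (fun z => z = fnRep R P P) X := by
  obtain ⟨t, ht⟩ := h
  let b := Module.finBasis R X
  let α : ∀ i, X ⟶ fnRep R P P := fun i => mkHom (Y := fnRep R P P) (LinearMap.pi fun g => b.coord i ∘ₗ t ∘ₗ X.ρ g⁻¹) (fun h x => by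
    funext g
    show b.coord i (t (X.ρ g⁻¹ (X.ρ h x))) = b.coord i (t (X.ρ (h⁻¹ * g)⁻¹ x))
    rw [ρρ, mul_inv_rev, inv_inv])
  let bL : ∀ i, (P → R) →ₗ[R] X := fun i => ∑ g, (LinearMap.proj g : (P → R) →ₗ[R] R).smulRight (X.ρ g (b i))
  have hbL : ∀ i f, bL i f = ∑ g, f g • X.ρ g (b i) := fun i f => LinearMap.sum_apply _ _ _
  let β : ∀ i, fnRep R P P ⟶ X := fun i => mkHom (X := fnRep R P P) (bL i) (fun h f => by
    refine (hbL i _).trans (Eq.trans ?_ (congrArg (X.ρ h) (hbL i f).symm))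
    rw [map_sum]
    refine (Equiv.sum_comp (Equiv.mulLeft h) _).symm.trans ?_
    refine Finset.sum_congr rfl fun g _ => ?_
    show (f : P → R) (h⁻¹ * (h * g)) • X.ρ (h * g) (b i) = X.ρ h ((f : P → R) g • X.ρ g (b i))
    rw [inv_mul_cancel_left, map_smul, ρρ])
  refine InAdd.of_sum Finset.univ (fun _ => fnRep R P P) α β ?_ (fun i _ => .of_mem rfl)
  apply toLin_inj
  rw [toLin_sum]
  refine LinearMap.ext fun x => ?_
  rw [LinearMap.sum_apply]
  have e : ∀ i, toLin (α i ≫ β i) x = ∑ g, b.coord i (t (X.ρ g⁻¹ x)) • X.ρ g (b i) := fun i => hbL i _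
  rw [Finset.sum_congr rfl fun i _ => e i, Finset.sum_comm]
  refine Eq.trans ?_ (ht x)
  refine Finset.sum_congr rfl fun g _ => ?_
  conv_rhs => rw [← b.sum_repr (t (X.ρ g⁻¹ x)), map_sum]
  refine Finset.sum_congr rfl fun i _ => ?_
  rw [map_smul]; rfl
theorem IsProj.tensor {X : FDRep R P} (h : IsProj X) (Y : FDRep R P) : IsProj (X ⊗ Y) := by
  obtain ⟨t, ht⟩ := h
  refine ⟨TensorProduct.map t LinearMap.id, fun x => ?_⟩
  have : ∑ g, TensorProduct.map (X.ρ g) (Y.ρ g) ∘ₗ TensorProduct.map t LinearMap.id ∘ₗ TensorProduct.map (X.ρ g⁻¹) (Y.ρ g⁻¹) = LinearMap.id := by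
    refine TensorProduct.ext' fun u v => ?_
    rw [LinearMap.sum_apply]
    simp only [LinearMap.comp_apply, TensorProduct.map_tmul, LinearMap.id_apply]
    have : ∀ g, Y.ρ g (Y.ρ g⁻¹ v) = v := fun g => by rw [ρρ, mul_inv_cancel, map_one]; rfl
    simp only [this]
    rw [← TensorProduct.sum_tmul, ht]
  have h2 := LinearMap.congr_fun this x
  rw [LinearMap.sum_apply] at h2
  exact h2
theorem isProj_kP : IsProj (fnRep R P P) := by
  classical
  refine ⟨(LinearMap.single R (fun _ : P => R) 1) ∘ₗ LinearMap.proj (R := R) (φ := fun _ : P => R) 1, fun x => ?_⟩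
  refine @Eq.trans (P → R) _ (∑ g : P, fun w => if w = g then (x : P → R) g else 0) _ ?_ ?_
  · refine Finset.sum_congr rfl fun g _ => ?_
    funext w
    show (Pi.single (1 : P) ((x : P → R) (g⁻¹⁻¹ * 1)) : P → R) (g⁻¹ * w) = _
    rw [inv_inv, mul_one, Pi.single_apply]
    have : g⁻¹ * w = 1 ↔ w = g := by rw [inv_mul_eq_one, eq_comm]
    simp only [this]
  · funext w
    exact (Finset.sum_apply _ _ _).trans (Fintype.sum_ite_eq w (fun g => (x : P → R) g))
theorem kP_left (X : FDRep R P) : InAdd (fun z => z = fnRep R P P) (fnRep R P P ⊗ X) := (isProj_kP.tensor X).inAdd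
theorem kP_right (X : FDRep R P) : InAdd (fun z => z = fnRep R P P) (X ⊗ fnRep R P P) := (kP_left X).iso (β_ _ _)
variable [CharP R 3]
variable {ι : Type} [Fintype ι] [DecidableEq ι]
variable {X : FDRep R P} {N : Matrix ι ι (ZMod 3)} {w : ι → ℕ} {t : P → R}
theorem Gr.proj (gX : Gr X N w t) (z y : ι) (H : ∀ p q, ∑ g, (gA N w (t g) p z - gA N w (t g) p y) * gA N w (t g⁻¹) z q = if p = q then 1 else 0) : IsProj X := by
  refine ⟨(LinearMap.proj z ∘ₗ gX.e.toLinearMap).smulRight (gX.e.symm (Pi.single z 1 - Pi.single y 1)), fun x => ?_⟩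
  apply gX.e.injective
  rw [map_sum]
  funext p
  rw [Finset.sum_apply]
  have e : ∀ g, gX.e (X.ρ g ((LinearMap.proj z ∘ₗ gX.e.toLinearMap).smulRight (gX.e.symm (Pi.single z 1 - Pi.single y 1)) (X.ρ g⁻¹ x))) p =
      ∑ q, ((gA N w (t g) p z - gA N w (t g) p y) * gA N w (t g⁻¹) z q) * gX.e x q := fun g => by
    rw [gX.he]
    simp only [LinearMap.smulRight_apply, map_smul, LinearEquiv.apply_symm_apply, Matrix.mulVec_smul, Matrix.mulVec_sub, Matrix.mulVec_single_one,
      LinearMap.comp_apply, LinearMap.proj_apply, LinearEquiv.coe_coe, gX.he]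
    simp only [Pi.smul_apply, Pi.sub_apply, Matrix.col_apply, smul_eq_mul, Matrix.mulVec, dotProduct]
    rw [Finset.sum_mul]
    refine Finset.sum_congr rfl fun q _ => by ring
  rw [Finset.sum_congr rfl fun g _ => e g, Finset.sum_comm]
  simp only [← Finset.sum_mul, H]
  simp
end
section
variable {R : Type} [Field R] [CharP R 3] (I : R) (hI : I * I = -1)
noncomputable def LZ : ℤ√(-1) →+* R := Zsqrtd.lift ⟨I, by rw [hI]; simp⟩
theorem LZ_eq (z z' : ℤ√(-1)) (h : (z - z').re % 3 = 0 ∧ (z - z').im % 3 = 0) : LZ I hI z = LZ I hI z' := by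
  rw [← sub_eq_zero, ← map_sub]
  obtain ⟨a, ha⟩ := Int.dvd_of_emod_eq_zero h.1
  obtain ⟨b, hb⟩ := Int.dvd_of_emod_eq_zero h.2
  have h3 := h3F R
  simp only [LZ, Zsqrtd.lift_apply_apply, ha, hb]
  push_cast
  linear_combination (a + b * I) * h3
def zθ (g : PP) : ℤ√(-1) := ⟨g.toAdd.1.val, g.toAdd.2.val⟩
noncomputable def θ (g : PP) : R := LZ I hI (zθ g)
theorem θ_AH : AH (θ I hI) where
  one := by
    have := LZ_eq I hI (zθ 1) 0 (by decide +kernel)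
    rwa [map_zero] at this
  mul g h := by
    have := LZ_eq I hI (zθ (g * h)) (zθ g + zθ h) (by revert g h; decide +kernel)
    rwa [map_add] at this
theorem θ9 (g : PP) : θ I hI g ^ 9 = θ I hI g := by
  have := LZ_eq I hI (zθ g ^ 9) (zθ g) (by revert g; decide +kernel)
  rwa [map_pow] at this
noncomputable def Sr_gr3 {P : Type} [Group P] {t : P → R} (h : AH t) : Gr (Sr h.cube) NS ![0, 3, 6] t := ⟨LinearEquiv.refl R (Fin 3 → R), fun g x => by
  have e : gA NS ![0, 3, 6] (t g) = gA NS ![0, 1, 2] (t g ^ 3) := by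
    ext p q; fin_cases p <;> fin_cases q <;> simp [gA, NS, cst, ← pow_mul]
  rw [e]; rfl, prodAll (by decide)⟩
def gZ {ι : Type} (N : Matrix ι ι (ZMod 3)) (w : ι → ℕ) (t : ℤ√(-1)) (p q : ι) : ℤ√(-1) := ((N p q).val : ℤ√(-1)) * t ^ (w q - w p)
theorem LZ_gZ {ι : Type} [Fintype ι] [DecidableEq ι] (N : Matrix ι ι (ZMod 3)) (w : ι → ℕ) (t : ℤ√(-1)) (p q : ι) : LZ I hI (gZ N w t p q) = gA N w (LZ I hI t) p q := by
  rw [gZ, gA, map_mul, map_pow, map_natCast]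
  rw [show cst R (N p q) = ((N p q).val : R) from ((congrArg (cst R) (ZMod.natCast_zmod_val (N p q))).symm.trans (map_natCast _ _))]
def NSS : Matrix (Fin 3 × Fin 3) (Fin 3 × Fin 3) (ZMod 3) := fun p q => NS p.1 q.1 * NS p.2 q.2
def wSS (p : Fin 3 × Fin 3) : ℕ := ![0, 1, 2] p.1 + ![0, 3, 6] p.2
def cE (x : (Fin 3 × Fin 3) × (Fin 3 × Fin 3)) : ℤ√(-1) := ∑ g : PP, (gZ NSS wSS (zθ g) x.1 (0, 0) - gZ NSS wSS (zθ g) x.1 (2, 2)) * gZ NSS wSS (zθ g⁻¹) (0, 0) x.2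
theorem cE_eq : ∀ x, (cE x - if x.1 = x.2 then 1 else 0).re % 3 = 0 ∧ (cE x - if x.1 = x.2 then 1 else 0).im % 3 = 0 := by decide +kernel
theorem E3 : IsProj (Sr (θ_AH I hI) ⊗ Sr (θ_AH I hI).cube) := by
  refine ((Sr_gr (θ_AH I hI)).tensor (Sr_gr3 (θ_AH I hI))).proj (0, 0) (2, 2) fun p q => ?_
  have := LZ_eq I hI _ _ (cE_eq (p, q))
  simp only [cE, map_sum, map_mul, map_sub, LZ_gZ, apply_ite (LZ I hI), map_one, map_zero] at this
  exact this
end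
end A7

namespace A7
section
variable {R P : Type} [Field R] [CharP R 3] [Group P] [Fintype P]
noncomputable def Or_iso : Or R P ≅ 𝟙_ (FDRep R P) := mkIso (X := Or R P) (Y := 𝟙_ (FDRep R P)) (LinearEquiv.funUnique (Fin 1) R R) (fun g v => by
  show LinearEquiv.funUnique (Fin 1) R R (Matrix.mulVec 1 v) = LinearEquiv.funUnique (Fin 1) R R v
  exact congrArg (LinearEquiv.funUnique (Fin 1) R R) (Matrix.one_mulVec (v : Fin 1 → R)))
noncomputable def Or_left (X : FDRep R P) : Or R P ⊗ X ≅ X := whiskerRightIso Or_iso X ≪≫ λ_ X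
noncomputable def Or_right (X : FDRep R P) : X ⊗ Or R P ≅ X := whiskerLeftIso X Or_iso ≪≫ ρ_ X
noncomputable def tswap (X Y Z W : FDRep R P) : (X ⊗ Y) ⊗ (Z ⊗ W) ≅ (X ⊗ Z) ⊗ (Y ⊗ W) :=
  ⟨tensorμ X Y Z W, tensorδ X Y Z W, tensorμ_tensorδ _ _ _ _, tensorδ_tensorμ _ _ _ _⟩
theorem Vr_congr {t t' : P → R} (e : t = t') (h : AH t) (h' : AH t') : Vr h = Vr h' := by subst e; rfl
theorem good_D {t : P → R} (h : AH t) (h9 : ∀ g, t g ^ 9 = t g) (pr : IsProj (Sr h ⊗ Sr h.cube)) : Good (Vr h ⊗ Vr h.cube) := by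
  have hV : Vr h.cube.cube = Vr h := Vr_congr (by funext g; rw [← pow_mul, h9]) _ _
  have e2 := E2 h
  have e2' := E2 h.cube
  rw [hV] at e2'
  have e1 := E1 h
  have e1' := E1 h.cube
  have ss := pr.inAdd
  have s's := ss.iso (β_ (Sr h.cube) (Sr h))
  have kr := fun X : FDRep R P => kP_right X
  have kl := fun X : FDRep R P => kP_left X
  generalize fnRep R P P = K at *
  generalize Sr h = S at *
  generalize Sr h.cube = S' at *
  generalize Vr h = V at *
  generalize Vr h.cube = V' at *
  have oo := fun X : FDRep R P => Or_left X
  have oo' := fun X : FDRep R P => Or_right X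
  generalize Or R P = O at *
  let L : List (FDRep R P) := [O, V ⊗ V', S, S', S ⊗ (V ⊗ V'), S' ⊗ (V ⊗ V'), S ⊗ S, S' ⊗ S', K]
  have hO : O ∈ L := by simp [L]
  have hD : V ⊗ V' ∈ L := by simp [L]
  have hS : S ∈ L := by simp [L]
  have hS' : S' ∈ L := by simp [L]
  have hSD : S ⊗ (V ⊗ V') ∈ L := by simp [L]
  have hSD' : S' ⊗ (V ⊗ V') ∈ L := by simp [L]
  have hSS : S ⊗ S ∈ L := by simp [L]
  have hSS' : S' ⊗ S' ∈ L := by simp [L]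
  have hK : K ∈ L := by simp [L]
  have tk : ∀ X, InAdd (fun z => z = K) X → InAdd (· ∈ L) X := fun X hX => hX.mono fun z hz => hz ▸ hK
  have om : ∀ {X}, X ∈ L → InAdd (· ∈ L) X := fun hX => InAdd.of_mem hX
  have dd : InAdd (fun z => z = O ∨ z = S ∨ z = S' ∨ z = K) ((V ⊗ V') ⊗ (V ⊗ V')) := by
    refine InAdd.iso ?_ (tswap V V' V V')
    refine InAdd.tensor e1 e1' ?_
    rintro z (rfl | rfl) z' (rfl | rfl)
    · exact InAdd.iso (.of_mem (.inl rfl)) (oo _)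
    · exact InAdd.iso (.of_mem (.inr (.inr (.inl rfl)))) (oo _)
    · exact InAdd.iso (.of_mem (.inr (.inl rfl))) (oo' _)
    · exact ss.mono fun z hz => .inr (.inr (.inr hz))
  refine ⟨L, om hD, fun z hz => ?_⟩
  simp only [L, List.mem_cons, List.not_mem_nil, or_false] at hz
  rcases hz with hz | hz | hz | hz | hz | hz | hz | hz | hz <;> rw [hz]
  · exact (om hD).iso (oo _)
  · refine dd.mono ?_
    rintro z (rfl | rfl | rfl | rfl) <;> assumption
  · exact om hSD
  · exact om hSD'
  · refine InAdd.iso ?_ (α_ S (V ⊗ V') (V ⊗ V'))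
    refine dd.tensorLeft S ?_
    rintro z (rfl | rfl | rfl | rfl)
    · exact (om hS).iso (oo' _)
    · exact om hSS
    · exact tk _ ss
    · exact tk _ (kr _)
  · refine InAdd.iso ?_ (α_ S' (V ⊗ V') (V ⊗ V'))
    refine dd.tensorLeft S' ?_
    rintro z (rfl | rfl | rfl | rfl)
    · exact (om hS').iso (oo' _)
    · exact tk _ s's
    · exact om hSS'
    · exact tk _ (kr _)
  · refine InAdd.iso ?_ (α_ (S ⊗ S) V V').symm
    refine e2.tensorRight V' ?_
    rintro z (rfl | rfl)
    · exact (om hSD).iso (α_ _ _ _)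
    · refine InAdd.iso ?_ (α_ S V' V')
      refine e1'.tensorLeft S ?_
      rintro z (rfl | rfl)
      · exact (om hS).iso (oo' _)
      · exact tk _ ss
  · refine InAdd.iso ?_ (whiskerLeftIso (S' ⊗ S') (β_ V V') ≪≫ (α_ (S' ⊗ S') V' V).symm)
    refine e2'.tensorRight V ?_
    rintro z (rfl | rfl)
    · exact (om hSD').iso (α_ _ _ _ ≪≫ whiskerLeftIso S' (β_ V' V))
    · refine InAdd.iso ?_ (α_ S' V V)
      refine e1.tensorLeft S' ?_
      rintro z (rfl | rfl)
      · exact (om hS').iso (oo' _)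
      · exact tk _ s's
  · exact tk _ (kl _)
end
def DM (g : PP) : Matrix (Fin 4) (Fin 4) (ZMod 3) :=
  let a := g.toAdd.1
  let b := g.toAdd.2
  !![1, a, b, a * a + b * b; 0, 1, 0, 2 * a; 0, 0, 1, 2 * b; 0, 0, 0, 1]
theorem DM_mul : ∀ x : PP × PP, DM (x.1 * x.2) = DM x.1 * DM x.2 := by decide +kernel
section
variable (k : Type) [Field k] [CharP k 3]
noncomputable def Dk : FDRep k PP := mRep (fun g => (DM g).map (cst k))
  (by rw [show DM 1 = 1 by decide +kernel, Matrix.map_one _ (map_zero _) (map_one _)]) (fun a b => by rw [DM_mul (a, b), Matrix.map_mul])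
variable {k}
variable {R : Type} [Field R] [CharP R 3] (I : R) (hI : I * I = -1)
def iu : ℤ√(-1) := ⟨0, 1⟩
def BZ (p : Fin 2 × Fin 2) (q : Fin 4) : ℤ√(-1) :=
  (!![1, 0, 0, 0; 0, -1, -iu, 0; 0, -1, iu, 0; 0, 0, 0, 1] : Matrix (Fin 4) (Fin 4) (ℤ√(-1))) ⟨p.1.val * 2 + p.2.val, by omega⟩ q
def CZ (q : Fin 4) (p : Fin 2 × Fin 2) : ℤ√(-1) :=
  (!![1, 0, 0, 0; 0, 1, 1, 0; 0, -iu, iu, 0; 0, 0, 0, 1] : Matrix (Fin 4) (Fin 4) (ℤ√(-1))) q ⟨p.1.val * 2 + p.2.val, by omega⟩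
def z3 (z : ℤ√(-1)) : Prop := z.re % 3 = 0 ∧ z.im % 3 = 0
instance (z) : Decidable (z3 z) := inferInstanceAs (Decidable (_ ∧ _))
theorem BC : ∀ x : (Fin 2 × Fin 2) × (Fin 2 × Fin 2), z3 ((∑ r, BZ x.1 r * CZ r x.2) - if x.1 = x.2 then 1 else 0) := by decide +kernel
theorem CB : ∀ x : Fin 4 × Fin 4, z3 ((∑ r, CZ x.1 r * BZ r x.2) - if x.1 = x.2 then 1 else 0) := by decide +kernel
def NVV : Matrix (Fin 2 × Fin 2) (Fin 2 × Fin 2) (ZMod 3) := fun p q => NV p.1 q.1 * NV p.2 q.2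
def wVV (p : Fin 2 × Fin 2) : ℕ := ![0, 1] p.1 + ![0, 3] p.2
theorem BD : ∀ x : PP × (Fin 2 × Fin 2) × Fin 4, z3 ((∑ r, BZ x.2.1 r * ((DM x.1 r x.2.2).val : ℤ√(-1))) - ∑ r, gZ NVV wVV (zθ x.1) x.2.1 r * BZ r x.2.2) := by decide +kernel
noncomputable def BR : Matrix (Fin 2 × Fin 2) (Fin 4) R := fun p q => LZ I hI (BZ p q)
noncomputable def CR : Matrix (Fin 4) (Fin 2 × Fin 2) R := fun p q => LZ I hI (CZ p q)
theorem BR_CR : BR I hI * CR I hI = 1 := by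
  ext p q
  have := LZ_eq I hI _ _ (BC (p, q))
  simp only [map_sum, map_mul, apply_ite (LZ I hI), map_one, map_zero] at this
  rw [Matrix.mul_apply, Matrix.one_apply]
  exact this
theorem CR_BR : CR I hI * BR I hI = 1 := by
  ext p q
  have := LZ_eq I hI _ _ (CB (p, q))
  simp only [map_sum, map_mul, apply_ite (LZ I hI), map_one, map_zero] at this
  rw [Matrix.mul_apply, Matrix.one_apply]
  exact this
theorem BR_D (g : PP) : BR I hI * (DM g).map (cst R) = gA NVV wVV (θ I hI g) * BR I hI := by
  ext p q
  have := LZ_eq I hI _ _ (BD (g, p, q))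
  have hc : ∀ n : ZMod 3, (n.val : R) = cst R n := fun n => ((congrArg (cst R) (ZMod.natCast_zmod_val n)).symm.trans (map_natCast _ _)).symm
  simp only [map_sum, map_mul, LZ_gZ, map_natCast, hc] at this
  rw [Matrix.mul_apply, Matrix.mul_apply]
  exact this
noncomputable def bcD [Algebra k R] : bcRep R (Dk k) ≅ Dk R :=
  mkIso (X := bcRep R (Dk k)) (Y := Dk R) (TensorProduct.piScalarRight k R R (Fin 4)) (fun g v => by
    have key : ∀ v : TensorProduct k R (Fin 4 → k), TensorProduct.piScalarRight k R R (Fin 4) ((Matrix.mulVecLin ((DM g).map (cst k))).baseChange R v) =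
        ((DM g).map (cst R)).mulVec (TensorProduct.piScalarRight k R R (Fin 4) v) := fun v => by
      induction v using TensorProduct.induction_on with
      | zero => simp only [map_zero, Matrix.mulVec_zero]
      | add x y hx hy => simp only [map_add, hx, hy, Matrix.mulVec_add]
      | tmul r f =>
        funext i
        have hc : ∀ n : ZMod 3, algebraMap k R (cst k n) = cst R n := fun n =>
          RingHom.congr_fun (Subsingleton.elim ((algebraMap k R).comp (cst k)) (cst R)) n
        simp only [LinearMap.baseChange_tmul, TensorProduct.piScalarRight_apply, TensorProduct.piScalarRightHom_tmul, Matrix.mulVecLin_apply, Matrix.mulVec, dotProduct, Matrix.map_apply,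
          Finset.sum_smul]
        refine Finset.sum_congr rfl fun j _ => ?_
        rw [Algebra.smul_def, Algebra.smul_def, map_mul, hc, mul_assoc]
    exact key v)
noncomputable def DkV (I : R) (hI : I * I = -1) : Dk R ≅ Vr (θ_AH I hI) ⊗ Vr (θ_AH I hI).cube :=
  mkIso (X := Dk R) (Y := Vr (θ_AH I hI) ⊗ Vr (θ_AH I hI).cube) ((Matrix.toLin'OfInv (BR_CR I hI) (CR_BR I hI)).symm.trans ((Vr_gr (θ_AH I hI)).tensor (Vr_gr3 (θ_AH I hI))).e.symm) (fun g v => by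
    have key := ((Vr_gr (θ_AH I hI)).tensor (Vr_gr3 (θ_AH I hI))).he g (((Vr_gr (θ_AH I hI)).tensor (Vr_gr3 (θ_AH I hI))).e.symm ((BR I hI).mulVec v))
    rw [LinearEquiv.apply_symm_apply] at key
    replace key := key.trans (Matrix.mulVec_mulVec (v : Fin 4 → R) (gA NVV wVV (θ I hI g)) (BR I hI))
    apply ((Vr_gr (θ_AH I hI)).tensor (Vr_gr3 (θ_AH I hI))).e.injective
    refine Eq.trans ?_ key.symm
    refine (LinearEquiv.apply_symm_apply _ _).trans ?_
    refine Eq.trans ?_ (congrArg (fun M => Matrix.mulVec M (v : Fin 4 → R)) (BR_D I hI g))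
    exact Matrix.mulVec_mulVec (v : Fin 4 → R) (BR I hI) ((DM g).map (cst R)))
theorem good_Dk : Good (Dk k) := by
  let p : Polynomial k := Polynomial.X ^ 2 + 1
  let R := p.SplittingField
  haveI : CharP R 3 := charP_of_injective_algebraMap (algebraMap k R).injective 3
  have hd : p.degree = 2 := by
    have : p = Polynomial.X ^ 2 + Polynomial.C 1 := by simp [p]
    rw [this, Polynomial.degree_X_pow_add_C (by norm_num)]; rfl
  obtain ⟨I, hI⟩ := (Polynomial.SplittingField.splits p).exists_eval_eq_zero (by rw [Polynomial.degree_map, hd]; norm_num)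
  have hI' : I * I = -1 := by
    simp [p] at hI
    linear_combination hI
  refine descent (R := R) (Dk k) ?_
  refine Good.iso ?_ (bcD (k := k) (R := R) ≪≫ DkV I hI')
  exact good_D _ (θ9 I hI') (E3 I hI')
end
end A7

namespace A7
def pq (g : PP) (x : Fin 7) : Fin 7 :=
  if x.val < 3 then ⟨(x.val + g.toAdd.1.val) % 3, by omega⟩ else if x.val < 6 then ⟨3 + (x.val + g.toAdd.2.val) % 3, by omega⟩ else 6
theorem pq_eq : ∀ y : PP × Fin 7, ψ0 y.1 y.2 = pq y.1 y.2 := by decide +kernel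
abbrev TT := Fin 7 × Fin 7
def pT (g : PP) (p : TT) : TT := (pq g p.1, pq g p.2)
theorem pT_eq (g : PP) (p : TT) : ψ g • p = pT g p := Prod.ext (pq_eq (g, p.1)) (pq_eq (g, p.2))
theorem pT_inv (g : PP) (p : TT) : (ψ g)⁻¹ • p = pT g⁻¹ p := by rw [← map_inv, pT_eq]
section
variable {F : Type} [Field F] [CharP F 3]
theorem kill (v : TT → ZMod 3) (u : Fin 7 → ZMod 3) (h : ∀ x : TT, x.1 < x.2 → v x + v x.swap = u x.1 + u x.2) (f : TT → F) (hf : f ∈ V14' F) :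
    ∑ x, cst F (v x) * f x = 0 := by
  obtain ⟨hs, hd, hr⟩ := (mem_V14 F f).1 hf
  have e1 : ∑ x : TT, cst F (v x) * f x = ∑ x : TT, cst F (v x.swap) * f x := by
    rw [← Equiv.sum_comp (Equiv.prodComm (Fin 7) (Fin 7))]
    refine Finset.sum_congr rfl fun x _ => ?_
    show cst F (v x.swap) * f (x.2, x.1) = cst F (v x.swap) * f (x.1, x.2)
    rw [hs]
  have e2 : ∑ x : TT, cst F (v x) * f x + ∑ x : TT, cst F (v x.swap) * f x = ∑ x : TT, (cst F (u x.1) + cst F (u x.2)) * f x := by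
    rw [← Finset.sum_add_distrib]
    refine Finset.sum_congr rfl fun x _ => ?_
    rw [← add_mul, ← map_add, ← map_add]
    rcases lt_trichotomy x.1 x.2 with hx | hx | hx
    · rw [h x hx]
    · rw [show f x = 0 by rw [show x = (x.1, x.1) from Prod.ext rfl hx.symm]; exact hd _]; simp
    · have := h x.swap hx
      rw [Prod.swap_swap, add_comm] at this
      rw [this, Prod.fst_swap, Prod.snd_swap, add_comm (u x.2)]
  have e3 : ∑ x : TT, (cst F (u x.1) + cst F (u x.2)) * f x = 0 := by
    simp only [add_mul, Finset.sum_add_distrib]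
    have a1 : ∑ x : TT, cst F (u x.1) * f x = 0 := by
      rw [Fintype.sum_prod_type]
      refine Finset.sum_eq_zero fun a _ => ?_
      dsimp only
      rw [← Finset.mul_sum, hr, mul_zero]
    have a2 : ∑ x : TT, cst F (u x.2) * f x = 0 := by
      rw [Fintype.sum_prod_type_right]
      refine Finset.sum_eq_zero fun a _ => ?_
      dsimp only
      rw [← Finset.mul_sum, Finset.sum_congr rfl fun b _ => hs b a, hr, mul_zero]
    rw [a1, a2, add_zero]
  have h3 := h3F F
  rw [← e1, e3] at e2
  linear_combination (∑ x : TT, cst F (v x) * f x) * h3 - e2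
structure ZR (κ : Type) [Fintype κ] [DecidableEq κ] where
  D : PP → Matrix κ κ (ZMod 3)
  one : D 1 = 1
  mul : ∀ x : PP × PP, D (x.1 * x.2) = D x.1 * D x.2
variable {κ : Type} [Fintype κ] [DecidableEq κ]
variable (F) in
noncomputable def ZR.rep (z : ZR κ) : FDRep F PP := mRep (fun g => (z.D g).map (cst F))
  (by rw [z.one, Matrix.map_one _ (map_zero _) (map_one _)]) (fun a b => by rw [z.mul (a, b), Matrix.map_mul])
noncomputable def mvl {α β : Type} [Fintype β] (F : Type) [Field F] [CharP F 3] (A : Matrix α β (ZMod 3)) : (β → F) →ₗ[F] (α → F) := Matrix.mulVecLin (A.map (cst F))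
theorem mv_apply {α β : Type} [Fintype β] (A : Matrix α β (ZMod 3)) (f : β → F) (i : α) : mvl F A f i = ∑ j, cst F (A i j) * f j := rfl
theorem mv_mv {α β γ : Type} [Fintype β] [Fintype γ] (A : Matrix α β (ZMod 3)) (B : Matrix β γ (ZMod 3)) (f : γ → F) : mvl F A (mvl F B f) = mvl F (A * B) f := by
  show Matrix.mulVec _ (Matrix.mulVec _ _) = Matrix.mulVec _ _
  rw [Matrix.mulVec_mulVec, Matrix.map_mul]
structure AOk (z : ZR κ) (A : Matrix κ TT (ZMod 3)) (u : PP → κ → Fin 7 → ZMod 3) : Prop where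
  c : ∀ i, ∑ x : TT, (if x.1 = x.2 then 0 else A i x) = 0
  e : ∀ y : (PP × κ) × TT, y.2.1 < y.2.2 → (A y.1.2 (pT y.1.1 y.2) - ∑ j, z.D y.1.1 y.1.2 j * A j y.2) + (A y.1.2 (pT y.1.1 y.2.swap) - ∑ j, z.D y.1.1 y.1.2 j * A j y.2.swap) = u y.1.1 y.1.2 y.2.1 + u y.1.1 y.1.2 y.2.2
structure BOk (z : ZR κ) (B : Matrix TT κ (ZMod 3)) : Prop where
  s : ∀ y : TT × κ, B y.1 y.2 = B y.1.swap y.2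
  d : ∀ y : Fin 7 × κ, B (y.1, y.1) y.2 = 0
  r : ∀ y : Fin 7 × κ, ∑ x, B (y.1, x) y.2 = 0
  e : ∀ y : (PP × κ) × TT, y.2.1 < y.2.2 → (∑ j, B y.2 j * z.D y.1.1 j y.1.2) - B (pT y.1.1⁻¹ y.2) y.1.2 = (∑ j, B (0, 1) j * z.D y.1.1 j y.1.2) - B (pT y.1.1⁻¹ (0, 1)) y.1.2
theorem memC {f : TT → F} (hf : f ∈ V14' F) (h : ∀ x : TT, x.1 < x.2 → f x = f (0, 1)) : (⟨f, hf⟩ : V14' F) ∈ C1' F := by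
  refine ⟨f (0, 1), fun a b hab => ?_⟩
  rcases lt_or_gt_of_ne hab with hx | hx
  · exact h (a, b) hx
  · exact (((mem_V14 F f).1 hf).1 a b).trans (h (b, a) hx)
variable {z : ZR κ} {A : Matrix κ TT (ZMod 3)} {u : PP → κ → Fin 7 → ZMod 3} {B : Matrix TT κ (ZMod 3)}
noncomputable def AL (h : AOk z A u) : (V14' F ⧸ C1' F) →ₗ[F] (κ → F) := (C1' F).liftQ (mvl F A ∘ₗ (V14' F).subtype) (by
  rintro ⟨f, hf⟩ ⟨c, hc⟩
  rw [LinearMap.mem_ker]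
  funext i
  show mvl F A f i = 0
  rw [mv_apply]
  have e : ∀ x : TT, cst F (A i x) * f x = cst F (if x.1 = x.2 then 0 else A i x) * c := fun x => by
    split_ifs with hx
    · rw [show f x = 0 by rw [show x = (x.1, x.1) from Prod.ext rfl hx.symm]; exact ((mem_V14 F f).1 hf).2.1 _]; simp
    · rw [← hc _ _ hx]
  rw [Finset.sum_congr rfl fun x _ => e x, ← Finset.sum_mul, ← map_sum, h.c i, map_zero, zero_mul])
theorem BV (h : BOk z B) (c : κ → F) : mvl F B c ∈ V14' F := by
  refine (mem_V14 F _).2 ⟨fun a b => ?_, fun a => ?_, fun a => ?_⟩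
  · rw [mv_apply, mv_apply]
    exact Finset.sum_congr rfl fun j _ => by rw [h.s ((a, b), j)]; rfl
  · rw [mv_apply]
    exact Finset.sum_eq_zero fun j _ => by rw [h.d (a, j), map_zero, zero_mul]
  · simp only [mv_apply]
    rw [Finset.sum_comm]
    exact Finset.sum_eq_zero fun j _ => by rw [← Finset.sum_mul, ← map_sum, h.r (a, j), map_zero, zero_mul]
noncomputable def BL (h : BOk z B) : (κ → F) →ₗ[F] (V14' F ⧸ C1' F) := (C1' F).mkQ ∘ₗ LinearMap.codRestrict (V14' F) (mvl F B) (BV h)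
theorem mvA (h : AOk z A u) (g : PP) (f : TT → F) (hf : f ∈ V14' F) : mvl F A (fun p => f ((ψ g)⁻¹ • p)) = mvl F (z.D g) (mvl F A f) := by
  rw [mv_mv]
  funext i
  rw [← sub_eq_zero, mv_apply, mv_apply, ← Equiv.sum_comp (MulAction.toPerm (ψ g))]
  rw [← Finset.sum_sub_distrib]
  refine Eq.trans ?_ (kill (fun x => A i (pT g x) - ∑ j, z.D g i j * A j x) (u g i) (fun x hx => h.e ((g, i), x) hx) f hf)
  refine Finset.sum_congr rfl fun x _ => ?_
  rw [MulAction.toPerm_apply, inv_smul_smul, pT_eq, map_sub, sub_mul, Matrix.mul_apply]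
noncomputable def hA (h : AOk z A u) : (Action.res _ ψ).obj (fam13.X F) ⟶ z.rep F :=
  mkHom (X := (Action.res _ ψ).obj (fam13.X F)) (Y := z.rep F) (AL h) (fun g v => by
    obtain ⟨x, rfl⟩ := (C1' F).mkQ_surjective v
    exact mvA h g x.1 x.2)
theorem mvB (h : BOk z B) (g : PP) (c : κ → F) (hf : mvl F B (mvl F (z.D g) c) - (fun p => mvl F B c ((ψ g)⁻¹ • p)) ∈ V14' F) : (⟨_, hf⟩ : V14' F) ∈ C1' F := by
  refine memC hf fun x hx => ?_
  have e : ∀ x : TT, (mvl F B (mvl F (z.D g) c) - (fun p => mvl F B c ((ψ g)⁻¹ • p))) x = ∑ i, cst F ((∑ j, B x j * z.D g j i) - B (pT g⁻¹ x) i) * c i := fun x => by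
    rw [mv_mv, Pi.sub_apply, mv_apply, mv_apply, ← Finset.sum_sub_distrib]
    refine Finset.sum_congr rfl fun i _ => ?_
    rw [pT_inv, map_sub, sub_mul, Matrix.mul_apply]
  rw [e, e]
  refine Finset.sum_congr rfl fun i _ => ?_
  rw [h.e ((g, i), x) hx]
noncomputable def hB (h : BOk z B) : z.rep F ⟶ (Action.res _ ψ).obj (fam13.X F) :=
  mkHom (X := z.rep F) (Y := (Action.res _ ψ).obj (fam13.X F)) (BL h) (fun g v => by
    refine (Submodule.Quotient.eq (C1' F)).2 ?_
    exact mvB h g v ((V14' F).sub_mem (BV h _) (V14_inv F (ψ g) _ (BV h _))))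
end
end A7

namespace A7
def zr1 : ZR (Fin 4) := ⟨DM, by decide +kernel, DM_mul⟩
def dd2 (g : PP) : Matrix PP PP (ZMod 3) := Matrix.of fun p q => if q = g⁻¹ * p then 1 else 0
theorem dd2_l (g : PP) (f : PP → ZMod 3) (p : PP) : ∑ j, dd2 g p j * f j = f (g⁻¹ * p) := by
  simp [dd2]
theorem dd2_r (g : PP) (f : PP → ZMod 3) (p : PP) : ∑ j, f j * dd2 g j p = f (g * p) := by
  simp [dd2, eq_inv_mul_iff_mul_eq]
def zr2 : ZR PP := ⟨dd2, by
    ext p q; simp [dd2, Matrix.one_apply, eq_comm], fun x => by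
    ext p q
    rw [Matrix.mul_apply, dd2_l]
    simp [dd2, mul_assoc, mul_left_comm]⟩
def KK : Matrix (Fin 4) (Fin 7) (ZMod 3) := !![1,0,0,2,0,0,0; 0,1,2,0,0,0,0; 0,0,0,0,2,1,0; 2,2,2,0,0,0,0]
def JJ : Matrix (Fin 7) (Fin 4) (ZMod 3) := !![1,0,0,0; 1,2,0,1; 1,1,0,1; 0,0,0,0; 0,0,1,2; 0,0,2,2; 0,0,0,0]
def MA1 : Matrix (Fin 4) TT (ZMod 3) := fun i x => if x.1 = 6 then KK i x.2 else 0
def uu1 (g : PP) (i : Fin 4) (a : Fin 7) : ZMod 3 := if a = 6 then (if i = 0 then g.toAdd.2 * g.toAdd.2 else if i = 2 then 2 * g.toAdd.2 else 0) else 0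
def MB1 : Matrix TT (Fin 4) (ZMod 3) := fun x i => if x.1 = x.2 then 0 else if x.1 = 6 then JJ x.2 i else if x.2 = 6 then JJ x.1 i else -(JJ x.1 i + JJ x.2 i)
def bz (b : Prop) [Decidable b] : ZMod 3 := if b then 1 else 0
def pα (p : PP) : ℕ := p.toAdd.1.val
def pβ (p : PP) : ℕ := 3 + p.toAdd.2.val
def MA2 : Matrix PP TT (ZMod 3) := fun p x => bz (x.1.val = pα p ∧ x.2.val = pβ p) + bz (x.1 = 6 ∧ x.2.val = pα p) + bz (x.1 = 6 ∧ x.2.val = pβ p)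
def MB2 : Matrix TT PP (ZMod 3) := fun x p => if x.1 = x.2 ∨ x.1 = 6 ∨ x.2 = 6 then 0 else
  if x.1 < 3 ∧ x.2 < 3 then 1 + bz (x.1.val + x.2.val + pα p = 3) else
  if 3 ≤ x.1 ∧ 3 ≤ x.2 then 1 + bz (x.1.val + x.2.val + pβ p = 12) else
  if x.1 < 3 then bz (x.1.val = pα p ∧ x.2.val = pβ p) else bz (x.2.val = pα p ∧ x.1.val = pβ p)
set_option maxHeartbeats 4000000
theorem aok1 : AOk zr1 MA1 uu1 := ⟨by decide +kernel, by decide +kernel⟩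
theorem bok1 : BOk zr1 MB1 := ⟨by decide +kernel, by decide +kernel, by decide +kernel, by decide +kernel⟩
theorem aok2 : AOk zr2 MA2 (fun _ _ _ => 0) := by
  have h : ∀ y : (PP × PP) × TT, y.2.1 < y.2.2 → (MA2 y.1.2 (pT y.1.1 y.2) - MA2 (y.1.1⁻¹ * y.1.2) y.2) + (MA2 y.1.2 (pT y.1.1 y.2.swap) - MA2 (y.1.1⁻¹ * y.1.2) y.2.swap) = 0 := by decide +kernel
  refine ⟨by decide +kernel, fun y hy => ?_⟩
  have e := fun x => dd2_l y.1.1 (fun j => MA2 j x) y.1.2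
  exact (congrArg₂ (fun s t => (MA2 y.1.2 (pT y.1.1 y.2) - s) + (MA2 y.1.2 (pT y.1.1 y.2.swap) - t)) (e _) (e _)).trans ((h y hy).trans (add_zero _).symm)
theorem bok2 : BOk zr2 MB2 := by
  have h : ∀ y : (PP × PP) × TT, y.2.1 < y.2.2 → MB2 y.2 (y.1.1 * y.1.2) = MB2 (pT y.1.1⁻¹ y.2) y.1.2 := by decide +kernel
  refine ⟨by decide +kernel, by decide +kernel, by decide +kernel, fun y hy => ?_⟩
  have e := fun x => dd2_r y.1.1 (fun j => MB2 x j) y.1.2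
  have h0 := h (y.1, (0, 1)) (show (0 : Fin 7) < 1 by decide)
  exact ((congrArg (· - _) (e _)).trans (sub_eq_zero.2 (h y hy))).trans ((congrArg (· - _) (e _)).trans (sub_eq_zero.2 h0)).symm
end A7

namespace A7
def EE (p q : TT) : ZMod 3 := (∑ i, MB1 p i * MA1 i q) + (∑ i, MB2 p i * MA2 i q) - if p = q then 1 else 0
def utab : ℕ := 1459650989163426979258627319790362298428630188153252242946942377937666996298455878780657653048513226668747291620449023611006604335063933797
def ut (x : TT) (c : Fin 7) : ZMod 3 := ((utab / 3 ^ ((x.1.val * 7 + x.2.val) * 7 + c.val) % 3 : ℕ) : ZMod 3)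
def eS (p q : TT) : ZMod 3 := EE p q + EE p q.swap
set_option maxHeartbeats 4000000
theorem E_id : ∀ y : TT × TT, y.1.1 < y.1.2 → y.2.1 < y.2.2 → eS y.1 y.2 - eS (0, 1) y.2 = ut y.1 y.2.1 + ut y.1 y.2.2 := by decide +kernel
end A7

namespace A7
section
variable {F : Type} [Field F] [CharP F 3]
theorem E_app (f : TT → F) (x : TT) : mvl F MB1 (mvl F MA1 f) x + mvl F MB2 (mvl F MA2 f) x - f x = ∑ q, cst F (EE x q) * f q := by
  rw [mv_mv, mv_mv, mv_apply, mv_apply, ← Finset.sum_add_distrib]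
  have : f x = ∑ q, cst F (if x = q then 1 else 0) * f q := by simp [apply_ite (cst F)]
  rw [this, ← Finset.sum_sub_distrib]
  refine Finset.sum_congr rfl fun q _ => ?_
  rw [← add_mul, ← sub_mul, ← map_add, ← map_sub]; rfl
theorem E_mem (f : TT → F) (hf : f ∈ V14' F) (h : mvl F MB1 (mvl F MA1 f) + mvl F MB2 (mvl F MA2 f) - f ∈ V14' F) : (⟨_, h⟩ : V14' F) ∈ C1' F := by
  refine memC h fun x hx => ?_
  refine (E_app f x).trans (Eq.trans ?_ (E_app f (0, 1)).symm)
  rw [← sub_eq_zero, ← Finset.sum_sub_distrib]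
  refine Eq.trans ?_ (kill (fun q => EE x q - EE (0, 1) q) (ut x) (fun y hy => ?_) f hf)
  · exact Finset.sum_congr rfl fun q _ => by rw [map_sub, sub_mul]
  · rw [← E_id (x, y) hx hy]; simp only [eS]; ring
theorem hAB : hA (F := F) aok1 ≫ hB bok1 + hA aok2 ≫ hB bok2 = 𝟙 ((Action.res _ ψ).obj (fam13.X F)) := by
  apply toLin_inj
  rw [toLin_add]
  refine LinearMap.ext fun v => ?_
  obtain ⟨x, rfl⟩ := (C1' F).mkQ_surjective v
  refine (Submodule.Quotient.eq (C1' F)).2 ?_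
  exact E_mem x.1 x.2 ((V14' F).sub_mem ((V14' F).add_mem (BV bok1 _) (BV bok2 _)) x.2)
noncomputable def zr2_iso : zr2.rep F ≅ fnRep F PP PP := mkIso (X := zr2.rep F) (Y := fnRep F PP PP) (LinearEquiv.refl F (PP → F)) (fun g v => by
  have key : ∀ (v : PP → F) (w : PP), mvl F (dd2 g) v w = v (g⁻¹ * w) := fun v w => by
    rw [mv_apply]
    simp [dd2, apply_ite (cst F)]
  funext w
  exact key v w)
theorem good13 : Good ((Action.res _ ψ).obj (fam13.X F)) := by
  obtain ⟨L, h1, h2⟩ := good_Dk (k := F)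
  have hP : ∀ z : FDRep F PP, z = fnRep F PP PP → z ∈ L ++ [fnRep F PP PP] := fun z hz => by simp [hz]
  have hL : ∀ z : FDRep F PP, z ∈ L → z ∈ L ++ [fnRep F PP PP] := fun z hz => by simp [hz]
  refine ⟨L ++ [fnRep F PP PP], ?_, fun z hz => ?_⟩
  · refine InAdd.of_two _ _ _ _ hAB (h1.mono hL) ?_
    exact (InAdd.of_mem (hP _ rfl)).iso zr2_iso
  · rcases List.mem_append.1 hz with hz | hz
    · refine InAdd.of_two (z ◁ hA aok1) (z ◁ hB bok1) (z ◁ hA aok2) (z ◁ hB bok2) ?_ ((h2 z hz).mono hL) ?_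
      · rw [← MonoidalCategory.whiskerLeft_comp, ← MonoidalCategory.whiskerLeft_comp, ← MonoidalPreadditive.whiskerLeft_add, hAB, MonoidalCategory.whiskerLeft_id]
      · exact ((kP_right z).mono hP).iso (whiskerLeftIso z zr2_iso)
    · rw [List.mem_singleton.1 hz]
      exact (kP_left _).mono hP
end
end A7

namespace A7
theorem goodFs (F : Type) [Field F] [CharP F 3] (j : Fin 9) : Good ((Action.res _ ψ).obj ((Fs j).X F)) := by
  fin_cases j
  · exact good1
  · exact good_tw _ good1
  · exact good6
  · exact good_tw _ good6
  · exact good13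
  · exact good_tw _ good13
  · exact good15
  · exact good_tw _ good15
  · exact good20
end A7
/-- Every simple module in characteristic `3` for `alternatingGroup (Fin 7)` is algebraic. -/
theorem alt7_char3_simple_algebraic (k : Type) [Field k] (hk : CharP k 3)
    (M : FDRep k (alternatingGroup (Fin 7))) (hM : Simple M) : IsAlgebraic M := by
  obtain ⟨N, hN, i, r, hir⟩ := A7.exists_S7 M hM
  obtain ⟨j, ⟨e⟩⟩ := A7.classify' k N hN
  have h1 : A7.Good ((Action.res _ A7.ψ).obj N) := A7.Good.iso (A7.goodFs k j) ((Action.res _ A7.ψ).mapIso e.symm)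
  have h2 : A7.Good ((Action.res _ A7.φP).obj ((Action.res _ A7.aι).obj N)) := h1
  refine A7.algebraic_of_good A7.φP M (A7.φP_idx k) (h2.retract ((Action.res _ A7.φP).map i) ((Action.res _ A7.φP).map r) ?_)
  rw [← CategoryTheory.Functor.map_comp, hir, CategoryTheory.Functor.map_id]
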